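/- arXiv:2407.03002 — 2 statements merged into one kernel-verified Lean document; each statement's English description precedes it below -/
import Mathlib

section
/- Lehmer's conjecture holds, i.e. τ(n) ≠ 0 for every integer n ≥ 1, if and only if for every integer m ≥ 0 the rational function R_{2m}(v) has a pole at v = 1/(2m+2). -/
open Polynomial Filter Topology

noncomputable section

/-- Derivative of a rational function. -/
def ratDeriv (f : RatFunc ℚ) : RatFunc ℚ :=
  RatFunc.mk (Polynomial.derivative f.num * f.denom - f.num * Polynomial.derivative f.denom)
    (f.denom ^ 2)

section ModularPart

open UpperHalfPlane hiding I
open ModularForm EisensteinSeries Complex Derivative Function Real MatrixGroups Manifold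
open scoped ModularForm

/-- The product `∏ (1 - q^(k+1))^24`. -/
def prodFn (q : ℂ) : ℂ := ∏' k : ℕ, (1 - q ^ (k + 1)) ^ 24

/-- Euler operator `q d/dq` on functions. -/
def eul (F : ℂ → ℂ) (q : ℂ) : ℂ := q * deriv F q

/-- `E₂` as a function of `q`. -/
def eFn (q : ℂ) : ℂ := 1 + eul prodFn q / prodFn q

lemma prodFn_diff : DifferentiableOn ℂ prodFn (Metric.ball 0 1) :=
  differentiableOn_tprod_one_sub_pow_pow 24

lemma prodFn_eq {q : ℂ} (hq : ‖q‖ < 1) : prodFn q = (∏' k : ℕ, (1 - q ^ (k + 1))) ^ 24 :=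
  (multipliable_one_sub_pow hq).tprod_pow 24

lemma prodFn_ne_zero {q : ℂ} (hq : ‖q‖ < 1) : prodFn q ≠ 0 := by
  rw [prodFn_eq hq]
  apply pow_ne_zero
  have := tprod_one_add_ne_zero_of_summable (f := fun n : ℕ ↦ -q ^ (n + 1)) ?_ ?_
  · simpa [sub_eq_add_neg] using this
  · intro i h
    have h1 : q ^ (i + 1) = 1 := by linear_combination -h
    have h2 : ‖q‖ ^ (i + 1) = 1 := by rw [← norm_pow, h1, norm_one]
    have := pow_lt_one₀ (norm_nonneg q) hq (Nat.succ_ne_zero i)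
    simp at this
    linarith
  · simpa [← summable_norm_iff] using
      (summable_nat_add_iff 1).mpr (summable_geometric_of_lt_one (norm_nonneg _) hq)

lemma eul_diff {F : ℂ → ℂ} (hF : DifferentiableOn ℂ F (Metric.ball 0 1)) :
    DifferentiableOn ℂ (eul F) (Metric.ball 0 1) :=
  differentiableOn_id.mul (hF.deriv Metric.isOpen_ball)

lemma eFn_diff : DifferentiableOn ℂ eFn (Metric.ball 0 1) := by
  refine (differentiableOn_const 1).add ((eul_diff prodFn_diff).div prodFn_diff ?_)
  intro q hq
  exact prodFn_ne_zero (by simpa using hq)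

lemma qmem (z : ℍ) : Function.Periodic.qParam 1 (z : ℂ) ∈ Metric.ball (0 : ℂ) 1 := by
  simpa using norm_qParam_lt_one 1 z

lemma D_of_q {G : ℂ → ℂ} (hG : DifferentiableOn ℂ G (Metric.ball 0 1)) (g : ℍ → ℂ)
    (hg : ∀ z : ℍ, g z = G (Function.Periodic.qParam 1 z)) (z : ℍ) :
    normalizedDerivOfComplex g z = eul G (Function.Periodic.qParam 1 z) := by
  have h1 : (g ∘ ofComplex) =ᶠ[𝓝 (z : ℂ)] (G ∘ Function.Periodic.qParam 1) := by
    filter_upwards [isOpen_upperHalfPlaneSet.mem_nhds z.2] with w hw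
    simp only [Function.comp_apply, hg, ofComplex_apply_of_im_pos hw]
  have h2 := (hG.differentiableAt (Metric.isOpen_ball.mem_nhds (qmem z))).hasDerivAt
  have h3 : HasDerivAt (Function.Periodic.qParam 1)
      (2 * π * I * Function.Periodic.qParam 1 z) (z : ℂ) := by
    have : HasDerivAt (fun w : ℂ => cexp (2 * π * I * w / (1 : ℝ)))
      (cexp (2 * π * I * z / (1 : ℝ)) * (2 * π * I * 1 / (1 : ℝ))) (z : ℂ) :=
        (((hasDerivAt_id (z : ℂ)).const_mul (2 * π * I)).div_const _).cexp
    have e : Function.Periodic.qParam 1 = fun w : ℂ => cexp (2 * π * I * w / (1 : ℝ)) := rfl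
    rw [e]
    convert this using 1
    simp; ring
  have h4 := (h2.comp (z : ℂ) h3).deriv
  unfold normalizedDerivOfComplex eul
  rw [h1.deriv_eq, h4]
  have : (2 * π * I : ℂ) ≠ 0 := two_pi_I_ne_zero
  field_simp

lemma E2_eq (z : ℍ) : E2 z = eFn (Function.Periodic.qParam 1 z) := by
  have h0 := logDeriv_eta_eq_E2 z
  have hd := differentiableAt_eta_of_mem_upperHalfPlaneSet z.2
  have hdisc : ∀ w : ℍ, ModularForm.discriminant w =
      (fun q => q * prodFn q) (Function.Periodic.qParam 1 w) := by
    intro w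
    rw [discriminant_eq_q_prod]
    simp [prodFn, eta_q_eq_pow, Function.Periodic.qParam]
  have hdiff : DifferentiableOn ℂ (fun q => q * prodFn q) (Metric.ball 0 1) :=
    differentiableOn_id.mul prodFn_diff
  have h1 := D_of_q hdiff _ hdisc z
  have h2 : normalizedDerivOfComplex ModularForm.discriminant z
      = E2 z * ModularForm.discriminant z := by
    unfold normalizedDerivOfComplex
    have h3 : (ModularForm.discriminant ∘ ofComplex) =ᶠ[𝓝 (z : ℂ)] fun w => ModularForm.eta w ^ 24 := by
      filter_upwards [isOpen_upperHalfPlaneSet.mem_nhds z.2] with w hw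
      simp [ModularForm.discriminant, ofComplex_apply_of_im_pos hw]
    rw [h3.deriv_eq]
    have h4 : deriv (fun w => ModularForm.eta w ^ 24) (z : ℂ) = 24 * ModularForm.eta z ^ 23 * deriv ModularForm.eta z := by
      simpa using (hd.hasDerivAt.fun_pow 24).deriv
    rw [h4]
    have hne := eta_ne_zero z.2
    have h5 : deriv ModularForm.eta z = (π * I / 12) * E2 z * ModularForm.eta z := by
      rw [← h0, logDeriv_apply]; field_simp
    rw [h5]
    simp only [ModularForm.discriminant]
    have : (π : ℂ) ≠ 0 := by exact_mod_cast Real.pi_ne_zero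
    have := I_ne_zero
    field_simp
    ring
  rw [h2, hdisc] at h1
  have hq := qmem z
  have hq0 : Function.Periodic.qParam 1 (z : ℂ) ≠ 0 := Function.Periodic.qParam_ne_zero _
  have hp := prodFn_ne_zero (q := Function.Periodic.qParam 1 z) (by simpa using hq)
  generalize Function.Periodic.qParam 1 (z : ℂ) = q at *
  have h6 : deriv (fun q => q * prodFn q) q = prodFn q + q * deriv prodFn q := by
    have := (hasDerivAt_id q).mul
      (prodFn_diff.differentiableAt (Metric.isOpen_ball.mem_nhds hq)).hasDerivAt
    have h7 := this.deriv
    simp only [id, one_mul] at h7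
    exact h7
  simp only [eul, eFn, h6] at h1 ⊢
  field_simp
  have : q * (E2 z * prodFn q) = q * (prodFn q + q * deriv prodFn q) := by
    linear_combination h1
  have := mul_left_cancel₀ hq0 this
  linear_combination this

/-- `A = E₂² - 12 θE₂` -/
def aFn (q : ℂ) : ℂ := eFn q ^ 2 - 12 * eul eFn q
/-- `B = E₂ A - 3 θA` -/
def bFn (q : ℂ) : ℂ := eFn q * aFn q - 3 * eul aFn q
/-- the difference of two weight 8 forms -/
def cFn (q : ℂ) : ℂ := eFn q * bFn q - 2 * eul bFn q - aFn q ^ 2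

lemma aFn_diff : DifferentiableOn ℂ aFn (Metric.ball 0 1) :=
  (eFn_diff.pow 2).sub ((eul_diff eFn_diff).const_mul 12)
lemma bFn_diff : DifferentiableOn ℂ bFn (Metric.ball 0 1) :=
  (eFn_diff.mul aFn_diff).sub ((eul_diff aFn_diff).const_mul 3)
lemma cFn_diff : DifferentiableOn ℂ cFn (Metric.ball 0 1) :=
  ((eFn_diff.mul bFn_diff).sub ((eul_diff bFn_diff).const_mul 2)).sub (aFn_diff.pow 2)

lemma cFn_zero : cFn 0 = 0 := by simp [cFn, bFn, aFn, eul, eFn]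

/-- pull back to the upper half plane -/
def pull (G : ℂ → ℂ) (z : ℍ) : ℂ := G (Function.Periodic.qParam 1 z)

lemma pull_mdiff {G : ℂ → ℂ} (hG : DifferentiableOn ℂ G (Metric.ball 0 1)) :
    MDiff (pull G) := by
  rw [UpperHalfPlane.mdifferentiable_iff]
  have : DifferentiableOn ℂ (G ∘ Function.Periodic.qParam 1) upperHalfPlaneSet :=
    hG.comp (by unfold Function.Periodic.qParam; fun_prop) (fun z hz => qmem ⟨z, hz⟩)
  refine this.congr fun z hz => ?_
  simp [pull, ofComplex_apply_of_im_pos hz]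

lemma D_pull {G : ℂ → ℂ} (hG : DifferentiableOn ℂ G (Metric.ball 0 1)) :
    normalizedDerivOfComplex (pull G) = pull (eul G) := by
  ext z
  exact D_of_q hG _ (fun _ => rfl) z

lemma E2_pull : E2 = pull eFn := funext E2_eq

lemma aFn_slash (γ : SL(2, ℤ)) : pull aFn ∣[(4 : ℤ)] γ = pull aFn := by
  have hA : pull aFn = E2 * E2 - (12 : ℂ) • normalizedDerivOfComplex E2 := by
    rw [E2_pull, D_pull eFn_diff]; ext z; simp [pull, aFn]; ring
  have h1 := normalizedDerivOfComplex_SL_slash (k := 2) (γ := γ) E2_mdifferentiable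
  have hE2 := E2_slash_action γ
  have h2 := ModularForm.mul_slash_SL2 2 2 γ E2 E2
  rw [hA, sub_eq_add_neg, SlashAction.add_slash, SlashAction.neg_slash, ModularForm.SL_smul_slash]
  have hder (z : ℍ) : HasDerivAt (D2 γ ∘ ofComplex)
      (- (2 * π * I) * (γ 1 0 / denom γ z) ^ 2) (z : ℂ) := by
    have e1 : (D2 γ ∘ ofComplex) =ᶠ[𝓝 (z : ℂ)]
        fun w => (2 * π * I * γ 1 0) / ((γ 1 0 : ℂ) * w + γ 1 1) := by
      filter_upwards [isOpen_upperHalfPlaneSet.mem_nhds z.2] with w hw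
      have e2 := ModularGroup.denom_apply γ ⟨w, hw⟩
      simp only [Function.comp_apply, D2, ofComplex_apply_of_im_pos hw, e2]
    have e2 : denom γ z = (γ 1 0 : ℂ) * z + γ 1 1 := by simp [ModularGroup.denom_apply]
    have e3 : (γ 1 0 : ℂ) * z + γ 1 1 ≠ 0 := by rw [← e2]; exact denom_ne_zero _ _
    refine HasDerivAt.congr_of_eventuallyEq ?_ e1
    have e4 : HasDerivAt (fun w : ℂ => (γ 1 0 : ℂ) * w + γ 1 1) (γ 1 0 : ℂ) (z : ℂ) := by
      simpa using ((hasDerivAt_id (z : ℂ)).const_mul (γ 1 0 : ℂ)).add_const (γ 1 1 : ℂ)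
    have e5 := (hasDerivAt_const (z : ℂ) (2 * π * I * γ 1 0)).fun_div e4 e3
    refine e5.congr_deriv ?_
    rw [e2]; field_simp; ring
  have h3 : normalizedDerivOfComplex (E2 ∣[(2 : ℤ)] γ) = normalizedDerivOfComplex E2 -
    (1 / (2 * riemannZeta 2)) • normalizedDerivOfComplex (D2 γ) := by
    have hD2 : MDiff (D2 γ) := by
      rw [UpperHalfPlane.mdifferentiable_iff]
      intro w hw
      have e := hder ⟨w, hw⟩
      exact e.differentiableAt.differentiableWithinAt
    rw [hE2, normalizedDerivOfComplex_sub _ _ E2_mdifferentiable (hD2.const_smul _),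
      normalizedDerivOfComplex_smul _ _ hD2]
  have h4 (z : ℍ) : normalizedDerivOfComplex (D2 γ) z = - (γ 1 0 / denom γ z) ^ 2 := by
    unfold normalizedDerivOfComplex
    rw [(hder z).deriv]
    have := two_pi_I_ne_zero
    field_simp
  ext z
  have h1' := congrFun h1 z
  have h2' := congrFun h2 z
  have h3' := congrFun h3 z
  have hE2' := congrFun hE2 z
  simp only [Pi.sub_apply, Pi.smul_apply, Pi.mul_apply, smul_eq_mul, Pi.add_apply, Pi.neg_apply, h4] at *
  norm_num at h1' h2' ⊢
  rw [h2']
  rw [hE2'] at *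
  rw [h3'] at h1'
  have hpi : (π : ℂ) ≠ 0 := by exact_mod_cast Real.pi_ne_zero
  have hD : D2 γ z = 2 * π * I * (γ 1 0 / denom γ z) := by simp only [D2]; ring
  rw [hD, riemannZeta_two] at h1' ⊢
  generalize ((γ 1 0 : ℤ) : ℂ) / denom γ z = w at *
  have hI := I_sq
  field_simp at h1' ⊢
  grind

lemma bFn_slash (γ : SL(2, ℤ)) : pull bFn ∣[(6 : ℤ)] γ = pull bFn := by
  have h := serreDerivative_slash_invariant (k := 4) (pull_mdiff aFn_diff) (aFn_slash γ)
  have h2 : pull bFn = (-3 : ℂ) • serreDerivative (4 : ℤ) (pull aFn) := by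
    ext z
    simp only [serreDerivative_eq, D_pull aFn_diff, Pi.smul_apply, E2_pull, smul_eq_mul]
    simp only [pull, bFn]; push_cast; ring
  rw [h2, ModularForm.SL_smul_slash]
  congr 1

lemma cFn_slash (γ : SL(2, ℤ)) : pull cFn ∣[(8 : ℤ)] γ = pull cFn := by
  have h := serreDerivative_slash_invariant (k := 6) (pull_mdiff bFn_diff) (bFn_slash γ)
  have h2 : pull cFn = (-2 : ℂ) • serreDerivative (6 : ℤ) (pull bFn) - pull aFn * pull aFn := by
    ext z
    simp only [serreDerivative_eq, D_pull bFn_diff, Pi.smul_apply, E2_pull, smul_eq_mul,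
      Pi.sub_apply, Pi.mul_apply]
    simp only [pull, cFn]; push_cast; ring
  have h3 := ModularForm.mul_slash_SL2 4 4 γ (pull aFn) (pull aFn)
  rw [aFn_slash] at h3
  rw [h2, sub_eq_add_neg, SlashAction.add_slash, SlashAction.neg_slash, ModularForm.SL_smul_slash]
  congr 1
  · congr 1
  · congr 1

/-- the weight-8 cusp form which vanishes -/
def cForm : CuspForm 𝒮ℒ 8 where
  toFun := pull cFn
  slash_action_eq' A hA := by
    obtain ⟨A, rfl⟩ := hA
    exact cFn_slash A
  holo' := pull_mdiff cFn_diff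
  zero_at_cusps' hc := by
    rw [Subgroup.IsArithmetic.isCusp_iff_isCusp_SL2Z] at hc
    rw [OnePoint.isZeroAt_iff_forall_SL2Z hc]
    intro γ _
    rw [cFn_slash]
    have h1 : Tendsto cFn (𝓝 0) (𝓝 (cFn 0)) :=
      (cFn_diff.differentiableAt (Metric.isOpen_ball.mem_nhds (Metric.mem_ball_self one_pos))).continuousAt
    rw [cFn_zero] at h1
    exact h1.comp (qParam_tendsto_atImInfty zero_lt_one)

lemma cFn_eq_zero {q : ℂ} (hq : ‖q‖ < 1) : cFn q = 0 := by
  by_cases h0 : q = 0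
  · rw [h0, cFn_zero]
  have h1 : cForm = 0 :=
    rank_zero_iff_forall_zero.mp (CuspForm.rank_eq_zero_of_weight_lt_twelve (by norm_num)) _
  have him : 0 < (Function.Periodic.invQParam 1 q).im :=
    Function.Periodic.im_invQParam_pos_of_norm_lt_one one_pos hq h0
  have h2 : cForm ⟨_, him⟩ = 0 := by rw [h1]; rfl
  change cFn (Function.Periodic.qParam 1 (Function.Periodic.invQParam 1 q)) = 0 at h2
  rwa [Function.Periodic.qParam_right_inv one_ne_zero h0] at h2

end ModularPart

section EulerD
open scoped PowerSeries Nat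

/-- The Euler derivation `X d/dX`. -/
def eD : Derivation ℂ ℂ⟦X⟧ ℂ⟦X⟧ := (PowerSeries.X : ℂ⟦X⟧) • d⁄dX ℂ

lemma eD_apply (p : ℂ⟦X⟧) : eD p = PowerSeries.X * d⁄dX ℂ p := rfl

lemma eD_coeff (p : ℂ⟦X⟧) (n : ℕ) :
    PowerSeries.coeff n (eD p) = n * PowerSeries.coeff n p := by
  rw [eD_apply]
  cases n with
  | zero => simp
  | succ n =>
    rw [PowerSeries.coeff_succ_X_mul, PowerSeries.coeff_derivative]
    push_cast; ring

lemma eD_mul (p q : ℂ⟦X⟧) : eD (p * q) = p * eD q + q * eD p := by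
  simp [Derivation.leibniz]

end EulerD

section TaylorPart
open scoped PowerSeries Nat

lemma eD_expand (p : ℂ⟦X⟧) :
    eD (PowerSeries.expand 2 two_ne_zero p) = 2 * PowerSeries.expand 2 two_ne_zero (eD p) := by
  ext n
  have h2 : (2 : ℂ⟦X⟧) = PowerSeries.C 2 := (map_ofNat (PowerSeries.C (R := ℂ)) 2).symm
  rw [eD_coeff, h2, PowerSeries.coeff_C_mul]
  by_cases h : 2 ∣ n
  · obtain ⟨k, rfl⟩ := h
    rw [PowerSeries.coeff_expand_mul, PowerSeries.coeff_expand_mul, eD_coeff]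
    push_cast; ring
  · rw [PowerSeries.coeff_expand_of_not_dvd _ _ _ h, PowerSeries.coeff_expand_of_not_dvd _ _ _ h]
    simp

/-- Taylor series at zero. -/
def tay (F : ℂ → ℂ) : ℂ⟦X⟧ := PowerSeries.mk fun n => iteratedDeriv n F 0 / n !

lemma tay_coeff (F : ℂ → ℂ) (n : ℕ) :
    PowerSeries.coeff n (tay F) = iteratedDeriv n F 0 / n ! := by simp [tay]

lemma cd_of_diff {F : ℂ → ℂ} (hF : DifferentiableOn ℂ F (Metric.ball 0 1)) (n : ℕ) :
    ContDiffAt ℂ n F 0 :=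
  (hF.analyticAt (Metric.ball_mem_nhds 0 one_pos)).contDiffAt

lemma tay_congr {F G : ℂ → ℂ} (h : ∀ q : ℂ, ‖q‖ < 1 → F q = G q) : tay F = tay G := by
  ext n
  rw [tay_coeff, tay_coeff]
  have : F =ᶠ[𝓝 0] G := by
    filter_upwards [Metric.ball_mem_nhds (0 : ℂ) one_pos] with q hq
    exact h q (by simpa using hq)
  rw [this.iteratedDeriv_eq]

lemma tay_mul {F G : ℂ → ℂ} (hF : DifferentiableOn ℂ F (Metric.ball 0 1))
    (hG : DifferentiableOn ℂ G (Metric.ball 0 1)) :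
    tay (fun q => F q * G q) = tay F * tay G := by
  ext n
  rw [tay_coeff, iteratedDeriv_fun_mul (cd_of_diff hF n) (cd_of_diff hG n), PowerSeries.coeff_mul,
    Finset.Nat.sum_antidiagonal_eq_sum_range_succ_mk, Finset.sum_div]
  refine Finset.sum_congr rfl fun i hi => ?_
  have hi : i ≤ n := by simpa [Nat.lt_succ_iff] using hi
  rw [tay_coeff, tay_coeff, Nat.cast_choose ℂ hi]
  have := Nat.factorial_ne_zero n
  field_simp

lemma tay_sub {F G : ℂ → ℂ} (hF : DifferentiableOn ℂ F (Metric.ball 0 1))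
    (hG : DifferentiableOn ℂ G (Metric.ball 0 1)) :
    tay (fun q => F q - G q) = tay F - tay G := by
  ext n
  rw [tay_coeff, iteratedDeriv_fun_sub (cd_of_diff hF n) (cd_of_diff hG n), map_sub, tay_coeff,
    tay_coeff]
  ring

lemma tay_cmul (F : ℂ → ℂ) (c : ℂ) :
    tay (fun q => c * F q) = PowerSeries.C c * tay F := by
  ext n
  rw [tay_coeff, PowerSeries.coeff_C_mul, tay_coeff, iteratedDeriv_const_mul_field]
  ring

lemma tay_id : tay (fun q => q) = PowerSeries.X := by
  ext n
  rw [tay_coeff, PowerSeries.coeff_X]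
  rcases n with _ | _ | n
  · simp
  · simp [iteratedDeriv_one]
  · have : deriv (fun q : ℂ => q) = fun _ => 1 := by ext; simp
    rw [iteratedDeriv_succ', this]
    simp [iteratedDeriv_const]

lemma tay_deriv (F : ℂ → ℂ) : tay (deriv F) = d⁄dX ℂ (tay F) := by
  ext n
  rw [tay_coeff, PowerSeries.coeff_derivative, tay_coeff, iteratedDeriv_succ', Nat.factorial_succ]
  have := Nat.factorial_ne_zero n
  push_cast
  field_simp

lemma tay_eul {F : ℂ → ℂ} (hF : DifferentiableOn ℂ F (Metric.ball 0 1)) :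
    tay (eul F) = eD (tay F) := by
  rw [eD_apply, ← tay_deriv, ← tay_id, ← tay_mul (F := fun q => q) differentiableOn_id
    (hF.deriv Metric.isOpen_ball)]
  rfl

lemma tay_hasSum {F : ℂ → ℂ} (hF : DifferentiableOn ℂ F (Metric.ball 0 1)) {q : ℂ}
    (hq : ‖q‖ < 1) : HasSum (fun n => PowerSeries.coeff n (tay F) * q ^ n) (F q) := by
  have := Complex.hasSum_taylorSeries_on_ball (f := F) (c := 0) (r := 1) (by simpa using hF)
    (z := q) (by simpa using hq)
  refine this.congr_fun fun n => ?_
  rw [tay_coeff]; simp; ring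

lemma tay_unique {F : ℂ → ℂ} {t : ℕ → ℂ}
    (h : ∀ q : ℂ, ‖q‖ < 1 → HasSum (fun n => t n * q ^ n) (F q))
    (hF : DifferentiableOn ℂ F (Metric.ball 0 1)) (n : ℕ) :
    t n = PowerSeries.coeff n (tay F) := by
  have key : ∀ s : ℕ → ℂ, (∀ q : ℂ, ‖q‖ < 1 → HasSum (fun n => s n * q ^ n) (F q)) →
      HasFPowerSeriesAt F (FormalMultilinearSeries.ofScalars ℂ s) 0 := by
    intro s hs
    rw [hasFPowerSeriesAt_iff]
    filter_upwards [Metric.ball_mem_nhds (0 : ℂ) one_pos] with q hq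
    have := hs q (by simpa using hq)
    simpa [mul_comm, FormalMultilinearSeries.coeff_ofScalars] using this
  have := (key t h).eq_formalMultilinearSeries (key _ (fun q hq => tay_hasSum hF hq))
  have h2 := congrArg (fun p => FormalMultilinearSeries.coeff p n) this
  simpa [FormalMultilinearSeries.coeff_ofScalars] using h2

lemma prodFn_zero : prodFn 0 = 1 := by simp [prodFn]

lemma prodFn_deriv_zero : deriv prodFn 0 = -24 := by
  have h0 : (0 : ℂ) ∈ Metric.ball (0 : ℂ) 1 := by simp
  have hl : ∀ i : ℕ, logDeriv (fun q : ℂ => 1 - q ^ (i + 1)) 0 = if i = 0 then -1 else 0 := by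
    intro i
    rw [logDeriv_apply]
    have : deriv (fun q : ℂ => 1 - q ^ (i + 1)) 0 = - ((i + 1) * 0 ^ i) := by
      simp
    rw [this]
    rcases i with _ | i <;> simp
  have hP0 : (∏' k : ℕ, (1 - (0 : ℂ) ^ (k + 1))) = 1 := by simp
  have h1 := logDeriv_tprod_eq_tsum (f := fun (n : ℕ) (q : ℂ) => 1 - q ^ (n + 1))
    Metric.isOpen_ball h0 (by simp) (fun i => by fun_prop)
    (by simp_rw [hl]; exact summable_of_ne_finset_zero (s := {0}) (by simp))
    ModularForm.multipliableLocallyUniformlyOn_one_sub_pow (by rw [hP0]; exact one_ne_zero)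
  simp_rw [hl] at h1
  rw [tsum_ite_eq, logDeriv_apply, hP0, div_one] at h1
  have hd : DifferentiableAt ℂ (fun q : ℂ => ∏' k : ℕ, (1 - q ^ (k + 1))) 0 := by
    refine differentiableAt_of_deriv_ne_zero ?_
    rw [h1]; simp
  have he : prodFn =ᶠ[𝓝 0] fun q => (∏' k : ℕ, (1 - q ^ (k + 1))) ^ 24 := by
    filter_upwards [Metric.ball_mem_nhds (0 : ℂ) one_pos] with q hq
    exact prodFn_eq (by simpa using hq)
  rw [he.deriv_eq]
  have := (hd.hasDerivAt.fun_pow 24).deriv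
  rw [this, h1, hP0]
  norm_num

theorem exists_series (tau : ℕ → ℂ)
    (htau : ∀ q : ℂ, ‖q‖ < 1 →
      ∑' n : ℕ, tau n * q ^ n = q * ∏' k : ℕ, (1 - q ^ (k + 1)) ^ 24) :
    ∃ p f : ℂ⟦X⟧, PowerSeries.coeff 0 p = 1 ∧ PowerSeries.coeff 2 p = -24 ∧
      (∀ a b, a = p ^ 2 - 6 * eD p → b = 2 * p * a - 3 * eD a → p * b - eD b = 2 * a ^ 2) ∧
      eD f = 2 * p * f ∧ PowerSeries.coeff 2 f = 1 ∧ ∀ n, PowerSeries.coeff (2 * n) f = tau n := by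
  set E := tay eFn with hE
  set P := tay prodFn with hP
  have hEP : E * P = P + eD P := by
    have h1 : tay (fun q => eFn q * prodFn q - prodFn q) = tay (eul prodFn) := by
      apply tay_congr
      intro q hq
      have := prodFn_ne_zero hq
      simp only [eFn]
      field_simp
      ring
    rw [tay_sub (eFn_diff.fun_mul prodFn_diff) prodFn_diff, tay_mul eFn_diff prodFn_diff,
      tay_eul prodFn_diff] at h1
    linear_combination h1
  have hP0 : PowerSeries.coeff 0 P = 1 := by rw [hP, tay_coeff]; simp [prodFn_zero]
  have hP1 : PowerSeries.coeff 1 P = -24 := by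
    rw [hP, tay_coeff]; simp [iteratedDeriv_one, prodFn_deriv_zero]
  have hE0 : PowerSeries.coeff 0 E = 1 := by rw [hE, tay_coeff]; simp [eFn, eul]
  have hE1 : PowerSeries.coeff 1 E = -24 := by
    have := congrArg (PowerSeries.coeff 1) hEP
    rw [map_add, eD_coeff, PowerSeries.coeff_mul, Finset.Nat.antidiagonal_succ] at this
    simp only [Finset.Nat.antidiagonal_zero, Finset.map_singleton, Finset.sum_cons,
      Finset.sum_singleton] at this
    simp [hP1] at this hE0 hP0
    rw [hE0, hP0] at this
    linear_combination this
  have hdF : DifferentiableOn ℂ (fun q => q * prodFn q) (Metric.ball 0 1) :=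
    differentiableOn_id.mul prodFn_diff
  have hF : tay (fun q => q * prodFn q) = PowerSeries.X * P := by
    rw [tay_mul (F := fun q => q) differentiableOn_id prodFn_diff, tay_id]
  have hA : tay aFn = E ^ 2 - 12 * eD E := by
    have : tay aFn = tay (fun q => eFn q * eFn q - 12 * eul eFn q) :=
      tay_congr fun q _ => by simp only [aFn]; ring
    rw [this, tay_sub (eFn_diff.fun_mul eFn_diff) ((eul_diff eFn_diff).const_mul 12),
      tay_mul eFn_diff eFn_diff, tay_cmul, tay_eul eFn_diff, map_ofNat, sq]
  have hB : tay bFn = E * tay aFn - 3 * eD (tay aFn) := by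
    have : tay bFn = tay (fun q => eFn q * aFn q - 3 * eul aFn q) := rfl
    rw [this, tay_sub (eFn_diff.fun_mul aFn_diff) ((eul_diff aFn_diff).const_mul 3),
      tay_mul eFn_diff aFn_diff, tay_cmul, tay_eul aFn_diff, map_ofNat]
  have hC : E * tay bFn - 2 * eD (tay bFn) = tay aFn ^ 2 := by
    have : tay (fun q => eFn q * bFn q - 2 * eul bFn q) = tay (fun q => aFn q * aFn q) :=
      tay_congr fun q hq => by have := cFn_eq_zero hq; simp only [cFn] at this; linear_combination this
    rw [tay_sub (eFn_diff.fun_mul bFn_diff) ((eul_diff bFn_diff).const_mul 2),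
      tay_mul eFn_diff bFn_diff, tay_cmul, tay_eul bFn_diff, map_ofNat,
      tay_mul aFn_diff aFn_diff, ← sq] at this
    exact this
  refine ⟨PowerSeries.expand 2 two_ne_zero E, PowerSeries.expand 2 two_ne_zero (PowerSeries.X * P),
    ?_, ?_, ?_, ?_, ?_, ?_⟩
  · simpa using hE0
  · exact (PowerSeries.coeff_expand_mul 2 two_ne_zero E 1).trans hE1
  · set x := PowerSeries.expand 2 (two_ne_zero (α := ℕ)) (R := ℂ) with hx
    have hDx : ∀ y, eD (x y) = 2 * x (eD y) := eD_expand
    intro a b ha hb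
    have ha' : a = x (tay aFn) := by
      rw [ha, hA, hDx]; simp only [map_sub, map_mul, map_pow, map_ofNat]; ring
    have hb' : b = 2 * x (tay bFn) := by
      rw [hb, hB, ha', hDx]; simp only [map_sub, map_mul, map_pow, map_ofNat]; ring
    have hDb : eD b = 2 * eD (x (tay bFn)) := by
      rw [hb', two_mul, map_add, two_mul]
    rw [hDb, hb', ha', hDx]
    have := congrArg x hC
    simp only [map_sub, map_mul, map_pow, map_ofNat] at this
    linear_combination 2 * this
  · rw [eD_expand, eD_mul]
    have : eD (PowerSeries.X : ℂ⟦X⟧) = PowerSeries.X := by rw [eD_apply]; simp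
    rw [this, mul_assoc 2, ← map_mul]
    congr 2
    linear_combination - PowerSeries.X * hEP
  · refine (PowerSeries.coeff_expand_mul 2 two_ne_zero _ 1).trans ?_
    rw [show (1 : ℕ) = 0 + 1 from rfl, PowerSeries.coeff_succ_X_mul, hP0]
  · intro n
    rw [PowerSeries.coeff_expand_mul, ← hF]
    symm
    refine tay_unique ?_ hdF n
    intro q hq
    by_cases h : q = 0
    · subst h
      have h1 := hasSum_ite_eq 0 (tau 0)
      have h2 := htau 0 (by simp)
      have h3 : (fun n => tau n * (0 : ℂ) ^ n) = fun n => if n = 0 then tau 0 else 0 := by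
        ext n; rcases n with _ | n <;> simp
      rw [h3] at h2 ⊢
      rw [h1.tsum_eq] at h2
      simp only [zero_mul] at h2 ⊢
      rw [h2] at h1 ⊢
      exact h1
    · have h1 : ∑' n : ℕ, tau n * q ^ n = q * prodFn q := htau q hq
      have h2 : Summable fun n : ℕ => tau n * q ^ n := by
        by_contra hc
        rw [tsum_eq_zero_of_not_summable hc] at h1
        exact mul_ne_zero h (prodFn_ne_zero hq) h1.symm
      rw [← h1]
      exact h2.hasSum

end TaylorPart

section FormalODE
open scoped PowerSeries

lemma coeff_mul_low {d g : ℂ⟦X⟧} {n : ℕ} (h : ∀ k < n, PowerSeries.coeff k d = 0) :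
    PowerSeries.coeff n (d * g) = PowerSeries.coeff n d * PowerSeries.coeff 0 g := by
  rw [PowerSeries.coeff_mul, Finset.sum_eq_single (n, 0)]
  · intro b hb hne
    have hb' : b.1 + b.2 = n := by simpa using hb
    have : b.1 < n := by
      rcases Nat.eq_zero_or_pos b.2 with h0 | h0
      · exact absurd (Prod.ext (by simpa [h0] using hb') h0) hne
      · omega
    rw [h _ this, zero_mul]
  · simp

lemma chazy_expand {p : ℂ⟦X⟧}
    (h : ∀ a b, a = p ^ 2 - 6 * eD p → b = 2 * p * a - 3 * eD a → p * b - eD b = 2 * a ^ 2) :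
    2 * (p * eD (eD p)) - 3 * (eD p * eD p) - eD (eD (eD p)) = 0 := by
  have h1 := h _ _ rfl rfl
  have hn : ∀ (k : ℕ) [k.AtLeastTwo] (x : ℂ⟦X⟧),
      eD ((OfNat.ofNat k : ℂ⟦X⟧) * x) = (OfNat.ofNat k : ℂ⟦X⟧) * eD x := by
    intro k _ x
    have e : (OfNat.ofNat k : ℂ⟦X⟧) = ((k : ℕ) : ℂ⟦X⟧) := rfl
    rw [eD_mul, e, Derivation.map_natCast]; ring
  simp only [map_sub, map_add, eD_mul, sq, mul_assoc, hn] at h1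
  have h2 : (18 : ℂ⟦X⟧) * (2 * (p * eD (eD p)) - 3 * (eD p * eD p) - eD (eD (eD p))) = 0 := by
    linear_combination h1
  have h18 : (18 : ℂ⟦X⟧) ≠ 0 := by
    have : (18 : ℂ⟦X⟧) = PowerSeries.C 18 := (map_ofNat (PowerSeries.C (R := ℂ)) 18).symm
    rw [this]
    intro h0
    have := congrArg (PowerSeries.coeff 0) h0
    simp at this
  exact (mul_eq_zero.mp h2).resolve_left h18

lemma chazy_unique {p p' : ℂ⟦X⟧}
    (h : 2 * (p * eD (eD p)) - 3 * (eD p * eD p) - eD (eD (eD p)) = 0)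
    (h' : 2 * (p' * eD (eD p')) - 3 * (eD p' * eD p') - eD (eD (eD p')) = 0)
    (h0 : PowerSeries.coeff 0 p = 1) (h0' : PowerSeries.coeff 0 p' = 1)
    (h2 : PowerSeries.coeff 2 p = PowerSeries.coeff 2 p') : p = p' := by
  have hd : ∀ n, PowerSeries.coeff n (p - p') = 0 := by
    intro n
    induction n using Nat.strong_induction_on with
    | _ n ih =>
      by_cases hn0 : n = 0
      · subst hn0; rw [map_sub, h0, h0', sub_self]
      by_cases hn2 : n = 2
      · subst hn2; rw [map_sub, h2, sub_self]
      have e : ((p - p') * eD (eD p) + eD (eD (p - p')) * p')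
          + ((p - p') * eD (eD p) + eD (eD (p - p')) * p')
          - (eD (p - p') * (eD p + eD p') + eD (p - p') * (eD p + eD p')
            + eD (p - p') * (eD p + eD p'))
          - eD (eD (eD (p - p'))) = 0 := by
        simp only [map_sub]
        linear_combination h - h'
      have hD : ∀ k < n, PowerSeries.coeff k (eD (p - p')) = 0 := fun k hk => by
        rw [eD_coeff, ih k hk, mul_zero]
      have hDD : ∀ k < n, PowerSeries.coeff k (eD (eD (p - p'))) = 0 := fun k hk => by
        rw [eD_coeff, hD k hk, mul_zero]
      have := congrArg (PowerSeries.coeff n) e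
      rw [map_sub, map_sub, map_add, map_add, map_add, map_add, coeff_mul_low ih,
        coeff_mul_low hDD, coeff_mul_low hD, map_add] at this
      simp only [eD_coeff, h0', map_zero] at this
      have h3 : ((n : ℂ) ^ 2 * (2 - n)) * PowerSeries.coeff n (p - p') = 0 := by
        push_cast at this
        linear_combination this
      refine (mul_eq_zero.mp h3).resolve_left (mul_ne_zero (pow_ne_zero _ ?_) ?_)
      · exact_mod_cast hn0
      · rw [sub_ne_zero]; exact_mod_cast (Ne.symm hn2)
  have : p - p' = 0 := by ext n; rw [hd, map_zero]
  exact sub_eq_zero.mp this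

/-- Course-of-values recursion. -/
def seqOf {α : Type} (G : ℕ → (ℕ → α) → α) (d : α) (n : ℕ) : α :=
  G n (fun k => if _h : k < n then seqOf G d k else d)
termination_by n

lemma seqOf_eq {α : Type} (G : ℕ → (ℕ → α) → α) (d : α) (n : ℕ) :
    seqOf G d n = G n (fun k => if k < n then seqOf G d k else d) := by
  rw [seqOf]; simp

/-- Convolution. -/
def conv (a b : ℕ → ℂ) (n : ℕ) : ℂ := ∑ x ∈ Finset.HasAntidiagonal.antidiagonal n, a x.1 * b x.2

/-- Truncation. -/
def trc (n : ℕ) (a : ℕ → ℂ) (k : ℕ) : ℂ := if k < n then a k else 0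

lemma conv_split (a b : ℕ → ℂ) {n : ℕ} (hn : n ≠ 0) :
    conv a b n = a n * b 0 + a 0 * b n + conv (trc n a) (trc n b) n := by
  have : ∀ x ∈ Finset.HasAntidiagonal.antidiagonal n, a x.1 * b x.2 =
      (if x = (n, 0) then a n * b 0 else 0) + (if x = (0, n) then a 0 * b n else 0)
      + trc n a x.1 * trc n b x.2 := by
    rintro ⟨i, j⟩ hx
    have hx' : i + j = n := by simpa using hx
    simp only [Prod.mk.injEq, trc]
    rcases Nat.eq_zero_or_pos i with hi | hi
    · subst hi
      obtain rfl : j = n := by omega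
      simp [hn, Ne.symm hn]
    rcases Nat.eq_zero_or_pos j with hj | hj
    · subst hj
      obtain rfl : i = n := by omega
      simp [hn]
    have h1 : i < n := by omega
    have h2 : j < n := by omega
    simp [h1, h2, h1.ne, h2.ne]
  unfold conv
  rw [Finset.sum_congr rfl this, Finset.sum_add_distrib, Finset.sum_add_distrib,
    Finset.sum_ite_eq', Finset.sum_ite_eq']
  simp

/-- One step of the recursion for `(U, V, φ)`. -/
def stepUV (n : ℕ) (s : ℕ → ℂ × ℂ × ℂ) : ℂ × ℂ × ℂ :=
  if n = 0 then (1, 0, 0) else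
  let U := fun k => (s k).1
  let V := fun k => (s k).2.1
  let P := fun k => (s k).2.2
  let v : ℂ := if n = 1 then 16 else (2 * conv V P n + conv V U n) / (n - 1)
  let p : ℂ := (conv P P n - (conv U V n + v) / 4) / n
  let u : ℂ := (2 * conv U P n + conv U V n + 2 * p + v) / n
  (u, v, p)

theorem exists_UV : ∃ U V P : ℂ⟦X⟧, eD U = U * (2 * P + V) ∧ eD V = V * (2 * P + U) ∧
    4 * eD P = 4 * P ^ 2 - U * V ∧ PowerSeries.coeff 0 U = 1 ∧ PowerSeries.coeff 0 V = 0 ∧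
    PowerSeries.coeff 1 V = 16 ∧ PowerSeries.coeff 0 P = 0 := by
  set s := seqOf stepUV 0 with hs
  set u : ℕ → ℂ := fun n => (s n).1 with hu
  set v : ℕ → ℂ := fun n => (s n).2.1 with hv
  set p : ℕ → ℂ := fun n => (s n).2.2 with hp
  have hs0 : s 0 = (1, 0, 0) := by rw [hs, seqOf_eq]; simp [stepUV]
  have hsn : ∀ n, n ≠ 0 → s n = stepUV n (fun k => if k < n then s k else 0) := by
    intro n hn; rw [hs, seqOf_eq]
  have hu0 : u 0 = 1 := by simp [hu, hs0]
  have hv0 : v 0 = 0 := by simp [hv, hs0]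
  have hp0 : p 0 = 0 := by simp [hp, hs0]
  have tu : ∀ n, (fun k => (if k < n then s k else 0).1) = trc n u := by
    intro n; ext k; simp only [trc, hu]; split_ifs <;> rfl
  have tv : ∀ n, (fun k => (if k < n then s k else 0).2.1) = trc n v := by
    intro n; ext k; simp only [trc, hv]; split_ifs <;> rfl
  have tp : ∀ n, (fun k => (if k < n then s k else 0).2.2) = trc n p := by
    intro n; ext k; simp only [trc, hp]; split_ifs <;> rfl
  have hvn : ∀ n, n ≠ 0 → v n = if n = 1 then 16 else
      (2 * conv (trc n v) (trc n p) n + conv (trc n v) (trc n u) n) / (n - 1) := by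
    intro n hn
    change (s n).2.1 = _
    rw [hsn n hn]
    simp only [stepUV, if_neg hn, tu, tv, tp]
  have hpn : ∀ n, n ≠ 0 → p n =
      (conv (trc n p) (trc n p) n - (conv (trc n u) (trc n v) n + v n) / 4) / n := by
    intro n hn
    rw [hvn n hn]
    change (s n).2.2 = _
    rw [hsn n hn]
    simp only [stepUV, if_neg hn, tu, tv, tp]
  have hun : ∀ n, n ≠ 0 → u n = (2 * conv (trc n u) (trc n p) n + conv (trc n u) (trc n v) n
      + 2 * p n + v n) / n := by
    intro n hn
    rw [hpn n hn, hvn n hn]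
    change (s n).1 = _
    rw [hsn n hn]
    simp only [stepUV, if_neg hn, tu, tv, tp]
  have cm : ∀ (a b : ℕ → ℂ) (n : ℕ),
      PowerSeries.coeff n (PowerSeries.mk a * PowerSeries.mk b) = conv a b n := by
    intro a b n; simp [PowerSeries.coeff_mul, conv]
  have c0 : ∀ (a b : ℕ → ℂ), conv a b 0 = a 0 * b 0 := by intro a b; simp [conv]
  have h4 : (4 : ℂ⟦X⟧) = PowerSeries.C 4 := (map_ofNat (PowerSeries.C (R := ℂ)) 4).symm
  refine ⟨PowerSeries.mk u, PowerSeries.mk v, PowerSeries.mk p, ?_, ?_, ?_, ?_, ?_, ?_, ?_⟩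
  · ext n
    rw [mul_add, two_mul, mul_add, map_add, map_add, cm, cm, eD_coeff, PowerSeries.coeff_mk]
    by_cases hn : n = 0
    · subst hn; simp [c0, hv0, hp0]
    have hn' : (n : ℂ) ≠ 0 := by exact_mod_cast hn
    rw [conv_split u p hn, conv_split u v hn, hu0, hv0, hp0]
    nth_rewrite 1 [hun n hn]
    field_simp
    ring
  · ext n
    rw [mul_add, two_mul, mul_add, map_add, map_add, cm, cm, eD_coeff, PowerSeries.coeff_mk]
    by_cases hn : n = 0
    · subst hn; simp [c0, hv0, hp0]
    rw [conv_split v p hn, conv_split v u hn, hu0, hv0, hp0]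
    by_cases h1 : n = 1
    · subst h1
      simp [conv, trc, Finset.Nat.antidiagonal_succ]
    have hn' : (n : ℂ) - 1 ≠ 0 := by rw [sub_ne_zero]; exact_mod_cast h1
    have := hvn n hn
    rw [if_neg h1, eq_div_iff hn'] at this
    linear_combination this
  · ext n
    rw [h4, sq, map_sub, PowerSeries.coeff_C_mul, PowerSeries.coeff_C_mul, cm, cm, eD_coeff,
      PowerSeries.coeff_mk]
    by_cases hn : n = 0
    · subst hn; simp [c0, hv0, hp0]
    have hn' : (n : ℂ) ≠ 0 := by exact_mod_cast hn
    rw [conv_split p p hn, conv_split u v hn, hu0, hv0, hp0]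
    have := hpn n hn
    rw [eq_div_iff hn'] at this
    linear_combination 4 * this
  · simpa using hu0
  · simpa using hv0
  · simp [hvn 1 one_ne_zero]
  · simpa using hp0

end FormalODE

section FormalIdentity
open scoped PowerSeries

/-- The data used: `V = 4 v`. -/
structure UVData (U v P f : ℂ⟦X⟧) : Prop where
  hU : eD U = U * (2 * P + 4 * v)
  hv : eD v = v * (2 * P + U)
  hP : eD P = P ^ 2 - U * v
  hf : eD f = 2 * (U + 4 * v + 6 * P) * f
  U0 : PowerSeries.coeff 0 U = 1
  v0 : PowerSeries.coeff 0 v = 0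
  v1 : PowerSeries.coeff 1 v = 4
  P0 : PowerSeries.coeff 0 P = 0
  f0 : PowerSeries.coeff 0 f = 0
  f1 : PowerSeries.coeff 1 f = 0
  f2 : PowerSeries.coeff 2 f = 1

lemma coeff1_mul (a b : ℂ⟦X⟧) : PowerSeries.coeff 1 (a * b) =
    PowerSeries.coeff 0 a * PowerSeries.coeff 1 b + PowerSeries.coeff 1 a * PowerSeries.coeff 0 b := by
  rw [PowerSeries.coeff_mul, Finset.Nat.sum_antidiagonal_succ]; simp

lemma coeff2_mul (a b : ℂ⟦X⟧) : PowerSeries.coeff 2 (a * b) =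
    PowerSeries.coeff 0 a * PowerSeries.coeff 2 b + PowerSeries.coeff 1 a * PowerSeries.coeff 1 b
    + PowerSeries.coeff 2 a * PowerSeries.coeff 0 b := by
  rw [PowerSeries.coeff_mul, Finset.Nat.sum_antidiagonal_succ, Finset.Nat.sum_antidiagonal_succ]
  simp; ring

lemma eD_ofNat_mul (k : ℕ) [k.AtLeastTwo] (x : ℂ⟦X⟧) :
      eD ((OfNat.ofNat k : ℂ⟦X⟧) * x) = (OfNat.ofNat k : ℂ⟦X⟧) * eD x := by
  have e : (OfNat.ofNat k : ℂ⟦X⟧) = ((k : ℕ) : ℂ⟦X⟧) := rfl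
  rw [eD_mul, e, Derivation.map_natCast]; ring

lemma ps_ofNat_mul (n k : ℕ) [k.AtLeastTwo] (x : ℂ⟦X⟧) :
    PowerSeries.coeff n ((OfNat.ofNat k : ℂ⟦X⟧) * x) = OfNat.ofNat k * PowerSeries.coeff n x := by
  have : (OfNat.ofNat k : ℂ⟦X⟧) = PowerSeries.C (OfNat.ofNat k) :=
    (map_ofNat (PowerSeries.C (R := ℂ)) k).symm
  rw [this, PowerSeries.coeff_C_mul]

theorem exists_UVData {p f : ℂ⟦X⟧} (hp0 : PowerSeries.coeff 0 p = 1)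
    (hp2 : PowerSeries.coeff 2 p = -24)
    (hc : ∀ a b, a = p ^ 2 - 6 * eD p → b = 2 * p * a - 3 * eD a → p * b - eD b = 2 * a ^ 2)
    (hf : eD f = 2 * p * f) (hf2 : PowerSeries.coeff 2 f = 1) :
    ∃ U v P, UVData U v P f := by
  obtain ⟨U, V, P, hU, hV, hP, U0, V0, V1, P0⟩ := exists_UV
  obtain ⟨v, rfl⟩ : ∃ v, V = 4 * v := by
    refine ⟨PowerSeries.C (1/4) * V, ?_⟩
    ext n
    rw [ps_ofNat_mul, PowerSeries.coeff_C_mul]; ring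
  have h4 : (4 : ℂ⟦X⟧) ≠ 0 := by
    intro h
    have := ps_ofNat_mul 0 4 (1 : ℂ⟦X⟧)
    rw [h] at this
    simp at this
  have hv : eD v = v * (2 * P + U) := by
    apply mul_left_cancel₀ h4
    rw [eD_ofNat_mul] at hV
    rw [hV]; ring
  have hP' : eD P = P ^ 2 - U * v := by
    apply mul_left_cancel₀ h4
    rw [hP]; ring
  rw [ps_ofNat_mul] at V0 V1
  have c2 : ∀ n (x : ℂ⟦X⟧), PowerSeries.coeff n (2 * x) = 2 * PowerSeries.coeff n x :=
    fun n x => ps_ofNat_mul n 2 x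
  have c4 : ∀ n (x : ℂ⟦X⟧), PowerSeries.coeff n (4 * x) = 4 * PowerSeries.coeff n x :=
    fun n x => ps_ofNat_mul n 4 x
  have c6 : ∀ n (x : ℂ⟦X⟧), PowerSeries.coeff n (6 * x) = 6 * PowerSeries.coeff n x :=
    fun n x => ps_ofNat_mul n 6 x
  have v0 : PowerSeries.coeff 0 v = 0 := by simpa using V0
  have v1 : PowerSeries.coeff 1 v = 4 := by linear_combination V1 / 4
  have U1 : PowerSeries.coeff 1 U = 8 := by
    have h1 := congrArg (PowerSeries.coeff 1) hP'
    have h2 := congrArg (PowerSeries.coeff 1) hU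
    simp only [eD_coeff, sq, map_sub, map_add, coeff1_mul, ↓c2, ↓c4, ↓c6, U0, v0, v1, P0] at h1 h2
    push_cast at h1 h2
    linear_combination h2 + 2 * h1
  have P1 : PowerSeries.coeff 1 P = -4 := by
    have h1 := congrArg (PowerSeries.coeff 1) hP'
    simp only [eD_coeff, sq, map_sub, map_add, coeff1_mul, ↓c2, ↓c4, ↓c6, U0, v0, v1, P0] at h1
    push_cast at h1
    linear_combination h1
  have q0 : PowerSeries.coeff 0 (U + 4 * v + 6 * P) = 1 := by
    simp only [map_add, c2, c4, c6, U0, v0, P0]; norm_num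
  have q2 : PowerSeries.coeff 2 (U + 4 * v + 6 * P) = -24 := by
    have h1 := congrArg (PowerSeries.coeff 2) hP'
    have h2 := congrArg (PowerSeries.coeff 2) hU
    have h3 := congrArg (PowerSeries.coeff 2) hv
    simp only [eD_coeff, sq, map_sub, map_add, coeff1_mul, coeff2_mul, ↓c2, ↓c4, ↓c6,
      U0, v0, v1, P0, U1, P1] at h1 h2 h3 ⊢
    push_cast at h1 h2 h3 ⊢
    linear_combination h2 / 2 + (7 / 2) * h1 + (5 / 2) * h3
  have hpq : p = U + 4 * v + 6 * P := by
    refine chazy_unique (chazy_expand hc) ?_ hp0 q0 (hp2.trans q2.symm)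
    have d2 : eD (2 : ℂ⟦X⟧) = 0 := Derivation.map_natCast eD 2
    have d4 : eD (4 : ℂ⟦X⟧) = 0 := Derivation.map_natCast eD 4
    have d6 : eD (6 : ℂ⟦X⟧) = 0 := Derivation.map_natCast eD 6
    simp only [map_add, map_sub, eD_mul, sq, hU, hv, hP', d2, d4, d6, map_zero]
    ring
  have hf0 : PowerSeries.coeff 0 f = 0 := by
    have h1 := congrArg (PowerSeries.coeff 0) hf
    rw [eD_coeff, mul_assoc, ps_ofNat_mul, coeff_mul_low (by simp), hp0] at h1
    push_cast at h1
    linear_combination - h1 / 2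
  have hf1 : PowerSeries.coeff 1 f = 0 := by
    have h1 := congrArg (PowerSeries.coeff 1) hf
    rw [eD_coeff, mul_assoc, ps_ofNat_mul, coeff1_mul, hp0, hf0] at h1
    push_cast at h1
    linear_combination - h1
  exact ⟨U, v, P, hU, hv, hP', hpq ▸ hf, U0, v0, v1, P0, hf0, hf1, hf2⟩

/-- Coefficients of `R m` at zero. -/
def rr (m : ℕ) : ℕ → ℂ
  | 0 => if m = 0 then 1 else 0
  | k + 1 => (m + 2) * rr m k + if m = 0 then 0 else
      ((k + 3 - m) * rr (m - 1) k - k * (k + 11) / 4 * rr (m - 1) (k - 1))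
termination_by k => k

lemma rr_zero (m : ℕ) : rr m 0 = if m = 0 then 1 else 0 := by rw [rr]

lemma rr_succ0 (k : ℕ) : rr 0 (k + 1) = 2 * rr 0 k := by rw [rr]; simp

lemma rr_succ (m k : ℕ) : rr (m + 1) (k + 1) = (m + 3) * rr (m + 1) k +
    ((k + 2 - m) * rr m k - k * (k + 11) / 4 * rr m (k - 1)) := by
  rw [rr, if_neg (Nat.succ_ne_zero m), Nat.add_sub_cancel]; push_cast; ring

lemma rr_lt {m k : ℕ} (h : k < m) : rr m k = 0 := by
  induction k using Nat.strong_induction_on generalizing m with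
  | _ k ih =>
    cases k with
    | zero => rw [rr_zero, if_neg (by omega)]
    | succ k =>
      obtain ⟨m, rfl⟩ : ∃ l, m = l + 1 := ⟨m - 1, by omega⟩
      rw [rr_succ, ih k (by omega) (by omega), ih k (by omega) (by omega),
        ih (k - 1) (by omega) (by omega)]
      ring

/-- Rescaled coefficients. -/
def tt (i j : ℕ) : ℂ := 4 ^ i * rr i (i + j)

lemma tt_00 : tt 0 0 = 1 := by simp [tt, rr_zero]

lemma tt_0 (j : ℕ) : tt 0 (j + 1) = 2 * tt 0 j := by
  simp only [tt]; rw [← add_assoc, rr_succ0]; ring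

lemma tt_s0 (i : ℕ) : tt (i + 1) 0 = 8 * tt i 0 := by
  simp only [tt, add_zero]
  rw [rr_succ, rr_lt (Nat.lt_succ_self i)]
  rcases Nat.eq_zero_or_pos i with h | h
  · subst h; push_cast; ring
  · rw [rr_lt (show i - 1 < i by omega)]; ring

lemma tt_ss (i j : ℕ) : tt (i + 1) (j + 1) = (i + 3) * tt (i + 1) j + 4 * (j + 3) * tt i (j + 1)
    - (i + j + 1) * (i + j + 12) * tt i j := by
  simp only [tt]
  rw [show i + 1 + (j + 1) = (i + j + 1) + 1 by ring, rr_succ,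
    show i + 1 + j = i + j + 1 by ring, show i + (j + 1) = i + j + 1 by ring, Nat.add_sub_cancel]
  push_cast; ring

/-- The polynomials `h_k`. -/
def hh (U v : ℂ⟦X⟧) (k : ℕ) : ℂ⟦X⟧ :=
  ∑ x ∈ Finset.HasAntidiagonal.antidiagonal k, PowerSeries.C (tt x.1 x.2) * v ^ x.1 * U ^ x.2

/-- first part of the derivative -/
def hh' (U v : ℂ⟦X⟧) (k : ℕ) : ℂ⟦X⟧ :=
  ∑ x ∈ Finset.HasAntidiagonal.antidiagonal k, PowerSeries.C (tt x.1 x.2) * v ^ x.1 * U ^ x.2 *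
    ((x.1 + 2) * U + 4 * (x.2 + 2) * v)

lemma eD_pow (x : ℂ⟦X⟧) (y : ℂ⟦X⟧) (h : eD x = x * y) (n : ℕ) : eD (x ^ n) = n * x ^ n * y := by
  induction n with
  | zero => simp
  | succ n ih => rw [pow_succ, eD_mul, ih, h]; push_cast; ring

lemma eD_C (c : ℂ) : eD (PowerSeries.C c) = 0 := by rw [eD_apply]; simp

lemma eD_hh {U v P f : ℂ⟦X⟧} (h : UVData U v P f) (k : ℕ) :
    eD (f * hh U v k) = f * hh' U v k + (12 + 2 * k) * P * (f * hh U v k) := by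
  simp only [hh, hh', Finset.mul_sum, map_sum]
  rw [← Finset.sum_add_distrib]
  refine Finset.sum_congr rfl fun x hx => ?_
  have hx' : x.1 + x.2 = k := by simpa using hx
  have hk : (k : ℂ⟦X⟧) = x.1 + x.2 := by rw [← hx']; push_cast; rfl
  rw [eD_mul, eD_mul, eD_mul, eD_C, eD_pow _ _ h.hU, eD_pow _ _ h.hv, h.hf, hk]
  ring

lemma hh_one (U v : ℂ⟦X⟧) : hh U v 1 = hh' U v 0 := by
  simp only [hh, hh', Finset.Nat.antidiagonal_zero, Finset.sum_singleton]
  rw [Finset.Nat.sum_antidiagonal_succ]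
  simp only [Finset.Nat.antidiagonal_zero, Finset.sum_singleton, zero_add, tt_0, tt_s0, tt_00,
    map_mul, map_one, map_ofNat]
  push_cast
  ring

lemma hh_two (U v : ℂ⟦X⟧) (l : ℕ) :
    hh U v (l + 2) = hh' U v (l + 1) - (l + 1) * (l + 12) * (U * v) * hh U v l := by
  have e : hh' U v (l + 1) =
      ∑ x ∈ Finset.HasAntidiagonal.antidiagonal (l + 1),
        PowerSeries.C (tt x.1 x.2) * v ^ x.1 * U ^ x.2 * ((x.1 + 2) * U)
      + ∑ x ∈ Finset.HasAntidiagonal.antidiagonal (l + 1),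
        PowerSeries.C (tt x.1 x.2) * v ^ x.1 * U ^ x.2 * (4 * (x.2 + 2) * v) := by
    rw [← Finset.sum_add_distrib]
    exact Finset.sum_congr rfl fun x _ => by ring
  rw [e]
  simp only [hh]
  rw [Finset.Nat.sum_antidiagonal_succ, Finset.Nat.sum_antidiagonal_succ',
    Finset.Nat.sum_antidiagonal_succ, Finset.Nat.sum_antidiagonal_succ', Finset.mul_sum]
  have key : ∑ x ∈ Finset.HasAntidiagonal.antidiagonal l,
      PowerSeries.C (tt (x.1 + 1) (x.2 + 1)) * v ^ (x.1 + 1) * U ^ (x.2 + 1)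
      = ∑ x ∈ Finset.HasAntidiagonal.antidiagonal l,
          PowerSeries.C (tt (x.1 + 1) x.2) * v ^ (x.1 + 1) * U ^ x.2 * (((x.1 + 1 : ℕ) + 2) * U)
      + ∑ x ∈ Finset.HasAntidiagonal.antidiagonal l,
          PowerSeries.C (tt x.1 (x.2 + 1)) * v ^ x.1 * U ^ (x.2 + 1) * (4 * ((x.2 + 1 : ℕ) + 2) * v)
      - ∑ x ∈ Finset.HasAntidiagonal.antidiagonal l,
          (l + 1) * (l + 12) * (U * v) * (PowerSeries.C (tt x.1 x.2) * v ^ x.1 * U ^ x.2) := by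
    rw [← Finset.sum_add_distrib, ← Finset.sum_sub_distrib]
    refine Finset.sum_congr rfl fun x hx => ?_
    have hx' : x.1 + x.2 = l := by simpa using hx
    have hl : (l : ℂ⟦X⟧) = x.1 + x.2 := by rw [← hx']; push_cast; rfl
    rw [tt_ss, hl]
    simp only [map_mul, map_add, map_sub, map_natCast, map_ofNat, map_one]
    push_cast
    ring
  simp only [] at key ⊢
  rw [key, tt_0, tt_s0]
  simp only [map_mul, map_ofNat]
  push_cast
  ring

/-- weights -/
def ww : ℕ → ℕ → ℂ
  | 0, _ => 1
  | i + 1, j => (i + j + 1) * (i + j + 12) / (i + 1) * ww i j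

lemma ww_s (i j : ℕ) : (i + 1) * ww (i + 1) j = (i + j + 1) * (i + j + 12) * ww i j := by
  rw [ww]
  have : (i : ℂ) + 1 ≠ 0 := Nat.cast_add_one_ne_zero i
  field_simp

lemma ww_j (i j : ℕ) : ww i (j + 1) * ((j + 1) * (j + 12)) = (i + j + 1) * (i + j + 12) * ww i j := by
  induction i with
  | zero => simp [ww]
  | succ i ih =>
    rw [ww, ww]
    have : (i : ℂ) + 1 ≠ 0 := Nat.cast_add_one_ne_zero i
    push_cast
    field_simp
    linear_combination (i + j + 2) * (i + j + 13) * ih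

lemma ww_ss (i j : ℕ) : ww (i + 1) (j + 1) = ww (i + 1) j + (i + 2 * j + 14) * ww i (j + 1) := by
  have h1 := ww_s i (j + 1)
  have h2 := ww_s i j
  have h3 := ww_j i j
  have : (i : ℂ) + 1 ≠ 0 := Nat.cast_add_one_ne_zero i
  apply mul_left_cancel₀ this
  push_cast at h1
  linear_combination h1 - h2 + h3

/-- The closed form. -/
def gg (P f : ℂ⟦X⟧) (k : ℕ) : ℂ⟦X⟧ :=
  ∑ x ∈ Finset.HasAntidiagonal.antidiagonal k,
    PowerSeries.C (ww x.1 x.2) * (-P) ^ x.1 * (eD^[x.2] f)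

lemma eD_iter (f : ℂ⟦X⟧) (j : ℕ) : eD (eD^[j] f) = eD^[j + 1] f :=
  (Function.iterate_succ_apply' _ _ _).symm

lemma eD_gg (P f : ℂ⟦X⟧) (k : ℕ) : eD (gg P f k) =
    ∑ x ∈ Finset.HasAntidiagonal.antidiagonal k,
      PowerSeries.C (ww x.1 x.2) * (-P) ^ x.1 * (eD^[x.2 + 1] f)
    - ∑ x ∈ Finset.HasAntidiagonal.antidiagonal k,
      x.1 * PowerSeries.C (ww x.1 x.2) * (-P) ^ (x.1 - 1) * eD P * (eD^[x.2] f) := by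
  rw [gg, map_sum, ← Finset.sum_sub_distrib]
  refine Finset.sum_congr rfl fun x _ => ?_
  rw [eD_mul, eD_mul, eD_C, eD_iter, Derivation.leibniz_pow]
  simp only [map_neg, smul_eq_mul, nsmul_eq_mul]
  ring

lemma gg_shift (P f y : ℂ⟦X⟧) (l : ℕ) :
    ∑ x ∈ Finset.HasAntidiagonal.antidiagonal (l + 1),
      x.1 * PowerSeries.C (ww x.1 x.2) * (-P) ^ (x.1 - 1) * y * (eD^[x.2] f)
    = (l + 1) * (l + 12) * y * gg P f l := by
  rw [Finset.Nat.sum_antidiagonal_succ, gg, Finset.mul_sum]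
  simp only [Nat.cast_zero, zero_mul, zero_add, Nat.add_sub_cancel]
  refine Finset.sum_congr rfl fun x hx => ?_
  have hx' : x.1 + x.2 = l := by simpa using hx
  have hl : (l : ℂ⟦X⟧) = x.1 + x.2 := by rw [← hx']; push_cast; rfl
  have h := congrArg (PowerSeries.C (R := ℂ)) (ww_s x.1 x.2)
  simp only [map_mul, map_add, map_natCast, map_ofNat, map_one] at h
  rw [hl]
  push_cast
  linear_combination (-P) ^ x.1 * y * (eD^[x.2] f) * h

lemma gg_one (P f : ℂ⟦X⟧) : gg P f 1 = eD (gg P f 0) - 12 * P * gg P f 0 := by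
  rw [eD_gg]
  simp only [gg]
  rw [Finset.Nat.sum_antidiagonal_succ]
  have h12 : (PowerSeries.C (12 : ℂ)) = 12 := map_ofNat (PowerSeries.C (R := ℂ)) 12
  simp [ww, h12]
  ring

lemma gg_two (P f : ℂ⟦X⟧) (l : ℕ) : gg P f (l + 2) = eD (gg P f (l + 1))
    - (12 + 2 * (l + 1)) * P * gg P f (l + 1)
    - (l + 1) * (l + 12) * (P ^ 2 - eD P) * gg P f l := by
  have h1 : (l + 1) * (l + 12) * (P ^ 2 - eD P) * gg P f l =
      (l + 1) * (l + 12) * (P ^ 2) * gg P f l - (l + 1) * (l + 12) * (eD P) * gg P f l := by ring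
  rw [eD_gg, h1, ← gg_shift, ← gg_shift]
  have h2 : ∑ x ∈ Finset.HasAntidiagonal.antidiagonal (l + 1),
      x.1 * PowerSeries.C (ww x.1 x.2) * (-P) ^ (x.1 - 1) * P ^ 2 * (eD^[x.2] f)
      = ∑ x ∈ Finset.HasAntidiagonal.antidiagonal (l + 1),
      x.1 * PowerSeries.C (ww x.1 x.2) * (-P) ^ (x.1 + 1) * (eD^[x.2] f) := by
    refine Finset.sum_congr rfl fun x _ => ?_
    rcases x with ⟨_ | i, j⟩
    · simp
    · simp only [Nat.add_sub_cancel]; ring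
  rw [h2]
  have h3 : (12 + 2 * (l + 1)) * P * gg P f (l + 1) =
      - ∑ x ∈ Finset.HasAntidiagonal.antidiagonal (l + 1),
      (12 + 2 * (l + 1)) * PowerSeries.C (ww x.1 x.2) * (-P) ^ (x.1 + 1) * (eD^[x.2] f) := by
    rw [gg, Finset.mul_sum, ← Finset.sum_neg_distrib]
    exact Finset.sum_congr rfl fun x _ => by ring
  rw [h3]
  have h4 : ∑ x ∈ Finset.HasAntidiagonal.antidiagonal (l + 1),
      (12 + 2 * (l + 1)) * PowerSeries.C (ww x.1 x.2) * (-P) ^ (x.1 + 1) * (eD^[x.2] f)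
      - ∑ x ∈ Finset.HasAntidiagonal.antidiagonal (l + 1),
      x.1 * PowerSeries.C (ww x.1 x.2) * (-P) ^ (x.1 + 1) * (eD^[x.2] f)
      = ∑ x ∈ Finset.HasAntidiagonal.antidiagonal (l + 1),
      (12 + x.1 + 2 * x.2) * PowerSeries.C (ww x.1 x.2) * (-P) ^ (x.1 + 1) * (eD^[x.2] f) := by
    rw [← Finset.sum_sub_distrib]
    refine Finset.sum_congr rfl fun x hx => ?_
    have hx' : x.1 + x.2 = l + 1 := by simpa using hx
    have hl : (l : ℂ⟦X⟧) + 1 = x.1 + x.2 := by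
      have := congrArg (Nat.cast (R := ℂ⟦X⟧)) hx'
      push_cast at this
      exact this.symm
    rw [hl]; ring
  have h5 : gg P f (l + 2) = ∑ x ∈ Finset.HasAntidiagonal.antidiagonal (l + 1),
      PowerSeries.C (ww x.1 x.2) * (-P) ^ x.1 * (eD^[x.2 + 1] f)
      + ∑ x ∈ Finset.HasAntidiagonal.antidiagonal (l + 1),
      (12 + x.1 + 2 * x.2) * PowerSeries.C (ww x.1 x.2) * (-P) ^ (x.1 + 1) * (eD^[x.2] f) := by
    rw [gg, Finset.Nat.sum_antidiagonal_succ, Finset.Nat.sum_antidiagonal_succ',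
      Finset.Nat.sum_antidiagonal_succ, Finset.Nat.sum_antidiagonal_succ']
    have key : ∑ x ∈ Finset.HasAntidiagonal.antidiagonal l,
        PowerSeries.C (ww (x.1 + 1) (x.2 + 1)) * (-P) ^ (x.1 + 1) * (eD^[x.2 + 1] f)
        = ∑ x ∈ Finset.HasAntidiagonal.antidiagonal l,
          PowerSeries.C (ww (x.1 + 1) x.2) * (-P) ^ (x.1 + 1) * (eD^[x.2 + 1] f)
        + ∑ x ∈ Finset.HasAntidiagonal.antidiagonal l,
          (12 + x.1 + 2 * (x.2 + 1 : ℕ)) * PowerSeries.C (ww x.1 (x.2 + 1)) * (-P) ^ (x.1 + 1)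
            * (eD^[x.2 + 1] f) := by
      rw [← Finset.sum_add_distrib]
      refine Finset.sum_congr rfl fun x _ => ?_
      rw [ww_ss]
      simp only [map_mul, map_add, map_natCast, map_ofNat, map_one]
      push_cast
      ring
    have hw : ww (l + 1 + 1) 0 = (12 + (l + 1)) * ww (l + 1) 0 := by
      rw [ww]
      have : (l : ℂ) + 1 + 1 ≠ 0 := by exact_mod_cast Nat.succ_ne_zero (l + 1)
      push_cast
      field_simp
      ring
    simp only [] at key ⊢
    rw [key, hw]
    simp only [map_mul, map_add, map_natCast, map_ofNat, map_one, ww]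
    push_cast
    ring
  rw [h5, ← h4]
  ring

theorem main_identity {U v P f : ℂ⟦X⟧} (h : UVData U v P f) (k : ℕ) :
    f * hh U v k = gg P f k := by
  induction k using Nat.twoStepInduction with
  | zero => simp [hh, gg, tt_00, ww]
  | one =>
    have := eD_hh h 0
    have h0 : f * hh U v 0 = gg P f 0 := by simp [hh, gg, tt_00, ww]
    rw [gg_one, ← h0, this, hh_one]
    push_cast
    ring
  | more l ih1 ih2 =>
    rw [gg_two, ← ih1, ← ih2, eD_hh h, hh_two, h.hP]
    push_cast
    ring

end FormalIdentity

section Limits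
open scoped PowerSeries
open Asymptotics

/-- Exponential growth rate at most `x`. -/
def ZZ (x : ℝ) (a : ℕ → ℂ) : Prop := ∀ y : ℝ, x < y → a =O[atTop] (fun k : ℕ => y ^ k)

lemma ZZ.mono {x x' : ℝ} {a : ℕ → ℂ} (h : ZZ x a) (hx : x ≤ x') : ZZ x' a :=
  fun y hy => h y (lt_of_le_of_lt hx hy)

lemma ZZ.add {x : ℝ} {a b : ℕ → ℂ} (h : ZZ x a) (h' : ZZ x b) : ZZ x (fun k => a k + b k) :=
  fun y hy => (h y hy).add (h' y hy)

lemma ZZ.sub {x : ℝ} {a b : ℕ → ℂ} (h : ZZ x a) (h' : ZZ x b) : ZZ x (fun k => a k - b k) :=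
  fun y hy => (h y hy).sub (h' y hy)

lemma ZZ.sum {ι : Type*} {s : Finset ι} {x : ℝ} {a : ι → ℕ → ℂ} (h : ∀ i ∈ s, ZZ x (a i)) :
    ZZ x (fun k => ∑ i ∈ s, a i k) :=
  fun y hy => IsBigO.fun_sum fun i hi => h i hi y hy

lemma ZZ.congr {x : ℝ} {a b : ℕ → ℂ} (h : ZZ x a) (n : ℕ) (hab : ∀ k, n ≤ k → b k = a k) : ZZ x b :=
  fun y hy => (h y hy).congr' (by
    filter_upwards [eventually_ge_atTop n] with k hk using (hab k hk).symm) EventuallyEq.rfl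

lemma ZZ.mul {x : ℝ} (hx : 0 ≤ x) {a b : ℕ → ℂ} (h : ZZ x a) (h' : ZZ 1 b) :
    ZZ x (fun k => b k * a k) := by
  intro y hy
  have h1 : x < (x + y) / 2 := by linarith
  have h0 : 0 < (x + y) / 2 := by linarith
  have h2 : 1 < y / ((x + y) / 2) := by rw [one_lt_div h0]; linarith
  refine ((h' _ h2).mul (h _ h1)).congr_right fun k => ?_
  rw [← mul_pow, div_mul_cancel₀ _ h0.ne']

lemma ZZ.shift {x : ℝ} (hx : 1 ≤ x) {a : ℕ → ℂ} (h : ZZ x a) (i : ℕ) :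
    ZZ x (fun k => a (k - i)) := by
  intro y hy
  refine ((h y hy).comp_tendsto (tendsto_sub_atTop_nat i)).trans (IsBigO.of_norm_le fun k => ?_)
  have : 1 ≤ y := by linarith
  simp only [Function.comp, norm_pow, Real.norm_eq_abs, abs_of_nonneg (by linarith : 0 ≤ y)]
  exact pow_le_pow_right₀ this (Nat.sub_le _ _)

lemma ZZ.unshift {x : ℝ} (hx : 0 ≤ x) {a : ℕ → ℂ} (h : ZZ x (fun k => a (k + 1))) : ZZ x a := by
  intro y hy
  have hy0 : 0 < y := by linarith
  have h1 := ((h y hy).comp_tendsto (tendsto_sub_atTop_nat 1))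
  have h2 : a =O[atTop] ((fun k : ℕ => y ^ k) ∘ fun k => k - 1) := h1.congr' (by
    filter_upwards [eventually_ge_atTop 1] with k hk
    simp [Function.comp, Nat.sub_add_cancel hk]) EventuallyEq.rfl
  refine h2.trans (IsBigO.of_bound (1 / y) ?_)
  filter_upwards [eventually_ge_atTop 1] with k hk
  obtain ⟨j, rfl⟩ := Nat.exists_eq_add_of_le' hk
  simp only [Function.comp, Nat.add_sub_cancel, norm_pow, Real.norm_eq_abs, abs_of_pos hy0]
  rw [pow_succ]
  apply le_of_eq
  field_simp

lemma ZZ.const (c : ℂ) : ZZ 1 (fun _ => c) := by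
  intro y hy
  refine IsBigO.of_bound ‖c‖ (Eventually.of_forall fun k => ?_)
  simp only [norm_pow, Real.norm_eq_abs, abs_of_pos (by linarith : 0 < y)]
  exact le_mul_of_one_le_right (norm_nonneg _) (one_le_pow₀ hy.le)

lemma ZZ.id : ZZ 1 (fun k => (k : ℂ)) := by
  intro y hy
  have := (isLittleO_pow_const_const_pow_of_one_lt (R := ℝ) 1 hy).isBigO
  refine IsBigO.congr_left (f₁ := fun k : ℕ => ((k : ℝ) : ℂ)) ?_ (fun k => by simp)
  rw [← isBigO_norm_left]
  simp only [Complex.norm_real]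
  rw [isBigO_norm_left]
  simpa using this

lemma ZZ.mul1 {a b : ℕ → ℂ} (h : ZZ 1 a) (h' : ZZ 1 b) : ZZ 1 (fun k => a k * b k) :=
  h'.mul zero_le_one h

lemma ZZ.powN (b : ℝ) (hb : 0 ≤ b) : ZZ b (fun k => (b : ℂ) ^ k) := by
  intro y hy
  refine IsBigO.of_norm_le fun k => ?_
  simp only [norm_pow, Complex.norm_real, Real.norm_eq_abs, abs_of_nonneg hb]
  exact pow_le_pow_left₀ hb (le_trans hy.le (le_refl _)) _

lemma ZZ.summable {x : ℝ} {M : ℝ} (hx : 0 ≤ x) (hM : x < M) {a : ℕ → ℂ} (h : ZZ x a) :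
    Summable (fun k => a k / (M : ℂ) ^ k) := by
  have h0 : 0 < M := by linarith
  have h1 := h ((x + M) / 2) (by linarith)
  have h2 : Summable (fun k : ℕ => (((x + M) / 2) / M) ^ k) :=
    summable_geometric_of_lt_one (by positivity) (by rw [div_lt_one h0]; linarith)
  refine summable_of_isBigO_nat h2 ?_
  have h3 : (fun k : ℕ => ((M : ℂ) ^ k)⁻¹) =O[atTop] (fun k : ℕ => (M ^ k)⁻¹) :=
    IsBigO.of_norm_le fun k => by
      simp [abs_of_pos h0]
  refine (h1.mul h3).congr (fun k => (div_eq_mul_inv _ _).symm) (fun k => ?_)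
  rw [div_pow _ M, div_eq_mul_inv (_ ^ k) (M ^ k)]

lemma ZZ.tendsto {x : ℝ} {M : ℝ} (hx : 0 ≤ x) (hM : x < M) {a : ℕ → ℂ} (h : ZZ x a) :
    Tendsto (fun k => a k / (M : ℂ) ^ k) atTop (𝓝 0) :=
  (h.summable hx hM).tendsto_atTop_zero

lemma ZZ.of_tendsto {M : ℝ} (hM : 0 < M) {a : ℕ → ℂ} {c : ℂ}
    (h : Tendsto (fun k => a k / (M : ℂ) ^ k) atTop (𝓝 c)) : ZZ M a := by
  intro y hy
  have h1 := h.isBigO_one ℝ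
  have h3 : (fun k : ℕ => ((M : ℂ) ^ k)) =O[atTop] (fun k : ℕ => (y ^ k)) :=
    ZZ.powN M hM.le y hy
  refine (h1.mul h3).congr (fun k => ?_) (fun k => one_mul _)
  have : (M : ℂ) ^ k ≠ 0 := pow_ne_zero _ (by exact_mod_cast hM.ne')
  field_simp

/-- Coefficients of `(1 - (m+2) v) R_m`. -/
def HH (m : ℕ) : ℕ → ℂ
  | 0 => rr m 0
  | k + 1 => rr m (k + 1) - (m + 2) * rr m k

lemma rr_div (m k : ℕ) : rr m k / ((m + 2 : ℝ) : ℂ) ^ k =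
    ∑ j ∈ Finset.range (k + 1), HH m j / ((m + 2 : ℝ) : ℂ) ^ j := by
  have h0 : ((m + 2 : ℝ) : ℂ) ≠ 0 := by
    exact_mod_cast (by positivity : (m + 2 : ℝ) ≠ 0)
  induction k with
  | zero => simp [HH]
  | succ k ih =>
    rw [Finset.sum_range_succ, ← ih, HH]
    have : (m + 2 : ℂ) = ((m + 2 : ℝ) : ℂ) := by push_cast; ring
    rw [this]
    field_simp
    ring

lemma HH_tendsto (m : ℕ) (h : ZZ (m + 1) (HH m)) :
    Summable (fun k => HH m k / ((m + 2 : ℝ) : ℂ) ^ k) ∧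
    Tendsto (fun k => rr m k / ((m + 2 : ℝ) : ℂ) ^ k) atTop
      (𝓝 (∑' k, HH m k / ((m + 2 : ℝ) : ℂ) ^ k)) := by
  have hs := h.summable (M := (m + 2 : ℝ)) (by positivity) (by linarith)
  refine ⟨hs, ?_⟩
  have := (hs.hasSum.tendsto_sum_nat).comp (tendsto_add_atTop_nat 1)
  refine this.congr fun k => (rr_div m k).symm

lemma HH_ZZ (m : ℕ) : ZZ (m + 1) (HH m) := by
  induction m with
  | zero =>
    refine (ZZ.const 0).congr 1 (fun k hk => ?_) |>.mono (by simp)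
    obtain ⟨j, rfl⟩ := Nat.exists_eq_add_of_le' hk
    simp [HH, rr_succ0]
  | succ m ih =>
    have h1 : ZZ (m + 2) (rr m) := ZZ.of_tendsto (by positivity) (HH_tendsto m ih).2
    have hp : (0 : ℝ) ≤ m + 2 := by positivity
    have h2 : ZZ (m + 2) (fun k => rr m (k - 1)) := h1.shift (by linarith [Nat.cast_nonneg (α := ℝ) m]) 1
    have h3 := (h1.mul hp ((ZZ.id.add (ZZ.const (2 - m))))).sub
      (h2.mul hp ((ZZ.id.mul1 (ZZ.id.add (ZZ.const 11))).mul1 (ZZ.const (1/4))))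
    have h4 : ZZ (m + 2) (fun k => HH (m + 1) (k + 1)) := by
      refine h3.congr 0 fun k _ => ?_
      rw [HH, rr_succ]; push_cast; ring
    refine (h4.unshift hp).mono ?_
    push_cast; linarith

lemma rr_ZZ (m : ℕ) : ZZ (m + 2) (rr m) :=
  ZZ.of_tendsto (by positivity) (HH_tendsto m (HH_ZZ m)).2

/-- The residue constant. -/
def cc (m : ℕ) : ℂ := ∑' k, HH m k / ((m + 2 : ℝ) : ℂ) ^ k

lemma coeff_pow_zero (W : ℂ⟦X⟧) (hW : PowerSeries.coeff 0 W = 0) (l : ℕ) :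
    ∀ n < l, PowerSeries.coeff n (W ^ l) = 0 := by
  intro n hn
  have : PowerSeries.X ^ l ∣ W ^ l := pow_dvd_pow_of_dvd (PowerSeries.X_dvd_iff.mpr (by simpa using hW)) l
  exact PowerSeries.X_pow_dvd_iff.mp this n hn

lemma coeff_mul_zero (a b : ℂ⟦X⟧) (n l : ℕ) (ha : ∀ k < l, PowerSeries.coeff k a = 0) (hn : n < l) :
    PowerSeries.coeff n (a * b) = 0 :=
  PowerSeries.X_pow_dvd_iff.mp ((PowerSeries.X_pow_dvd_iff.mpr ha).mul_right b) n hn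

lemma sum_trunc (F : ℕ → ℂ) (n k : ℕ) (hk : n ≤ k) (hF : ∀ i, n < i → F i = 0) :
    ∑ i ∈ Finset.range (k + 1), F i = ∑ i ∈ Finset.range (n + 1), F i := by
  symm
  refine Finset.sum_subset (Finset.range_mono (by omega)) fun i _ hi => hF i ?_
  simp at hi; omega

lemma U_pow_ZZ (U g : ℂ⟦X⟧) (hU : PowerSeries.coeff 0 U = 1) (n : ℕ) :
    ZZ 1 (fun k => PowerSeries.coeff n (g * U ^ k)) := by
  set W := U - 1 with hW
  have W0 : PowerSeries.coeff 0 W = 0 := by rw [hW, map_sub, hU]; simp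
  have hUW : U = W + 1 := by rw [hW]; ring
  have h1 : ZZ 1 (fun k => ∑ l ∈ Finset.range (n + 1),
      (k.choose l : ℂ) * PowerSeries.coeff n (W ^ l * g)) := by
    refine ZZ.sum fun l _ => ZZ.mul1 ?_ (ZZ.const _)
    intro y hy
    have := (isLittleO_pow_const_const_pow_of_one_lt (R := ℝ) l hy).isBigO
    refine IsBigO.trans (IsBigO.of_norm_le fun k => ?_) this
    simp only [Complex.norm_natCast]
    exact_mod_cast Nat.choose_le_pow k l
  refine h1.congr n fun k hk => ?_
  rw [hUW, add_pow, Finset.mul_sum, map_sum, ← sum_trunc _ n k hk]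
  · refine Finset.sum_congr rfl fun l _ => ?_
    have : g * (W ^ l * 1 ^ (k - l) * (k.choose l : ℂ⟦X⟧)) =
      PowerSeries.C (k.choose l : ℂ) * (W ^ l * g) := by
      rw [map_natCast]; ring
    rw [this, PowerSeries.coeff_C_mul]
  · intro l hl
    rw [coeff_mul_zero _ _ n l (coeff_pow_zero W W0 l) hl, mul_zero]

lemma ww_ZZ (i : ℕ) : ZZ 1 (ww i) := by
  induction i with
  | zero => exact (ZZ.const 1).congr 0 fun k _ => by rw [ww]
  | succ i ih =>
    refine ((((ZZ.id.add (ZZ.const (i + 1))).mul1 (ZZ.id.add (ZZ.const (i + 12)))).mul1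
      (ZZ.const (1 / (i + 1)))).mul1 ih).congr 0 fun k _ => ?_
    rw [ww]; ring

lemma eD_iter_coeff (f : ℂ⟦X⟧) (n j : ℕ) :
    PowerSeries.coeff n (eD^[j] f) = n ^ j * PowerSeries.coeff n f := by
  induction j with
  | zero => simp
  | succ j ih => rw [← eD_iter, eD_coeff, ih]; ring

lemma gg_tendsto {U v P f : ℂ⟦X⟧} (h : UVData U v P f) (m : ℕ) :
    Tendsto (fun k => PowerSeries.coeff (m + 2) (gg P f k) / ((m + 2 : ℝ) : ℂ) ^ k) atTop
      (𝓝 (PowerSeries.coeff (m + 2) f)) := by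
  have h0 : ((m + 2 : ℝ) : ℂ) ≠ 0 := by
    exact_mod_cast (by positivity : (m + 2 : ℝ) ≠ 0)
  have nP0 : PowerSeries.coeff 0 (-P) = 0 := by rw [map_neg, h.P0, neg_zero]
  have key : ZZ (m + 1) (fun k => PowerSeries.coeff (m + 2) (gg P f k)
      - (m + 2) ^ k * PowerSeries.coeff (m + 2) f) := by
    have h1 : ZZ (m + 1) (fun k => ∑ i ∈ Finset.range (m + 2), ww (i + 1) (k - (i + 1)) *
        ∑ x ∈ Finset.HasAntidiagonal.antidiagonal (m + 2), PowerSeries.coeff x.1 ((-P) ^ (i + 1)) *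
          (((x.2 : ℂ) ^ (k - (i + 1))) * PowerSeries.coeff x.2 f)) := by
      refine ZZ.sum fun i _ => ZZ.mul (by positivity) (ZZ.sum fun x hx => ?_)
        ((ww_ZZ (i + 1)).shift le_rfl _)
      have hx' : x.1 + x.2 = m + 2 := Finset.HasAntidiagonal.mem_antidiagonal.mp hx
      by_cases hx0 : x.1 = 0
      · refine ((ZZ.const 0).mono (by simp)).congr 0 fun k _ => ?_
        rw [hx0, coeff_pow_zero _ nP0 (i + 1) 0 (by omega), zero_mul]
      · have a1 : ZZ (m + 1) (fun k => (x.2 : ℂ) ^ k) := by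
          have := (ZZ.powN (x.2 : ℝ) (Nat.cast_nonneg _)).mono (x' := m + 1)
            (by exact_mod_cast (by omega : x.2 ≤ m + 1))
          simpa using this
        have a2 := a1.shift (by simp) (i + 1)
        refine (a2.mul (by positivity) (ZZ.const (PowerSeries.coeff x.1 ((-P) ^ (i + 1)) *
          PowerSeries.coeff x.2 f))).congr 0 fun k _ => ?_
        ring
    refine h1.congr (m + 2) fun k hk => ?_
    rw [gg, map_sum, Finset.Nat.sum_antidiagonal_eq_sum_range_succ
      (fun i j => PowerSeries.coeff (m + 2) (PowerSeries.C (ww i j) * (-P) ^ i * (eD^[j] f))),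
      sum_trunc _ (m + 2) k hk, Finset.sum_range_succ']
    · have e0 : PowerSeries.coeff (m + 2) (PowerSeries.C (ww 0 (k - 0)) * (-P) ^ 0 * (eD^[k - 0] f))
        = (m + 2) ^ k * PowerSeries.coeff (m + 2) f := by
        rw [ww, pow_zero, mul_one, map_one, one_mul, eD_iter_coeff, Nat.sub_zero]; push_cast; ring
      rw [e0, add_sub_cancel_right]
      refine Finset.sum_congr rfl fun i _ => ?_
      rw [mul_assoc, PowerSeries.coeff_C_mul, PowerSeries.coeff_mul]
      simp only [eD_iter_coeff]
    · intro i hi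
      rw [mul_assoc, PowerSeries.coeff_C_mul,
        coeff_mul_zero _ _ _ i (coeff_pow_zero _ nP0 i) hi, mul_zero]
  have := (key.tendsto (M := (m + 2 : ℝ)) (by positivity) (by linarith)).add_const
    (PowerSeries.coeff (m + 2) f)
  rw [zero_add] at this
  refine this.congr fun k => ?_
  have e : (m + 2 : ℂ) = ((m + 2 : ℝ) : ℂ) := by push_cast; ring
  rw [e]
  field_simp
  ring

lemma hh_tendsto {U v P f : ℂ⟦X⟧} (h : UVData U v P f) (m : ℕ) :
    Tendsto (fun k => PowerSeries.coeff (m + 2) (f * hh U v k) / ((m + 2 : ℝ) : ℂ) ^ k) atTop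
      (𝓝 (16 ^ m * cc m)) := by
  have h0 : ((m + 2 : ℝ) : ℂ) ≠ 0 := by
    exact_mod_cast (by positivity : (m + 2 : ℝ) ≠ 0)
  have hf : ∀ n < 2, PowerSeries.coeff n f = 0 := by
    intro n hn; interval_cases n
    exacts [h.f0, h.f1]
  have hlow : ∀ i, ∀ n < i + 2, PowerSeries.coeff n (v ^ i * f) = 0 := by
    intro i
    have d1 := pow_dvd_pow_of_dvd (PowerSeries.X_dvd_iff.mpr (by simpa using h.v0 : _)) i
    have d2 := PowerSeries.X_pow_dvd_iff.mpr hf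
    have d3 := mul_dvd_mul d1 d2
    rw [← pow_add] at d3
    exact PowerSeries.X_pow_dvd_iff.mp d3
  have hlead : ∀ i, PowerSeries.coeff (i + 2) (v ^ i * f) = 4 ^ i := by
    intro i
    obtain ⟨v', hv'⟩ := PowerSeries.X_dvd_iff.mpr (by simpa using h.v0 : PowerSeries.constantCoeff v = 0)
    obtain ⟨f', hf'⟩ := PowerSeries.X_pow_dvd_iff.mpr hf
    have e1 : PowerSeries.constantCoeff v' = 4 := by
      have := h.v1
      rw [hv', show 1 = 0 + 1 from rfl, PowerSeries.coeff_succ_X_mul] at this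
      simpa using this
    have e2 : PowerSeries.constantCoeff f' = 1 := by
      have := h.f2
      rw [hf', show 2 = 0 + 2 from rfl, PowerSeries.coeff_X_pow_mul] at this
      simpa using this
    have : v ^ i * f = PowerSeries.X ^ (i + 2) * (v' ^ i * f') := by rw [hv', hf']; ring
    have e3 := PowerSeries.coeff_X_pow_mul (v' ^ i * f') (i + 2) 0
    rw [zero_add] at e3
    rw [this, e3]
    simp [e1, e2]
  have key : ZZ (m + 1) (fun k => PowerSeries.coeff (m + 2) (f * hh U v k) - 16 ^ m * rr m k) := by
    have h1 : ZZ (m + 1) (fun k => ∑ i ∈ Finset.range m,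
        (4 ^ i * PowerSeries.coeff (m + 2) (v ^ i * f * U ^ (k - i))) * rr i k) := by
      refine ZZ.sum fun i hi => ZZ.mul (by positivity) ((rr_ZZ i).mono ?_)
        ((ZZ.const _).mul1 ((U_pow_ZZ U (v ^ i * f) h.U0 (m + 2)).shift le_rfl i))
      have : i + 1 ≤ m := by simpa using hi
      have : (i : ℝ) + 1 ≤ m := by exact_mod_cast this
      linarith
    refine h1.congr m fun k hk => ?_
    rw [hh, Finset.mul_sum, map_sum, Finset.Nat.sum_antidiagonal_eq_sum_range_succ
      (fun i j => PowerSeries.coeff (m + 2) (f * (PowerSeries.C (tt i j) * v ^ i * U ^ j)))]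
    have e1 : ∀ i j, PowerSeries.coeff (m + 2) (f * (PowerSeries.C (tt i j) * v ^ i * U ^ j)) =
        tt i j * PowerSeries.coeff (m + 2) (v ^ i * f * U ^ j) := by
      intro i j
      rw [← PowerSeries.coeff_C_mul]; congr 1; ring
    simp only [e1]
    rw [sum_trunc _ m k hk, Finset.sum_range_succ]
    · have e2 : PowerSeries.coeff (m + 2) (v ^ m * f * U ^ (k - m)) = 4 ^ m := by
        rw [coeff_mul_low (hlow m), hlead]
        simp [show PowerSeries.constantCoeff U = 1 by simpa using h.U0]
      rw [e2]
      have e3 : tt m (k - m) * 4 ^ m = 16 ^ m * rr m k := by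
        rw [tt, Nat.add_sub_cancel' hk, show (16 : ℂ) = 4 * 4 by norm_num, mul_pow]; ring
      rw [e3, add_sub_cancel_right]
      refine Finset.sum_congr rfl fun i hi => ?_
      have : i < m := by simpa using hi
      rw [tt, Nat.add_sub_cancel' (by omega)]; ring
    · intro i hi
      rw [coeff_mul_zero _ _ _ (i + 2) (hlow i) (by omega), mul_zero]
  have := (key.tendsto (M := (m + 2 : ℝ)) (by positivity) (by linarith)).add
    ((HH_tendsto m (HH_ZZ m)).2.const_mul (16 ^ m))
  rw [zero_add] at this
  refine this.congr fun k => ?_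
  field_simp
  ring

theorem cc_eq {U v P f : ℂ⟦X⟧} (h : UVData U v P f) (m : ℕ) :
    16 ^ m * cc m = PowerSeries.coeff (m + 2) f := by
  refine tendsto_nhds_unique (hh_tendsto h m) ?_
  simp only [main_identity h]
  exact gg_tendsto h m

end Limits

section Rational
open scoped PowerSeries

/-- Embedding of rational polynomials into complex power series. -/
def io : ℚ[X] →+* ℂ⟦X⟧ :=
  (Polynomial.coeToPowerSeries.ringHom (R := ℂ)).comp (Polynomial.mapRingHom (algebraMap ℚ ℂ))

lemma io_apply (p : ℚ[X]) : io p = ((p.map (algebraMap ℚ ℂ) : ℂ[X]) : ℂ⟦X⟧) := rfl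

lemma io_inj {p : ℚ[X]} (h : p ≠ 0) : io p ≠ 0 := by
  rw [io_apply]
  intro h'
  apply h
  have := Polynomial.coe_eq_zero_iff.mp h'
  exact (Polynomial.map_eq_zero _).mp this

lemma io_X : io Polynomial.X = PowerSeries.X := by simp [io_apply]

lemma io_C (c : ℚ) : io (Polynomial.C c) = PowerSeries.C (c : ℂ) := by simp [io_apply]

lemma io_deriv (p : ℚ[X]) : io (Polynomial.derivative p) = PowerSeries.derivative ℂ (io p) := by
  rw [io_apply, io_apply, PowerSeries.derivative_coe, Polynomial.derivative_map]

/-- `f` has power series expansion `r` at `0`. -/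
def HasExp (f : RatFunc ℚ) (r : ℂ⟦X⟧) : Prop :=
  ∃ a b : ℚ[X], b ≠ 0 ∧ f * algebraMap ℚ[X] (RatFunc ℚ) b = algebraMap ℚ[X] (RatFunc ℚ) a ∧
    io a = io b * r

lemma HasExp.rep {f : RatFunc ℚ} {r : ℂ⟦X⟧} (h : HasExp f r) {c d : ℚ[X]}
    (hcd : f * algebraMap ℚ[X] (RatFunc ℚ) c = algebraMap ℚ[X] (RatFunc ℚ) d) :
    io d = io c * r := by
  obtain ⟨a, b, hb, hab, h⟩ := h
  have : a * c = b * d := by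
    apply RatFunc.algebraMap_injective ℚ
    rw [map_mul, map_mul, ← hab, ← hcd]; ring
  apply mul_left_cancel₀ (io_inj hb)
  rw [← map_mul, ← this, map_mul, h]; ring

lemma HasExp.nd {f : RatFunc ℚ} {r : ℂ⟦X⟧} (h : HasExp f r) : io f.num = io f.denom * r := by
  apply h.rep
  have hd : algebraMap ℚ[X] (RatFunc ℚ) f.denom ≠ 0 :=
    (map_ne_zero_iff _ (RatFunc.algebraMap_injective ℚ)).mpr f.denom_ne_zero
  have e := RatFunc.num_div_denom f
  rw [div_eq_iff hd] at e
  exact e.symm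

lemma HasExp.add {f g : RatFunc ℚ} {r s : ℂ⟦X⟧} (h : HasExp f r) (h' : HasExp g s) : HasExp (f + g) (r + s) := by
  obtain ⟨a, b, hb, hab, h⟩ := h
  obtain ⟨c, d, hd, hcd, h'⟩ := h'
  refine ⟨a * d + c * b, b * d, mul_ne_zero hb hd, ?_, ?_⟩
  · simp only [map_mul, map_add, ← hab, ← hcd]; ring
  · simp only [map_mul, map_add, h, h']; ring

lemma HasExp.poly (p : ℚ[X]) : HasExp (algebraMap ℚ[X] (RatFunc ℚ) p) (io p) :=
  ⟨p, 1, one_ne_zero, by simp, by simp⟩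

lemma HasExp.pmul {f : RatFunc ℚ} {r : ℂ⟦X⟧} (h : HasExp f r) (p : ℚ[X]) :
    HasExp (algebraMap ℚ[X] (RatFunc ℚ) p * f) (io p * r) := by
  obtain ⟨a, b, hb, hab, h⟩ := h
  refine ⟨p * a, b, hb, ?_, ?_⟩
  · rw [mul_assoc, hab, map_mul]
  · rw [map_mul, h]; ring

lemma HasExp.unmul {f : RatFunc ℚ} {r : ℂ⟦X⟧} {p : ℚ[X]} (hp : p ≠ 0)
    (h : HasExp (algebraMap ℚ[X] (RatFunc ℚ) p * f) (io p * r)) : HasExp f r := by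
  obtain ⟨a, b, hb, hab, h⟩ := h
  refine ⟨a, p * b, mul_ne_zero hp hb, ?_, ?_⟩
  · rw [← hab, map_mul]; ring
  · rw [map_mul, h]; ring

lemma HasExp.mulX {f : RatFunc ℚ} {r : ℂ⟦X⟧} (h : HasExp f r) : HasExp (RatFunc.X * f) (PowerSeries.X * r) := by
  have := h.pmul Polynomial.X
  rwa [RatFunc.algebraMap_X, io_X] at this

lemma HasExp.smul {f : RatFunc ℚ} {r : ℂ⟦X⟧} (h : HasExp f r) (c : ℚ) :
    HasExp (c • f) (PowerSeries.C (c : ℂ) * r) := by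
  have := h.pmul (Polynomial.C c)
  rwa [RatFunc.algebraMap_C, io_C, ← RatFunc.smul_eq_C_mul] at this

lemma HasExp.deriv {f : RatFunc ℚ} {r : ℂ⟦X⟧} (h : HasExp f r) :
    HasExp (ratDeriv f) (PowerSeries.derivative ℂ r) := by
  have hn := h.nd
  have hd := f.denom_ne_zero
  refine ⟨Polynomial.derivative f.num * f.denom - f.num * Polynomial.derivative f.denom,
    f.denom ^ 2, pow_ne_zero 2 hd, ?_, ?_⟩
  · rw [ratDeriv, RatFunc.mk_eq_div]
    rw [div_mul_cancel₀]
    exact (map_ne_zero_iff _ (RatFunc.algebraMap_injective ℚ)).mpr (pow_ne_zero 2 hd)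
  · have h2 := congrArg (PowerSeries.derivative ℂ) hn
    rw [Derivation.leibniz, ← io_deriv, ← io_deriv] at h2
    simp only [map_sub, map_mul, map_pow, h2, hn, smul_eq_mul]
    ring

lemma HasExp.congr {f : RatFunc ℚ} {r s : ℂ⟦X⟧} (h : HasExp f r) (hrs : r = s) : HasExp f s := hrs ▸ h

/-- The generating series of `rr m`. -/
def rho (m : ℕ) : ℂ⟦X⟧ := PowerSeries.mk (rr m)

lemma HH_series (m : ℕ) : PowerSeries.mk (HH m) =
    (1 - PowerSeries.C ((m : ℂ) + 2) * PowerSeries.X) * rho m := by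
  ext k
  rw [sub_mul, one_mul, mul_assoc, map_sub, PowerSeries.coeff_C_mul, PowerSeries.coeff_mk]
  cases k with
  | zero => simp [HH, rho]
  | succ k => rw [PowerSeries.coeff_succ_X_mul]; simp [HH, rho]

lemma io_lin (m : ℕ) : io (1 - Polynomial.C ((m : ℚ) + 2) * Polynomial.X) =
    1 - PowerSeries.C ((m : ℂ) + 2) * PowerSeries.X := by
  rw [map_sub, map_mul, io_C, io_X, map_one]; push_cast; rfl

lemma lin_ne (m : ℕ) : (1 - Polynomial.C ((m : ℚ) + 2) * Polynomial.X : ℚ[X]) ≠ 0 := by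
  intro h
  have := congrArg (Polynomial.eval 0) h
  simp at this

lemma series_rec (m : ℕ) : PowerSeries.mk (HH (m + 1)) = PowerSeries.C ((-1 : ℚ) : ℂ) *
    (PowerSeries.X * (PowerSeries.C ((((m + 1 : ℕ) : ℚ) - 3 : ℚ) : ℂ) * rho m +
      PowerSeries.C ((-1 : ℚ) : ℂ) * (PowerSeries.X * PowerSeries.derivative ℂ (rho m)) +
      PowerSeries.C ((11/4 : ℚ) : ℂ) * (PowerSeries.X * PowerSeries.derivative ℂ (PowerSeries.X * rho m)) +
      PowerSeries.C ((1/4 : ℚ) : ℂ) * (PowerSeries.X * PowerSeries.derivative ℂ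
        (PowerSeries.X * PowerSeries.derivative ℂ (PowerSeries.X * rho m))))) := by
  ext k
  rw [PowerSeries.coeff_mk, PowerSeries.coeff_C_mul]
  cases k with
  | zero => simp [HH, rr_zero]
  | succ k =>
    rw [PowerSeries.coeff_succ_X_mul]
    have e : ∀ p : ℂ⟦X⟧, PowerSeries.X * PowerSeries.derivative ℂ p = eD p := fun p => (eD_apply p).symm
    simp only [e, map_add, PowerSeries.coeff_C_mul, eD_coeff]
    rw [HH, rr_succ]
    cases k with
    | zero => simp [rho]; ring
    | succ k =>
      rw [PowerSeries.coeff_succ_X_mul]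
      simp only [rho, PowerSeries.coeff_mk, Nat.add_sub_cancel]
      push_cast; ring

theorem hasExp_R (R : ℕ → RatFunc ℚ)
    (hRrec : ∀ m : ℕ, R m / RatFunc.X - ((m : ℚ) + 2) • R m + ((m : ℚ) - 3) • (if m = 0 then 0 else R (m - 1)) - RatFunc.X * ratDeriv (if m = 0 then 0 else R (m - 1)) + (11/4 : ℚ) • (RatFunc.X * ratDeriv (RatFunc.X * (if m = 0 then 0 else R (m - 1)))) + (1/4 : ℚ) • (RatFunc.X * ratDeriv (RatFunc.X * ratDeriv (RatFunc.X * (if m = 0 then 0 else R (m - 1))))) = (if m = 0 then 1 else 0) / RatFunc.X)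
    (m : ℕ) : HasExp (R m) (rho m) := by
  have hX : (RatFunc.X : RatFunc ℚ) ≠ 0 := RatFunc.X_ne_zero
  have hd0 : ratDeriv 0 = 0 := by simp [ratDeriv]
  have lin : ∀ m : ℕ, algebraMap ℚ[X] (RatFunc ℚ) (1 - Polynomial.C ((m : ℚ) + 2) * Polynomial.X)
      = 1 - RatFunc.C ((m : ℚ) + 2) * RatFunc.X := by
    intro m
    rw [map_sub, map_mul, RatFunc.algebraMap_C, RatFunc.algebraMap_X, map_one]
  induction m with
  | zero =>
    have h := hRrec 0
    simp only [if_true, mul_zero, hd0, smul_zero, add_zero, sub_zero, RatFunc.smul_eq_C_mul] at h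
    refine HasExp.unmul (lin_ne 0) ?_
    rw [lin, io_lin, ← HH_series]
    field_simp at h
    have e1 : (1 - RatFunc.C (((0 : ℕ) : ℚ) + 2) * RatFunc.X) * R 0 = 1 := by
      linear_combination h
    rw [e1]
    have := HasExp.poly 1
    rw [map_one, map_one] at this
    refine this.congr ?_
    ext k
    cases k with
    | zero => simp [HH, rr_zero]
    | succ k => simp [HH, rr_succ0, PowerSeries.coeff_one]
  | succ m ih =>
    have h := hRrec (m + 1)
    simp only [if_neg (Nat.succ_ne_zero m), Nat.add_sub_cancel] at h
    refine HasExp.unmul (lin_ne (m + 1)) ?_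
    rw [lin, io_lin, ← HH_series, series_rec]
    have key := ((((ih.smul (((m + 1 : ℕ) : ℚ) - 3)).add (ih.deriv.mulX.smul (-1))).add
      (ih.mulX.deriv.mulX.smul (11/4))).add (ih.mulX.deriv.mulX.deriv.mulX.smul (1/4))).mulX.smul (-1)
    convert key using 1
    simp only [RatFunc.smul_eq_C_mul, map_neg, map_one] at h ⊢
    rw [zero_div] at h
    have h2 := congrArg (fun t => RatFunc.X * t) h
    simp only [mul_add, mul_sub, mul_zero, mul_div_cancel₀ _ hX] at h2
    linear_combination h2

lemma hasSum_X (H : ℂ⟦X⟧) (x s : ℂ) (h : HasSum (fun k => PowerSeries.coeff k H * x ^ k) s) :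
    HasSum (fun k => PowerSeries.coeff k (PowerSeries.X * H) * x ^ k) (x * s) := by
  rw [← hasSum_nat_add_iff' 1]
  simp only [PowerSeries.coeff_succ_X_mul]
  simpa [pow_succ, mul_comm, mul_assoc, mul_left_comm] using h.mul_left x

lemma hasSum_poly (p : ℂ[X]) (H : ℂ⟦X⟧) (x s : ℂ)
    (h : HasSum (fun k => PowerSeries.coeff k H * x ^ k) s) :
    HasSum (fun k => PowerSeries.coeff k ((p : ℂ⟦X⟧) * H) * x ^ k) (p.eval x * s) := by
  induction p using Polynomial.induction_on with
  | C a =>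
    simp only [Polynomial.coe_C, PowerSeries.coeff_C_mul, Polynomial.eval_C, mul_assoc]
    exact h.mul_left a
  | add p q hp hq =>
    simp only [Polynomial.coe_add, add_mul, map_add, Polynomial.eval_add]
    exact hp.add hq
  | monomial n a hn =>
    have := hasSum_X _ x _ hn
    convert this using 1
    · funext k
      congr 2
      simp only [Polynomial.coe_mul, Polynomial.coe_C, Polynomial.coe_pow, Polynomial.coe_X]; ring
    · simp; ring

lemma hasSum_poly1 (p : ℂ[X]) (x : ℂ) :
    HasSum (fun k => PowerSeries.coeff k (p : ℂ⟦X⟧) * x ^ k) (p.eval x) := by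
  have h1 : HasSum (fun k => PowerSeries.coeff k (1 : ℂ⟦X⟧) * x ^ k) 1 := by
    convert hasSum_ite_eq 0 (1 : ℂ) using 1
    funext k
    rw [PowerSeries.coeff_one]
    split_ifs with h <;> simp [h]
  simpa using hasSum_poly p 1 x 1 h1

theorem pole_iff {f : RatFunc ℚ} {m : ℕ} (h : HasExp f (rho m)) :
    f.denom.eval (1 / ((m : ℚ) + 2)) = 0 ↔ cc m ≠ 0 := by
  set x : ℂ := (algebraMap ℚ ℂ) (1 / ((m : ℚ) + 2)) with hx
  have hN : ((m : ℂ) + 2) ≠ 0 := by exact_mod_cast (by omega : m + 2 ≠ 0)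
  have hxN : x = 1 / ((m : ℂ) + 2) := by rw [hx]; simp
  have hs : HasSum (fun k => PowerSeries.coeff k (PowerSeries.mk (HH m)) * x ^ k) (cc m) := by
    have := (HH_tendsto m (HH_ZZ m)).1.hasSum
    rw [← cc] at this
    convert this using 1
    funext k
    rw [PowerSeries.coeff_mk, hxN]
    push_cast
    rw [div_pow, one_pow]; ring
  have ev : ∀ p : ℚ[X], (p.map (algebraMap ℚ ℂ)).eval x = algebraMap ℚ ℂ (p.eval (1 / ((m : ℚ) + 2))) := by
    intro p
    rw [hx, Polynomial.eval_map, Polynomial.eval₂_at_apply]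
  have hnd := h.nd
  have hE : io f.denom * PowerSeries.mk (HH m) =
      io (f.num * (1 - Polynomial.C ((m : ℚ) + 2) * Polynomial.X)) := by
    rw [HH_series, map_mul, io_lin, hnd]; ring
  constructor
  · intro h0 hc
    obtain ⟨d, hd⟩ := Polynomial.dvd_iff_isRoot.mpr (show f.denom.IsRoot (1 / ((m : ℚ) + 2)) from h0)
    have hlin : (1 - Polynomial.C ((m : ℚ) + 2) * Polynomial.X : ℚ[X]) =
        (Polynomial.X - Polynomial.C (1 / ((m : ℚ) + 2))) * Polynomial.C (-((m : ℚ) + 2)) := by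
      have : (m : ℚ) + 2 ≠ 0 := by positivity
      rw [sub_mul, ← Polynomial.C_mul]
      have : 1 / ((m : ℚ) + 2) * (-((m : ℚ) + 2)) = -1 := by field_simp
      rw [this, map_neg, map_neg, map_one]; ring
    have hE2 : io d * PowerSeries.mk (HH m) = io (f.num * Polynomial.C (-((m : ℚ) + 2))) := by
      apply mul_left_cancel₀ (io_inj (Polynomial.X_sub_C_ne_zero (1 / ((m : ℚ) + 2))))
      rw [← mul_assoc, ← map_mul, ← hd, hE, hlin, ← map_mul]
      congr 1; ring
    have s1 := hasSum_poly (d.map (algebraMap ℚ ℂ)) _ x _ hs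
    rw [← io_apply, hE2, io_apply, hc, mul_zero] at s1
    have s2 := s1.unique (hasSum_poly1 _ x)
    rw [ev, eq_comm, map_eq_zero, Polynomial.eval_mul, Polynomial.eval_C] at s2
    have s3 : f.num.eval (1 / ((m : ℚ) + 2)) = 0 := by
      rcases mul_eq_zero.mp s2 with h | h
      · exact h
      · exact absurd h (neg_ne_zero.mpr (by positivity))
    obtain ⟨a, b, hab⟩ := RatFunc.isCoprime_num_denom f
    have := congrArg (Polynomial.eval (1 / ((m : ℚ) + 2))) hab
    rw [Polynomial.eval_add, Polynomial.eval_mul, Polynomial.eval_mul, s3, h0] at this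
    simp at this
  · intro hc
    have s1 := hasSum_poly (f.denom.map (algebraMap ℚ ℂ)) _ x _ hs
    rw [← io_apply, hE, io_apply] at s1
    have s2 := s1.unique (hasSum_poly1 _ x)
    rw [ev, ev, Polynomial.eval_mul] at s2
    have : (1 - Polynomial.C ((m : ℚ) + 2) * Polynomial.X : ℚ[X]).eval (1 / ((m : ℚ) + 2)) = 0 := by
      have : (m : ℚ) + 2 ≠ 0 := by positivity
      simp only [Polynomial.eval_sub, Polynomial.eval_one, Polynomial.eval_mul, Polynomial.eval_C,
        Polynomial.eval_X]
      field_simp; simp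
    rw [this, mul_zero, map_zero] at s2
    exact (map_eq_zero (algebraMap ℚ ℂ)).mp ((mul_eq_zero.mp s2).resolve_right hc)

end Rational

/-- Lehmer's conjecture (`τ(n) ≠ 0` for all `n ≥ 1`) holds if and only if for every `m ≥ 0`
the rational function `R (2m)` has a pole at `v = 1/(2m+2)` (i.e. the denominator of its
reduced form vanishes there). -/
theorem lehmer_iff_poles_of_R
    (R : ℕ → RatFunc ℚ)
    (hRrec : ∀ m : ℕ,
      R m / RatFunc.X - ((m : ℚ) + 2) • R m
        + ((m : ℚ) - 3) • (if m = 0 then 0 else R (m - 1))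
        - RatFunc.X * ratDeriv (if m = 0 then 0 else R (m - 1))
        + (11/4 : ℚ) • (RatFunc.X * ratDeriv (RatFunc.X * (if m = 0 then 0 else R (m - 1))))
        + (1/4 : ℚ) • (RatFunc.X * ratDeriv (RatFunc.X *
            ratDeriv (RatFunc.X * (if m = 0 then 0 else R (m - 1)))))
      = (if m = 0 then 1 else 0) / RatFunc.X)
    (tau : ℕ → ℂ)
    (htau : ∀ q : ℂ, ‖q‖ < 1 →
      ∑' n : ℕ, tau n * q ^ n = q * ∏' k : ℕ, (1 - q ^ (k + 1)) ^ 24) :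
    (∀ n : ℕ, 1 ≤ n → tau n ≠ 0) ↔
      (∀ m : ℕ, (R (2 * m)).denom.eval ((1 : ℚ) / (2 * m + 2)) = 0) := by
  obtain ⟨p, f, hp0, hp2, hc, hf, hf2, htc⟩ := exists_series tau htau
  obtain ⟨U, v, P, hUV⟩ := exists_UVData hp0 hp2 hc hf hf2
  have key : ∀ m : ℕ, (R (2 * m)).denom.eval ((1 : ℚ) / (2 * m + 2)) = 0 ↔ tau (m + 1) ≠ 0 := by
    intro m
    have h1 := pole_iff (hasExp_R R hRrec (2 * m))
    have h2 := cc_eq hUV (2 * m)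
    rw [show 2 * m + 2 = 2 * (m + 1) by ring, htc] at h2
    push_cast at h1
    rw [h1, ← h2]
    simp
  constructor
  · intro h m
    exact (key m).mpr (h (m + 1) (by omega))
  · intro h n hn
    obtain ⟨m, rfl⟩ := Nat.exists_eq_add_of_le' hn
    exact (key m).mp (h m)
end
end

section
/- An odd integer n ≥ 1 is a perfect number (i.e. σ(n) = 2n, where σ(n) is the sum of the positive divisors of n) if and only if Res_{v=1/n} S_n(v) = 1/16^{n−1}. -/
open Polynomial Filter Topology

noncomputable section

namespace OP

/-! ### Theta series as formal power series -/

/-- The Euler operator `q d/dq`. -/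
def qD (R : Type*) [CommRing R] : Derivation R (PowerSeries R) (PowerSeries R) :=
  (PowerSeries.X : PowerSeries R) • PowerSeries.derivative R

lemma coeff_qD {R : Type*} [CommRing R] (f : PowerSeries R) (n : ℕ) :
    PowerSeries.coeff n (qD R f) = n * PowerSeries.coeff n f := by
  cases n with
  | zero => simp [qD]
  | succ n =>
    simp only [qD, Derivation.smul_apply, smul_eq_mul, PowerSeries.coeff_succ_X_mul,
      PowerSeries.coeff_derivative]
    push_cast; ring

/-- sum of `g a q^(a^2)` -/
def th (g : ℤ → ℚ) : PowerSeries ℚ :=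
  PowerSeries.mk fun n => ∑ a ∈ (Finset.Icc (-(n : ℤ)) n).filter (fun a => a ^ 2 = (n : ℤ)), g a

lemma sq_bound {a : ℤ} {n : ℤ} (h : a ^ 2 ≤ n) : -n ≤ a ∧ a ≤ n := by
  constructor <;> nlinarith [sq_nonneg (a - 1), sq_nonneg (a + 1), sq_nonneg a,
    Int.le_self_sq a, Int.le_self_sq (-a)]

/-- Representations as a sum of two squares. -/
def rep (n : ℕ) : Finset (ℤ × ℤ) :=
  ((Finset.Icc (-(n : ℤ)) n) ×ˢ (Finset.Icc (-(n : ℤ)) n)).filter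
    (fun p => p.1 ^ 2 + p.2 ^ 2 = (n : ℤ))

lemma mem_rep {n : ℕ} {p : ℤ × ℤ} : p ∈ rep n ↔ p.1 ^ 2 + p.2 ^ 2 = (n : ℤ) := by
  unfold rep
  simp only [Finset.mem_filter, Finset.mem_product, Finset.mem_Icc]
  constructor
  · exact fun h => h.2
  · intro h
    exact ⟨⟨sq_bound (by nlinarith [sq_nonneg p.2]), sq_bound (by nlinarith [sq_nonneg p.1])⟩, h⟩

lemma coeff_th_mul (g h : ℤ → ℚ) (n : ℕ) :
    PowerSeries.coeff n (th g * th h) = ∑ p ∈ rep n, g p.1 * h p.2 := by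
  rw [PowerSeries.coeff_mul]
  simp only [th, PowerSeries.coeff_mk, Finset.sum_mul_sum, ← Finset.sum_product']
  rw [Finset.sum_sigma']
  refine Finset.sum_nbij' (fun x => x.2) (fun p => ⟨(p.1.natAbs ^ 2, p.2.natAbs ^ 2), p⟩)
    ?_ ?_ ?_ ?_ ?_
  · rintro ⟨⟨i, j⟩, ⟨a, b⟩⟩ hx
    simp only [Finset.mem_sigma, Finset.HasAntidiagonal.mem_antidiagonal, Finset.mem_product,
      Finset.mem_filter] at hx
    rw [mem_rep]
    simp only
    rw [hx.2.1.2, hx.2.2.2]; exact_mod_cast hx.1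
  · rintro ⟨a, b⟩ hp
    rw [mem_rep] at hp
    simp only [Finset.mem_sigma, Finset.HasAntidiagonal.mem_antidiagonal, Finset.mem_product,
      Finset.mem_filter, Finset.mem_Icc]
    simp only [Nat.cast_pow, Int.natCast_natAbs, sq_abs]
    refine ⟨?_, ⟨sq_bound le_rfl, trivial⟩, ⟨sq_bound le_rfl, trivial⟩⟩
    zify; simpa using hp
  · rintro ⟨⟨i, j⟩, ⟨a, b⟩⟩ hx
    simp only [Finset.mem_sigma, Finset.HasAntidiagonal.mem_antidiagonal, Finset.mem_product,
      Finset.mem_filter] at hx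
    have h1 : a.natAbs ^ 2 = i := by zify; simpa using hx.2.1.2
    have h2 : b.natAbs ^ 2 = j := by zify; simpa using hx.2.2.2
    simp [h1, h2]
  · rintro ⟨a, b⟩ _; rfl
  · rintro ⟨⟨i, j⟩, ⟨a, b⟩⟩ _; rfl

/-- parity sign -/
def eps (a : ℤ) : ℚ := if Even a then 1 else -1

/-- `θ₃` -/
def tA : PowerSeries ℚ := th (fun _ => 1)
/-- `θ₄` -/
def tB : PowerSeries ℚ := th eps

lemma rep_double (k : ℕ) (g : ℤ × ℤ → ℚ) :
    ∑ p ∈ rep (2 * k), g p = ∑ p ∈ rep k, g (p.1 + p.2, p.1 - p.2) := by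
  symm
  refine Finset.sum_nbij' (fun p => (p.1 + p.2, p.1 - p.2))
    (fun p => ((p.1 + p.2) / 2, (p.1 - p.2) / 2)) ?_ ?_ ?_ ?_ ?_
  · rintro ⟨a, b⟩ h
    rw [mem_rep] at h ⊢
    push_cast; simp only at *; linarith
  · rintro ⟨a, b⟩ h
    rw [mem_rep] at h ⊢
    simp only at *
    have he : Even (a + b) := by
      have : Even (a ^ 2 + b ^ 2) := by rw [h]; simp
      simpa [Int.even_add, Int.even_pow] using this
    obtain ⟨c, hc⟩ := he
    have hb : b = 2 * c - a := by linarith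
    subst hb
    have e1 : (a + (2 * c - a)) / 2 = c := by omega
    have e2 : (a - (2 * c - a)) / 2 = a - c := by omega
    rw [e1, e2]
    push_cast at h; linarith
  · rintro ⟨a, b⟩ _
    ext <;> simp only <;> omega
  · rintro ⟨a, b⟩ h
    rw [mem_rep] at h
    simp only at *
    have he : Even (a + b) := by
      have : Even (a ^ 2 + b ^ 2) := by rw [h]; simp
      simpa [Int.even_add, Int.even_pow] using this
    obtain ⟨c, hc⟩ := he
    ext <;> simp only <;> omega
  · intros; rfl

lemma eps_rep_even {k : ℕ} {p : ℤ × ℤ} (h : p ∈ rep (2 * k)) : eps p.1 = eps p.2 := by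
  rw [mem_rep] at h
  have : Even (p.1 ^ 2 + p.2 ^ 2) := by rw [h]; simp
  have h2 : Even p.1 ↔ Even p.2 := by simpa [Int.even_add, Int.even_pow] using this
  simp [eps, h2]

lemma eps_rep_odd {n : ℕ} (hn : ¬ Even n) {p : ℤ × ℤ} (h : p ∈ rep n) : eps p.1 = - eps p.2 := by
  rw [mem_rep] at h
  have : ¬ Even (p.1 ^ 2 + p.2 ^ 2) := by rw [h]; simpa using hn
  have h2 : Even p.1 ↔ ¬ Even p.2 := by
    simp only [Int.even_add, Int.even_pow] at this; tauto
  by_cases h3 : Even p.2 <;> simp [eps, h2, h3]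

lemma eps_sq (a : ℤ) : eps a * eps a = 1 := by unfold eps; split_ifs <;> norm_num

/-- doubling `q ↦ q²` -/
abbrev dbl : PowerSeries ℚ →ₐ[ℚ] PowerSeries ℚ := PowerSeries.expand 2 two_ne_zero

lemma coeff_dbl_even (f : PowerSeries ℚ) (k : ℕ) :
    PowerSeries.coeff (2 * k) (dbl f) = PowerSeries.coeff k f := by
  simp [dbl, PowerSeries.coeff_expand_mul]

lemma coeff_dbl_odd (f : PowerSeries ℚ) {n : ℕ} (h : ¬ Even n) :
    PowerSeries.coeff n (dbl f) = 0 := by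
  apply PowerSeries.coeff_expand_of_not_dvd
  rwa [even_iff_two_dvd] at h

lemma dbl1 : tA * tA + tB * tB = 2 * dbl (tA * tA) := by
  ext n
  rw [map_add, tA, tB, coeff_th_mul, coeff_th_mul,
    show (2 : PowerSeries ℚ) = PowerSeries.C (2 : ℚ) from (map_ofNat PowerSeries.C 2).symm, PowerSeries.coeff_C_mul]
  by_cases hn : Even n
  · obtain ⟨k, rfl⟩ := hn
    rw [← two_mul, coeff_dbl_even, coeff_th_mul, rep_double k]
    have : ∑ p ∈ rep (2 * k), eps p.1 * eps p.2 = ∑ p ∈ rep (2 * k), 1 * 1 :=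
      Finset.sum_congr rfl fun p hp => by rw [eps_rep_even hp, eps_sq, one_mul]
    rw [this, rep_double k]; ring
  · rw [coeff_dbl_odd _ hn, ← Finset.sum_add_distrib, mul_zero]
    refine Finset.sum_eq_zero fun p hp => ?_
    rw [eps_rep_odd hn hp, neg_mul, eps_sq]; ring

lemma dbl2 : tA * tB = dbl (tB * tB) := by
  ext n
  rw [tA, tB, coeff_th_mul]
  by_cases hn : Even n
  · obtain ⟨k, rfl⟩ := hn
    rw [← two_mul, coeff_dbl_even, coeff_th_mul, rep_double k]
    refine Finset.sum_congr rfl fun p _ => ?_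
    simp only [eps, Int.even_sub]
    by_cases h1 : Even p.1 <;> by_cases h2 : Even p.2 <;> simp [h1, h2]
  · rw [coeff_dbl_odd _ hn]
    have h1 : ∑ p ∈ rep n, 1 * eps p.2 = ∑ p ∈ rep n, eps p.1 := by
      refine Finset.sum_nbij' Prod.swap Prod.swap ?_ ?_ ?_ ?_ ?_
      · intro p hp; rw [mem_rep] at *; simp only [Prod.fst_swap, Prod.snd_swap]; linarith
      · intro p hp; rw [mem_rep] at *; simp only [Prod.fst_swap, Prod.snd_swap]; linarith
      · intros; simp
      · intros; simp
      · intros; simp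
    have h2 : ∑ p ∈ rep n, eps p.1 = - ∑ p ∈ rep n, 1 * eps p.2 := by
      rw [← Finset.sum_neg_distrib]
      exact Finset.sum_congr rfl fun p hp => by rw [eps_rep_odd hn hp]; ring
    linarith

lemma qD_dbl (f : PowerSeries ℚ) : qD ℚ (dbl f) = 2 * dbl (qD ℚ f) := by
  ext n
  rw [coeff_qD, show (2 : PowerSeries ℚ) = PowerSeries.C (2 : ℚ) from (map_ofNat PowerSeries.C 2).symm, PowerSeries.coeff_C_mul]
  by_cases hn : Even n
  · obtain ⟨k, rfl⟩ := hn
    rw [← two_mul, coeff_dbl_even, coeff_dbl_even, coeff_qD]; push_cast; ring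
  · rw [coeff_dbl_odd _ hn, coeff_dbl_odd _ hn]; simp

lemma tA_zero : PowerSeries.coeff 0 tA = 1 := by
  rw [tA, th, PowerSeries.coeff_mk,
    show (Finset.Icc (-((0 : ℕ) : ℤ)) (0 : ℕ)).filter (fun a => a ^ 2 = ((0 : ℕ) : ℤ)) = {0} by
      decide]
  simp
lemma tB_zero : PowerSeries.coeff 0 tB = 1 := by
  rw [tB, th, PowerSeries.coeff_mk,
    show (Finset.Icc (-((0 : ℕ) : ℤ)) (0 : ℕ)).filter (fun a => a ^ 2 = ((0 : ℕ) : ℤ)) = {0} by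
      decide]
  simp [eps]
lemma Icc_filter_one : (Finset.Icc (-((1 : ℕ) : ℤ)) (1 : ℕ)).filter
    (fun a => a ^ 2 = ((1 : ℕ) : ℤ)) = {-1, 1} := by
  decide
lemma tA_one : PowerSeries.coeff 1 tA = 2 := by
  rw [tA, th, PowerSeries.coeff_mk, Icc_filter_one]
  simp
lemma tB_one : PowerSeries.coeff 1 tB = -2 := by
  rw [tB, th, PowerSeries.coeff_mk, Icc_filter_one]
  simp [eps]; norm_num

lemma tB_const : PowerSeries.constantCoeff tB = 1 := by
  rw [← PowerSeries.coeff_zero_eq_constantCoeff_apply, tB_zero]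
lemma tA_const : PowerSeries.constantCoeff tA = 1 := by
  rw [← PowerSeries.coeff_zero_eq_constantCoeff_apply, tA_zero]

end OP

namespace OP
open PowerSeries (coeff constantCoeff)

/-! ### Differential equations for the theta series -/

lemma coeff_qD_zero (f : PowerSeries ℚ) : constantCoeff (qD ℚ f) = 0 := by
  rw [← PowerSeries.coeff_zero_eq_constantCoeff_apply, coeff_qD]; simp

def vV : PowerSeries ℚ :=
  4 * (tB * qD ℚ tA - tA * qD ℚ tB) - tA * tB * (tA ^ 4 - tB ^ 4)

lemma dA : 2 * (tA * qD ℚ tA) + 2 * (tB * qD ℚ tB) = 8 * (dbl tA * dbl (qD ℚ tA)) := by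
  have h := congrArg (qD ℚ) dbl1
  rw [show (2 : PowerSeries ℚ) * dbl (tA * tA) = dbl tA * dbl tA + dbl tA * dbl tA by
    rw [map_mul]; ring] at h
  simp only [map_add, Derivation.leibniz, smul_eq_mul, qD_dbl] at h
  linear_combination h

lemma dB : tA * qD ℚ tB + tB * qD ℚ tA = 4 * (dbl tB * dbl (qD ℚ tB)) := by
  have h := congrArg (qD ℚ) dbl2
  rw [map_mul dbl] at h
  simp only [Derivation.leibniz, smul_eq_mul, qD_dbl] at h
  linear_combination h

lemma vV_dbl : (dbl tA * dbl tB * 8) * dbl vV = (tA ^ 2 - tB ^ 2) * vV := by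
  have h1 := dbl1
  have h2 := dbl2
  rw [map_mul] at h1 h2
  have e : (dbl tA * dbl tB * 8) * dbl vV
      = 4 * (dbl tB * dbl tB) * (8 * (dbl tA * dbl (qD ℚ tA)))
        - 4 * (2 * (dbl tA * dbl tA)) * (4 * (dbl tB * dbl (qD ℚ tB)))
        - (2 * (dbl tA * dbl tA)) * (dbl tB * dbl tB) *
          ((2 * (dbl tA * dbl tA)) ^ 2 - 4 * (dbl tB * dbl tB) ^ 2) := by
    rw [vV]
    simp only [map_sub, map_mul, map_pow, map_ofNat]
    ring
  rw [e, ← dA, ← dB, ← h1, ← h2, vV]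
  ring

lemma cA (n : ℕ) : coeff 1 (tA ^ n) = 2 * n := by
  induction n with
  | zero => simp [PowerSeries.coeff_one]
  | succ n ih =>
    rw [pow_succ, PowerSeries.coeff_one_mul, ih, tA_one, map_pow, tA_const]; push_cast; ring

lemma cB (n : ℕ) : coeff 1 (tB ^ n) = -2 * n := by
  induction n with
  | zero => simp [PowerSeries.coeff_one]
  | succ n ih =>
    rw [pow_succ, PowerSeries.coeff_one_mul, ih, tB_one, map_pow, tB_const]; push_cast; ring

lemma vV_zero : vV = 0 := by
  have ho : (tA ^ 2 - tB ^ 2).order = 1 := by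
    rw [show (1 : ℕ∞) = ((1 : ℕ) : ℕ∞) by simp, PowerSeries.order_eq_nat]
    constructor
    · rw [map_sub, cA, cB]; norm_num
    · intro i hi
      obtain rfl : i = 0 := by omega
      simp [tA_const, tB_const]
  have hu : (dbl tA * dbl tB * 8).order = 0 := by
    rw [show (0 : ℕ∞) = ((0 : ℕ) : ℕ∞) by simp, PowerSeries.order_eq_nat]
    constructor
    · simp only [PowerSeries.coeff_zero_eq_constantCoeff, map_mul, dbl,
        PowerSeries.constantCoeff_expand, tA_const, tB_const, map_ofNat]
      norm_num
    · intro i hi; omega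
  have h := congrArg PowerSeries.order vV_dbl
  rw [PowerSeries.order_mul, PowerSeries.order_mul (tA ^ 2 - tB ^ 2), ho, hu, PowerSeries.order_expand,
    zero_add] at h
  have h2 : (2 : ℕ∞) ≤ vV.order := by
    rw [show (2 : ℕ∞) = ((2 : ℕ) : ℕ∞) by simp]
    apply PowerSeries.nat_le_order
    intro i hi
    interval_cases i
    · simp [vV, tA_const, tB_const, coeff_qD_zero]
    · rw [vV]
      have e4 : (4 : PowerSeries ℚ) = PowerSeries.C (4 : ℚ) := (map_ofNat PowerSeries.C 4).symm
      rw [e4]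
      simp only [map_sub, PowerSeries.coeff_C_mul, PowerSeries.coeff_one_mul, coeff_qD,
        tA_one, tB_one, coeff_qD_zero, tA_const, tB_const, cA, cB, map_mul, map_pow]
      norm_num
  by_contra hne
  have hfin : vV.order ≠ ⊤ := by simpa [PowerSeries.order_eq_top] using hne
  obtain ⟨k, hk⟩ := ENat.ne_top_iff_exists.mp hfin
  rw [← hk] at h h2
  have h2' : 2 ≤ k := by exact_mod_cast h2
  have : 2 * k = 1 + k := by
    have h' : ((2 * k : ℕ) : ℕ∞) = ((1 + k : ℕ) : ℕ∞) := by
      push_cast; rw [← h]; simp [two_mul]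
    exact_mod_cast h'
  omega

lemma tB_ne : tB ≠ 0 := by
  intro h; have := tB_const; rw [h] at this; simp at this
lemma tA_ne : tA ≠ 0 := by
  intro h; have := tA_const; rw [h] at this; simp at this

/-- `D log θ₄⁴` -/
def yy : PowerSeries ℚ := 4 * qD ℚ tB * tB⁻¹

lemma tB_inv : tB * tB⁻¹ = 1 := PowerSeries.mul_inv_cancel _ (by simp [tB_const])

lemma yy_mul : yy * tB = 4 * qD ℚ tB := by
  rw [yy]; linear_combination (4 * qD ℚ tB) * tB_inv

/-- `θ₂⁴` -/
def eE : PowerSeries ℚ := tA ^ 4 - tB ^ 4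

lemma qD_tA : 4 * qD ℚ tA = tA * (yy + eE) := by
  have h := vV_zero
  rw [vV] at h
  apply mul_left_cancel₀ tB_ne
  rw [eE]
  linear_combination h - tA * yy_mul

lemma qD_eE : qD ℚ eE = eE * yy + tA ^ 4 * eE := by
  have h : qD ℚ eE = tA ^ 3 * (4 * qD ℚ tA) - tB ^ 3 * (4 * qD ℚ tB) := by
    rw [eE]; simp only [map_sub, Derivation.leibniz_pow, smul_eq_mul, nsmul_eq_mul]
    push_cast; ring
  rw [h, qD_tA, ← yy_mul, eE]; ring

lemma dbl_yy : 4 * dbl yy = 2 * yy + eE := by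
  have h2 := dbl2
  rw [map_mul] at h2
  have h1 : dbl yy * dbl tB = 4 * dbl (qD ℚ tB) := by
    have := congrArg dbl yy_mul
    simpa only [map_mul, map_ofNat] using this
  apply mul_left_cancel₀ (mul_ne_zero tA_ne tB_ne)
  linear_combination (4 * dbl yy) * h2 + 4 * dbl tB * h1 - 4 * dB - tA * yy_mul + tB * qD_tA

def wW : PowerSeries ℚ := 2 * qD ℚ yy - yy ^ 2 + tA ^ 4 * eE

lemma dbl_wW : 4 * dbl wW = wW := by
  have h1 := dbl1
  have h2 := dbl2
  rw [map_mul] at h1 h2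
  have h3 : 8 * dbl (qD ℚ yy) = 2 * qD ℚ yy + qD ℚ eE := by
    have := congrArg (qD ℚ) dbl_yy
    rw [show 4 * dbl yy = dbl yy + dbl yy + dbl yy + dbl yy by ring, two_mul] at this
    simp only [map_add, qD_dbl] at this
    linear_combination this
  have h4 : 16 * dbl (tA ^ 4 * eE) = eE ^ 2 := by
    have : 16 * dbl (tA ^ 4 * eE) = (2 * (dbl tA * dbl tA)) ^ 2 *
        ((2 * (dbl tA * dbl tA)) ^ 2 - 4 * (dbl tB * dbl tB) ^ 2) := by
      rw [eE]; simp only [map_mul, map_pow, map_sub]; ring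
    rw [this, ← h1, ← h2, eE]; ring
  have h5 := dbl_yy
  have h6 := qD_eE
  have e : (4 : PowerSeries ℚ) ≠ 0 := by
    intro h
    have := congrArg (PowerSeries.constantCoeff (R := ℚ)) h
    rw [map_ofNat] at this
    norm_num at this
  apply mul_left_cancel₀ e
  rw [wW, map_add, map_sub, map_mul, map_pow]
  simp only [map_ofNat]
  linear_combination 4 * h3 + h4 - (4 * dbl yy + 2 * yy + eE) * h5 + 4 * h6

lemma wW_zero : wW = 0 := by
  have hc : ∀ n, 4 * coeff n (dbl wW) = coeff n wW := by
    intro n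
    conv_rhs => rw [← dbl_wW]
    rw [show (4 : PowerSeries ℚ) = PowerSeries.C (4 : ℚ) from (map_ofNat PowerSeries.C 4).symm,
      PowerSeries.coeff_C_mul]
  ext n
  rw [map_zero]
  induction n using Nat.strong_induction_on with
  | _ n ih =>
    by_cases hn : Even n
    · obtain ⟨k, rfl⟩ := hn
      have := hc (k + k)
      rw [← two_mul, coeff_dbl_even] at this
      rw [← two_mul]
      rcases Nat.eq_zero_or_pos k with rfl | hk
      · simp only [mul_zero] at this ⊢; linarith
      · rw [ih k (by omega)] at this; linarith
    · have := hc n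
      rw [coeff_dbl_odd _ hn] at this; linarith

end OP

namespace OP
open PowerSeries (coeff)

/-! ### Gauss product and the odd coefficients of `θ₄⁴` -/

/-- `q` -/
abbrev qq : PowerSeries ℚ := PowerSeries.X

/-- `(1 + q^j)⁻¹` -/
def iI (j : ℕ) : PowerSeries ℚ := (1 + qq ^ j)⁻¹

lemma iI_mul (j : ℕ) : (1 + qq ^ j) * iI j = 1 := by
  apply PowerSeries.mul_inv_cancel
  rcases Nat.eq_zero_or_pos j with rfl | h
  · simp
  · simp [h.ne']

/-- `∏_{s < j ≤ n} (1 - q^j) / (1 + q^j)` -/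
def gW (n s : ℕ) : PowerSeries ℚ := ∏ j ∈ Finset.Ioc s n, (1 - qq ^ j) * iI j

lemma gW_self (n : ℕ) : gW n n = 1 := by simp [gW]

lemma gW_succ {n s : ℕ} (h : s ≤ n) :
    gW (n + 1) s = gW n s * ((1 - qq ^ (n + 1)) * iI (n + 1)) := by
  rw [gW, gW, ← Finset.insert_Ioc_right_eq_Ioc_add_one h, Finset.prod_insert (by simp), mul_comm]

lemma gW_left {n s : ℕ} (h : s + 1 ≤ n) :
    gW n s = gW n (s + 1) * ((1 - qq ^ (s + 1)) * iI (s + 1)) := by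
  rw [gW, gW, ← Finset.insert_Ioc_add_one_left_eq_Ioc (by omega), Finset.prod_insert (by simp),
    mul_comm]

def gU (n s : ℕ) : PowerSeries ℚ := gW n s * (2 * (-1) ^ s * qq ^ (s * (n + 1)) * iI s)

lemma two_ne_zero_ps : (2 : PowerSeries ℚ) ≠ 0 := by
  intro h
  have := congrArg (PowerSeries.constantCoeff (R := ℚ)) h
  rw [map_ofNat] at this
  norm_num at this

lemma two_iI_zero : 2 * iI 0 = 1 := by
  have := iI_mul 0
  rw [pow_zero] at this
  linear_combination this

lemma gU_zero (n : ℕ) : gU n 0 = gW n 0 := by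
  rw [gU]; simp only [pow_zero, zero_mul, mul_one]; rw [two_iI_zero, mul_one]

lemma gU_tele (N k : ℕ) (hk : k ≤ N) :
    (1 + qq ^ (N + 1)) * ∑ s ∈ Finset.range (k + 1), (gU (N + 1) s - gU N s)
      = -2 * (-1) ^ k * qq ^ ((k + 1) * (N + 1)) * gW N k := by
  have hi := iI_mul (N + 1)
  induction k with
  | zero =>
    rw [Finset.sum_range_one, gU_zero, gU_zero, gW_succ hk]
    simp only [zero_add, one_mul, pow_zero]
    linear_combination gW N 0 * (1 - qq ^ (N + 1)) * hi
  | succ k ih =>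
    rw [Finset.sum_range_succ, mul_add, ih (by omega), gW_left hk, gU, gU, gW_succ hk]
    have hj := iI_mul (k + 1)
    have e1 : qq ^ ((k + 1) * (N + 1 + 1)) = qq ^ ((k + 1) * (N + 1)) * qq ^ (k + 1) := by
      rw [← pow_add]; ring_nf
    have e2 : qq ^ ((k + 1 + 1) * (N + 1)) = qq ^ ((k + 1) * (N + 1)) * qq ^ (N + 1) := by
      rw [← pow_add]; ring_nf
    rw [e1, e2]
    generalize qq ^ ((k + 1) * (N + 1)) = Y
    generalize qq ^ (N + 1) = Z at *
    generalize qq ^ (k + 1) = T at *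
    generalize iI (N + 1) = I at *
    generalize iI (k + 1) = J at *
    generalize gW N (k + 1) = G
    rw [pow_succ]
    generalize (-1 : PowerSeries ℚ) ^ k = m
    linear_combination (-2 * G * m * Y * (1 - Z) * J * T) * hi
      + (2 * G * m * Y * Z) * hj

/-- partial theta sums -/
def gA (n : ℕ) : PowerSeries ℚ := ∑ s ∈ Finset.range (n + 1), gU n s

lemma gA_zero : gA 0 = 1 := by
  rw [gA, Finset.sum_range_one, gU_zero, gW_self]

lemma gA_succ (N : ℕ) : gA (N + 1) = gA N + 2 * (-1) ^ (N + 1) * qq ^ ((N + 1) ^ 2) := by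
  have h := gU_tele N N le_rfl
  have hi := iI_mul (N + 1)
  rw [Finset.sum_sub_distrib, gW_self] at h
  have hne : (1 + qq ^ (N + 1)) ≠ 0 := left_ne_zero_of_mul_eq_one hi
  apply mul_left_cancel₀ hne
  rw [gA, gA, Finset.sum_range_succ, gU, gW_self]
  have e1 : qq ^ ((N + 1) * (N + 1 + 1)) = qq ^ ((N + 1) ^ 2) * qq ^ (N + 1) := by
    rw [← pow_add]; ring_nf
  rw [e1]
  rw [show (N + 1) * (N + 1) = (N + 1) ^ 2 by ring] at h
  rw [pow_succ (-1 : PowerSeries ℚ) N]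
  linear_combination h - (2 * (-1) ^ N * qq ^ ((N + 1) ^ 2) * qq ^ (N + 1)) * hi

lemma gA_sub_dvd (n : ℕ) : qq ^ (n + 1) ∣ gA n - gW n 0 := by
  rw [gA, Finset.sum_range_succ', gU_zero, add_sub_cancel_right]
  refine Finset.dvd_sum fun s _ => ?_
  rw [gU]
  have : qq ^ (n + 1) ∣ qq ^ ((s + 1) * (n + 1)) := pow_dvd_pow _ (by nlinarith)
  exact Dvd.dvd.mul_left (Dvd.dvd.mul_right (Dvd.dvd.mul_left this _) _) _

lemma gA_eq (n : ℕ) :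
    gA n = 1 + ∑ k ∈ Finset.range n, PowerSeries.C (2 * (-1 : ℚ) ^ (k + 1)) * qq ^ ((k + 1) ^ 2) := by
  induction n with
  | zero => simp [gA_zero]
  | succ n ih =>
    rw [gA_succ, ih, Finset.sum_range_succ]
    simp only [map_mul, map_pow, map_neg, map_one, map_ofNat]
    ring

lemma coeff_gA (n m : ℕ) (h : m ≤ n) : coeff m (gA n) = coeff m tB := by
  rw [gA_eq, map_add, map_sum]
  simp only [PowerSeries.coeff_C_mul, PowerSeries.coeff_X_pow, PowerSeries.coeff_one]
  by_cases hs : ∃ r : ℕ, m = r ^ 2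
  · obtain ⟨r, rfl⟩ := hs
    rcases Nat.eq_zero_or_pos r with rfl | hr
    · rw [show (0 : ℕ) ^ 2 = 0 by norm_num, tB_zero]
      rw [if_pos rfl, Finset.sum_eq_zero, add_zero]
      intro x _
      rw [if_neg (by positivity), mul_zero]
    · have hr0 : r ^ 2 ≠ 0 := by positivity
      rw [Finset.sum_eq_single (r - 1)]
      · rw [Nat.sub_add_cancel hr, if_neg hr0, tB, th, PowerSeries.coeff_mk]
        have : (Finset.Icc (-((r ^ 2 : ℕ) : ℤ)) ((r ^ 2 : ℕ) : ℤ)).filter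
            (fun a => a ^ 2 = ((r ^ 2 : ℕ) : ℤ)) = {-(r : ℤ), (r : ℤ)} := by
          ext a
          simp only [Finset.mem_filter, Finset.mem_Icc, Finset.mem_insert, Finset.mem_singleton]
          push_cast
          constructor
          · rintro ⟨_, h2⟩
            rcases sq_eq_sq_iff_eq_or_eq_neg.mp h2 with h | h <;> simp [h]
          · rintro h2
            have h3 : a ^ 2 = (r : ℤ) ^ 2 := by rcases h2 with h | h <;> simp [h]
            exact ⟨sq_bound h3.le, h3⟩
        rw [this, Finset.sum_pair (by omega)]
        have he : ∀ r : ℕ, (-1 : ℚ) ^ r = eps r := by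
          intro r
          unfold eps
          rcases Nat.even_or_odd r with h | h
          · simp [h]
          · rw [h.neg_one_pow, if_neg]; simpa using h
        have hn : eps (-(r : ℤ)) = eps r := by simp [eps]
        rw [he, hn]; simp; ring
      · intro b _ hb
        rw [if_neg, mul_zero]
        intro hh
        have := Nat.pow_left_injective (n := 2) (by norm_num) hh
        omega
      · intro hh
        exfalso; apply hh
        rw [Finset.mem_range]
        nlinarith [Nat.sub_add_cancel hr]
  · have h0 : m ≠ 0 := by rintro rfl; exact hs ⟨0, rfl⟩
    rw [if_neg h0, zero_add, tB, th, PowerSeries.coeff_mk]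
    rw [Finset.sum_eq_zero, Finset.sum_eq_zero]
    · intro a ha
      exfalso
      rw [Finset.mem_filter] at ha
      exact hs ⟨a.natAbs, by zify; simpa using ha.2.symm⟩
    · intro k _
      rw [if_neg, mul_zero]
      intro hk
      exact hs ⟨k + 1, hk⟩

lemma tB_sub_dvd (n : ℕ) : qq ^ (n + 1) ∣ tB - gW n 0 := by
  have h : qq ^ (n + 1) ∣ tB - gA n := by
    rw [PowerSeries.X_pow_dvd_iff]
    intro m hm
    rw [map_sub, coeff_gA n m (by omega), sub_self]
  have := dvd_add h (gA_sub_dvd n)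
  simpa using this

/-- Lambert series of the factor. -/
def lL (j : ℕ) : PowerSeries ℚ :=
  PowerSeries.mk fun n => if j ∣ n ∧ Odd (n / j) then -2 * (j : ℚ) else 0

lemma lL_mul {j : ℕ} (hj : 1 ≤ j) :
    lL j * (1 - qq ^ (2 * j)) = - (2 * (j : PowerSeries ℚ) * qq ^ j) := by
  ext n
  rw [mul_sub, mul_one, map_sub, PowerSeries.coeff_mul_X_pow', map_neg,
    show (2 * (j : PowerSeries ℚ)) = PowerSeries.C (2 * (j : ℚ)) by
      rw [map_mul, map_ofNat, map_natCast], PowerSeries.coeff_C_mul, PowerSeries.coeff_X_pow]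
  simp only [lL, PowerSeries.coeff_mk]
  by_cases hd : j ∣ n
  · obtain ⟨k, rfl⟩ := hd
    rw [Nat.mul_div_cancel_left _ hj]
    by_cases h2 : 2 ≤ k
    · obtain ⟨i, rfl⟩ := Nat.exists_eq_add_of_le h2
      have e : j * (2 + i) - 2 * j = j * i := by
        rw [mul_add, mul_comm j 2]; omega
      rw [if_pos (by nlinarith : 2 * j ≤ j * (2 + i)), e, Nat.mul_div_cancel_left _ hj]
      have : j * (2 + i) ≠ j := by nlinarith
      rw [if_neg this]
      have : Odd (2 + i) ↔ Odd i := by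
        rw [Nat.odd_iff, Nat.odd_iff]; omega
      simp [this]
    · rw [if_neg (by nlinarith : ¬ 2 * j ≤ j * k)]
      have : k = 0 ∨ k = 1 := by omega
      rcases this with rfl | rfl
      · simp; omega
      · simp
  · have h1 : n ≠ j := by rintro rfl; exact hd dvd_rfl
    rw [if_neg (by tauto), if_neg h1]
    split_ifs with h2 h3
    · exfalso
      apply hd
      have := (Nat.dvd_add h3.1 (Dvd.intro_left 2 rfl : j ∣ 2 * j))
      rwa [Nat.sub_add_cancel h2] at this
    · simp
    · simp

lemma qD_pow (j : ℕ) : qD ℚ (qq ^ j) = (j : PowerSeries ℚ) * qq ^ j := by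
  ext n
  rw [coeff_qD, ← map_natCast (PowerSeries.C (R := ℚ)), PowerSeries.coeff_C_mul,
    PowerSeries.coeff_X_pow]
  split_ifs with h
  · simp [h]
  · simp

lemma qD_fac {j : ℕ} (hj : 1 ≤ j) :
    qD ℚ ((1 - qq ^ j) * iI j) = ((1 - qq ^ j) * iI j) * lL j := by
  set f := (1 - qq ^ j) * iI j with hf
  have h1 : f * (1 + qq ^ j) = 1 - qq ^ j := by
    rw [hf]; linear_combination (1 - qq ^ j) * iI_mul j
  have h2 := congrArg (qD ℚ) h1
  simp only [map_add, map_sub, Derivation.leibniz, Derivation.map_one_eq_zero, smul_eq_mul,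
    qD_pow] at h2
  have h3 := lL_mul hj
  rw [two_mul j, pow_add] at h3
  have hne : (1 - qq ^ j * qq ^ j) ≠ 0 := by
    intro h
    have := congrArg (PowerSeries.constantCoeff (R := ℚ)) h
    rw [map_sub, map_mul, map_pow, PowerSeries.constantCoeff_X, zero_pow (by omega)] at this
    simp at this
  apply mul_left_cancel₀ hne
  linear_combination (1 - qq ^ j) * h2 - f * h3 + ((j : PowerSeries ℚ) * qq ^ j) * h1

lemma qD_gW (n : ℕ) : qD ℚ (gW n 0) = gW n 0 * ∑ j ∈ Finset.Ioc 0 n, lL j := by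
  induction n with
  | zero => simp [gW]
  | succ n ih =>
    rw [gW_succ (Nat.zero_le n), Derivation.leibniz, ih, qD_fac (by omega),
      ← Finset.insert_Ioc_right_eq_Ioc_add_one (Nat.zero_le n), Finset.sum_insert (by simp)]
    simp only [smul_eq_mul]
    ring

lemma yy_sub_dvd (n : ℕ) : qq ^ (n + 1) ∣ yy - 4 * ∑ j ∈ Finset.Ioc 0 n, lL j := by
  obtain ⟨h, hh⟩ := tB_sub_dvd n
  have e1 : tB = gW n 0 + qq ^ (n + 1) * h := by linear_combination hh
  have e2 := congrArg (qD ℚ) e1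
  rw [map_add, qD_gW, Derivation.leibniz, qD_pow] at e2
  simp only [smul_eq_mul] at e2
  refine ⟨4 * tB⁻¹ * (qD ℚ h + h * (n + 1 : ℕ) - h * ∑ j ∈ Finset.Ioc 0 n, lL j), ?_⟩
  have h3 := tB_inv
  have h4 := yy_mul
  apply mul_left_cancel₀ tB_ne
  linear_combination h4 + 4 * e2 - (4 * ∑ j ∈ Finset.Ioc 0 n, lL j) * e1 -
    (4 * qq ^ (n + 1) * (qD ℚ h + h * (n + 1 : ℕ) - h * ∑ j ∈ Finset.Ioc 0 n, lL j)) * h3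

lemma coeff_yy {n : ℕ} (hn : Odd n) :
    coeff n yy = -8 * ((∑ d ∈ n.divisors, d : ℕ) : ℚ) := by
  have h := (PowerSeries.X_pow_dvd_iff.mp (yy_sub_dvd n)) n (by omega)
  rw [map_sub, sub_eq_zero, show (4 : PowerSeries ℚ) = PowerSeries.C (4 : ℚ) from
    (map_ofNat PowerSeries.C 4).symm, PowerSeries.coeff_C_mul, map_sum] at h
  rw [h]
  simp only [lL, PowerSeries.coeff_mk]
  rw [← Finset.sum_filter]
  have : (Finset.Ioc 0 n).filter (fun j => j ∣ n ∧ Odd (n / j)) = n.divisors := by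
    ext d
    simp only [Finset.mem_filter, Finset.mem_Ioc, Nat.mem_divisors]
    have hn0 : 0 < n := hn.pos
    constructor
    · rintro ⟨_, h, _⟩; exact ⟨h, hn0.ne'⟩
    · rintro ⟨h, _⟩
      refine ⟨⟨Nat.pos_of_dvd_of_pos h hn0, Nat.le_of_dvd hn0 h⟩, h, ?_⟩
      exact hn.of_dvd_nat (Nat.div_dvd_of_dvd h)
  rw [this, ← Finset.mul_sum]
  push_cast; ring

/-- `q ↦ -q` -/
abbrev rho : PowerSeries ℚ →+* PowerSeries ℚ := PowerSeries.rescale (-1)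

lemma rho_tB : rho tB = tA := by
  ext n
  rw [PowerSeries.coeff_rescale, tB, tA, th, th, PowerSeries.coeff_mk, PowerSeries.coeff_mk,
    Finset.mul_sum]
  refine Finset.sum_congr rfl fun a ha => ?_
  rw [Finset.mem_filter] at ha
  have h : Even a ↔ Even n := by
    have : Even (a ^ 2) ↔ Even (n : ℤ) := by rw [ha.2]
    simpa [Int.even_pow] using this
  rcases Nat.even_or_odd n with h1 | h1
  · simp [eps, h, h1]
  · rw [h1.neg_one_pow, eps, if_neg (by rw [h]; simpa using h1)]; norm_num

lemma rho_qD (f : PowerSeries ℚ) : rho (qD ℚ f) = qD ℚ (rho f) := by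
  ext n
  rw [PowerSeries.coeff_rescale, coeff_qD, coeff_qD, PowerSeries.coeff_rescale]; ring

lemma rho_yy : rho yy = yy + eE := by
  have h := congrArg rho yy_mul
  rw [map_mul, map_mul, rho_qD, rho_tB, map_ofNat, qD_tA] at h
  apply mul_left_cancel₀ tA_ne
  linear_combination h

lemma coeff_P {n : ℕ} (hn : Odd n) :
    coeff n (tB ^ 4) = -8 * ((∑ d ∈ n.divisors, d : ℕ) : ℚ) := by
  rw [← coeff_yy hn]
  have h1 := congrArg (PowerSeries.coeff (R := ℚ) n) rho_yy
  have h2 : rho (tB ^ 4) = tA ^ 4 := by rw [map_pow, rho_tB]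
  have h3 := congrArg (PowerSeries.coeff (R := ℚ) n) h2
  rw [PowerSeries.coeff_rescale, hn.neg_one_pow] at h1 h3
  rw [map_add, eE, map_sub] at h1
  linarith

end OP
namespace OP

/-! ### The derivative on rational functions and the formal Laplace transform -/

/-- the field -/
abbrev KK := RatFunc ℚ
/-- inclusion of polynomials -/
abbrev am : ℚ[X] →+* KK := algebraMap ℚ[X] (RatFunc ℚ)
/-- inclusion of constants -/
def cst : ℚ →+* KK := am.comp Polynomial.C

lemma cst_apply (c : ℚ) : cst c = am (Polynomial.C c) := rfl

lemma smul_cst (c : ℚ) (g : KK) : c • g = cst c * g := by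
  rw [RatFunc.smul_eq_C_smul, Algebra.smul_def]; rfl

lemma am_ne {p : ℚ[X]} (h : p ≠ 0) : am p ≠ 0 := RatFunc.algebraMap_ne_zero h

lemma num_mul_of_eq (f : KK) (p q : ℚ[X]) (hq : q ≠ 0) (hf : f = am p / am q) :
    f.num * q = p * f.denom := by
  subst hf
  rw [RatFunc.num_mul_eq_mul_denom_iff hq]

lemma ratDeriv_of_eq (f : KK) (p q : ℚ[X]) (hq : q ≠ 0) (hf : f = am p / am q) :
    ratDeriv f = am (derivative p * q - p * derivative q) / am (q ^ 2) := by
  have hd : f.denom ≠ 0 := f.denom_ne_zero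
  have h1 : f.num * q = p * f.denom := num_mul_of_eq f p q hq hf
  unfold ratDeriv
  generalize f.num = a at *
  generalize f.denom = b at *
  have h2 : derivative a * q + a * derivative q
      = derivative p * b + p * derivative b := by
    have := congrArg derivative h1
    simpa only [derivative_mul] using this
  have key : (derivative a * b - a * derivative b) * q ^ 2
      = (derivative p * q - p * derivative q) * b ^ 2 := by
    linear_combination (q * b) * h2 - (derivative q * b + q * derivative b) * h1
  rw [RatFunc.mk_eq_div]
  have h3 : am (b ^ 2) ≠ 0 := am_ne (pow_ne_zero 2 hd)
  have h4 : am (q ^ 2) ≠ 0 := am_ne (pow_ne_zero 2 hq)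
  have h5 := congrArg am key
  rw [map_mul, map_mul] at h5
  exact (div_eq_div_iff h3 h4).mpr h5

lemma ratDeriv_div (p q : ℚ[X]) (hq : q ≠ 0) :
    ratDeriv (am p / am q) = am (derivative p * q - p * derivative q) / am (q ^ 2) :=
  ratDeriv_of_eq _ p q hq rfl

lemma ex_div (f : KK) : ∃ p q : ℚ[X], q ≠ 0 ∧ f = am p / am q :=
  ⟨f.num, f.denom, f.denom_ne_zero, (RatFunc.num_div_denom f).symm⟩

lemma rd_add (f g : KK) : ratDeriv (f + g) = ratDeriv f + ratDeriv g := by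
  obtain ⟨p, q, hq, rfl⟩ := ex_div f
  obtain ⟨r, s, hs, rfl⟩ := ex_div g
  have h1 := am_ne hq
  have h2 := am_ne hs
  have e : am p / am q + am r / am s = am (p * s + r * q) / am (q * s) := by
    simp only [map_add, map_mul]; field_simp
  rw [e, ratDeriv_div _ _ (mul_ne_zero hq hs), ratDeriv_div _ _ hq, ratDeriv_div _ _ hs]
  simp only [derivative_mul, map_add, map_mul, map_sub, map_pow]
  field_simp
  ring

lemma rd_mul (f g : KK) : ratDeriv (f * g) = ratDeriv f * g + f * ratDeriv g := by
  obtain ⟨p, q, hq, rfl⟩ := ex_div f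
  obtain ⟨r, s, hs, rfl⟩ := ex_div g
  have h1 := am_ne hq
  have h2 := am_ne hs
  have e : am p / am q * (am r / am s) = am (p * r) / am (q * s) := by
    simp only [map_mul]; field_simp
  rw [e, ratDeriv_div _ _ (mul_ne_zero hq hs), ratDeriv_div _ _ hq, ratDeriv_div _ _ hs]
  simp only [derivative_mul, map_add, map_mul, map_sub, map_pow]
  field_simp
  ring

lemma rd_poly (p : ℚ[X]) : ratDeriv (am p) = am (derivative p) := by
  have := ratDeriv_of_eq (am p) p 1 one_ne_zero (by simp)
  simpa using this

lemma rd_cst (c : ℚ) (f : KK) : ratDeriv (cst c * f) = cst c * ratDeriv f := by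
  rw [rd_mul, cst_apply, rd_poly]; simp

/-- the variable -/
abbrev vv : KK := RatFunc.X

lemma vv_am : vv = am X := (RatFunc.algebraMap_X).symm
lemma vv_ne : vv ≠ 0 := RatFunc.X_ne_zero

lemma rd_vv_mul (f : KK) : ratDeriv (vv * f) = f + vv * ratDeriv f := by
  rw [rd_mul, vv_am, rd_poly]; simp

/-- The operator in the recursion. -/
def opA (s : KK) : KK := cst (1/4) * (vv * ratDeriv (vv * s)) - vv * ratDeriv s
    + cst (1/4) * (vv * ratDeriv (vv * ratDeriv (vv * s)))

lemma opA_add (s t : KK) : opA (s + t) = opA s + opA t := by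
  unfold opA
  simp only [mul_add, rd_add]; ring

lemma opA_cst (c : ℚ) (s : KK) : opA (cst c * s) = cst c * opA s := by
  unfold opA
  have e : ∀ g : KK, vv * (cst c * g) = cst c * (vv * g) := fun g => by ring
  simp only [e, rd_cst]; ring

/-- Laplace transform of `t^j e^{kt}` (times `1/v`). -/
def ell (k j : ℕ) : KK := (j.factorial : KK) * vv ^ j / (1 - (k : KK) * vv) ^ (j + 1)

lemma den_am (k : ℕ) : (1 - (k : KK) * vv) = am (1 - (k : ℚ[X]) * X) := by
  rw [vv_am]; simp

lemma den_poly_ne (k : ℕ) : (1 - (k : ℚ[X]) * X) ≠ 0 := by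
  intro h
  have := congrArg (Polynomial.eval 0) h
  simp at this

lemma den_ne (k : ℕ) : (1 - (k : KK) * vv) ≠ 0 := by
  rw [den_am]; exact am_ne (den_poly_ne k)

lemma ell_succ (k j : ℕ) :
    (1 - (k : KK) * vv) * ell k (j + 1) = ((j : KK) + 1) * vv * ell k j := by
  unfold ell
  have := den_ne k
  field_simp
  rw [Nat.factorial_succ]; push_cast; ring

lemma ell_zero (k : ℕ) : (1 - (k : KK) * vv) * ell k 0 = 1 := by
  unfold ell
  have := den_ne k
  field_simp
  simp

lemma rd_ell (k j : ℕ) :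
    ratDeriv (vv * ell k j) = ((j : KK) + 1) * ell k j + (k : KK) * ell k (j + 1) := by
  have hd := den_ne k
  have e : vv * ell k j = am ((j.factorial : ℚ[X]) * X ^ (j + 1)) /
      am ((1 - (k : ℚ[X]) * X) ^ (j + 1)) := by
    unfold ell
    rw [map_pow, ← den_am, map_mul, map_pow, ← vv_am, map_natCast]; ring
  rw [e, ratDeriv_div _ _ (pow_ne_zero _ (den_poly_ne k))]
  have e2 : derivative ((j.factorial : ℚ[X]) * X ^ (j + 1)) =
      (j.factorial : ℚ[X]) * (((j : ℚ[X]) + 1) * X ^ j) := by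
    rw [derivative_mul]; simp
  have e3 : derivative ((1 - (k : ℚ[X]) * X) ^ (j + 1)) =
      -(((j : ℚ[X]) + 1) * (1 - (k : ℚ[X]) * X) ^ j * (k : ℚ[X])) := by
    rw [derivative_pow]; simp
  rw [e2, e3]
  unfold ell
  simp only [map_sub, map_mul, map_pow, map_neg, map_add, map_one, map_natCast, ← vv_am]
  rw [Nat.factorial_succ]
  push_cast
  field_simp
  ring

/-- Laplace transform on `e^{kt} ℚ[t]`. -/
def lam (k : ℕ) (p : ℚ[X]) : KK := p.sum fun j c => cst c * ell k j

lemma lam_add (k : ℕ) (p q : ℚ[X]) : lam k (p + q) = lam k p + lam k q := by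
  unfold lam
  apply Polynomial.sum_add_index
  · intro i; simp
  · intro i a b; rw [map_add, add_mul]

lemma lam_monomial (k j : ℕ) (c : ℚ) : lam k (monomial j c) = cst c * ell k j := by
  unfold lam
  rw [Polynomial.sum_monomial_index]; simp

lemma lam_zero (k : ℕ) : lam k 0 = 0 := by
  simp [lam]

lemma lam_C (k : ℕ) (c : ℚ) (p : ℚ[X]) : lam k (Polynomial.C c * p) = cst c * lam k p := by
  induction p using Polynomial.induction_on' with
  | add p q hp hq => rw [mul_add, lam_add, lam_add, hp, hq, mul_add]
  | monomial j a => rw [C_mul_monomial, lam_monomial, lam_monomial, map_mul, mul_assoc]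

lemma lam_sub (k : ℕ) (p q : ℚ[X]) : lam k (p - q) = lam k p - lam k q := by
  have h := lam_add k (p - q) q
  rw [sub_add_cancel] at h
  rw [h]; ring

/-- `e^{-kt} ∂ e^{kt}` -/
def dk (k : ℕ) (p : ℚ[X]) : ℚ[X] := derivative p + (k : ℚ[X]) * p

lemma dk_add (k : ℕ) (p q : ℚ[X]) : dk k (p + q) = dk k p + dk k q := by
  simp only [dk, map_add]; ring

lemma lam_natCast_mul (k m : ℕ) (p : ℚ[X]) : lam k ((m : ℚ[X]) * p) = (m : KK) * lam k p := by
  have := lam_C k (m : ℚ) p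
  rw [map_natCast, map_natCast] at this
  exact this

lemma cst_natCast (m : ℕ) : cst (m : ℚ) = (m : KK) := map_natCast cst m

lemma lam1' (k : ℕ) (p : ℚ[X]) : vv * lam k (dk k p) = lam k p - cst (p.eval 0) := by
  induction p using Polynomial.induction_on' with
  | add p q hp hq =>
    rw [dk_add, lam_add, lam_add, mul_add, hp, hq, eval_add, map_add]; ring
  | monomial j a =>
    rw [dk, lam_add, lam_natCast_mul, derivative_monomial, lam_monomial, lam_monomial,
      eval_monomial, map_mul, cst_natCast]
    cases j with
    | zero =>
      have := ell_zero k
      simp only [Nat.cast_zero, mul_zero, zero_mul, pow_zero, mul_one, zero_add]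
      linear_combination (-cst a) * this
    | succ j =>
      have := ell_succ k j
      simp only [Nat.add_sub_cancel, zero_pow (Nat.succ_ne_zero j), mul_zero, map_zero]
      push_cast
      linear_combination (-cst a) * this

lemma lam2' (k : ℕ) (p : ℚ[X]) : lam k (dk k (X * p)) = ratDeriv (vv * lam k p) := by
  induction p using Polynomial.induction_on' with
  | add p q hp hq =>
    rw [mul_add, dk_add, lam_add, lam_add, mul_add, rd_add, hp, hq]
  | monomial j a =>
    rw [dk, lam_add, lam_natCast_mul, X_mul_monomial, derivative_monomial, lam_monomial,
      lam_monomial, lam_monomial, map_mul, cst_natCast, Nat.add_sub_cancel]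
    have e : vv * (cst a * ell k j) = cst a * (vv * ell k j) := by ring
    rw [e, rd_cst, rd_ell]
    push_cast
    ring

/-- The transformed operator. -/
def opT (k : ℕ) (p : ℚ[X]) : ℚ[X] :=
  Polynomial.C (1/4 : ℚ) * dk k (X * (X * p)) - X * dk k p

lemma opA_lam (k : ℕ) (p : ℚ[X]) : opA (lam k p) = lam k (opT k p) := by
  have h1 : vv * ratDeriv (lam k p) = lam k (X * dk k p) := by
    have h := lam2' k p
    rw [rd_vv_mul] at h
    have e : dk k (X * p) = p + X * dk k p := by
      simp only [dk, derivative_mul, derivative_X]; ring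
    rw [e, lam_add] at h
    linear_combination -h
  have h2 : vv * ratDeriv (vv * lam k p) + vv * ratDeriv (vv * ratDeriv (vv * lam k p))
      = lam k (dk k (X * (X * p))) := by
    rw [← lam2', ← lam2', ← mul_add, ← lam_add, ← dk_add]
    have e : X * p + X * dk k (X * p) = dk k (X * (X * p)) := by
      simp only [dk, derivative_mul, derivative_X]; ring
    rw [e, lam1']
    simp [dk]
  rw [opT, lam_sub, lam_C, ← h2, ← h1, opA]
  ring

end OP

namespace OP

/-! ### The formal solution of the transformed equation -/

/-- power series with polynomial coefficients -/
abbrev RR := PowerSeries ℚ[X]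

/-- apply a map to every coefficient -/
def cw {R T : Type*} [CommRing R] [CommRing T] (f : R → T) (g : PowerSeries R) : PowerSeries T :=
  PowerSeries.mk fun n => f (PowerSeries.coeff n g)

lemma coeff_cw {R T : Type*} [CommRing R] [CommRing T] (f : R → T) (g : PowerSeries R) (n : ℕ) :
    PowerSeries.coeff n (cw f g) = f (PowerSeries.coeff n g) := by
  simp [cw]

lemma qD_map {R T : Type*} [CommRing R] [CommRing T] (f : R →+* T) (g : PowerSeries R) :
    qD T (PowerSeries.map f g) = PowerSeries.map f (qD R g) := by
  ext n
  simp [coeff_qD]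

lemma qD_mul {R : Type*} [CommRing R] (f g : PowerSeries R) :
    qD R (f * g) = qD R f * g + f * qD R g := by
  rw [Derivation.leibniz]; simp only [smul_eq_mul]; ring

lemma qD_one {R : Type*} [CommRing R] : qD R (1 : PowerSeries R) = 0 :=
  Derivation.map_one_eq_zero _

lemma qD_sq {R : Type*} [CommRing R] (f : PowerSeries R) : qD R (f ^ 2) = 2 * (f * qD R f) := by
  rw [pow_two, qD_mul]; ring

lemma cc_map {R T : Type*} [CommRing R] [CommRing T] (f : R →+* T) (g : PowerSeries R) :
    PowerSeries.constantCoeff (PowerSeries.map f g) = f (PowerSeries.constantCoeff g) := by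
  rw [← PowerSeries.coeff_zero_eq_constantCoeff_apply, PowerSeries.coeff_map,
    PowerSeries.coeff_zero_eq_constantCoeff_apply]

lemma c0_mul {R : Type*} [CommRing R] (f g : PowerSeries R) :
    PowerSeries.coeff 0 (f * g) = PowerSeries.coeff 0 f * PowerSeries.coeff 0 g := by
  simp

lemma qD_C {R : Type*} [CommRing R] (r : R) : qD R (PowerSeries.C r) = 0 := by
  ext n
  rw [coeff_qD, PowerSeries.coeff_C]
  split_ifs with h <;> simp [h]

/-- constants in the coefficients -/
abbrev hat : PowerSeries ℚ →+* RR := PowerSeries.map (Polynomial.C : ℚ →+* ℚ[X])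

/-- derivative in `t` -/
def pd (f : RR) : RR := cw (fun p : ℚ[X] => derivative p) f

lemma coeff_pd (f : RR) (n : ℕ) :
    PowerSeries.coeff n (pd f) = derivative (PowerSeries.coeff n f) := by
  simp [pd, coeff_cw]

lemma pd_add (f g : RR) : pd (f + g) = pd f + pd g := by
  ext1 n
  simp only [coeff_pd, map_add]

lemma pd_mul (f g : RR) : pd (f * g) = pd f * g + f * pd g := by
  ext1 n
  simp only [coeff_pd, map_add, PowerSeries.coeff_mul, Polynomial.derivative_sum, derivative_mul]
  rw [Finset.sum_add_distrib]

lemma pd_hat (f : PowerSeries ℚ) : pd (hat f) = 0 := by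
  ext1 n
  simp [coeff_pd]

lemma pd_C (p : ℚ[X]) : pd (PowerSeries.C p) = PowerSeries.C (derivative p) := by
  ext1 n
  rw [coeff_pd, PowerSeries.coeff_C, PowerSeries.coeff_C]
  split_ifs <;> simp

lemma pd_one : pd 1 = 0 := by
  have := pd_hat 1
  rwa [map_one] at this

lemma pd_qD (f : RR) : pd (qD _ f) = qD _ (pd f) := by
  ext1 n
  rw [coeff_pd, coeff_qD, coeff_qD, coeff_pd, derivative_mul]
  simp

lemma pd_pow (f g : RR) (h : pd f = f * g) (k : ℕ) : pd (f ^ k) = f ^ k * ((k : RR) * g) := by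
  induction k with
  | zero => simp [pd_one]
  | succ k ih => rw [pow_succ, pd_mul, ih, h]; push_cast; ring

lemma qD_npow {R : Type*} [CommRing R] (f g : PowerSeries R) (h : qD R f = f * g) (k : ℕ) :
    qD R (f ^ k) = f ^ k * ((k : PowerSeries R) * g) := by
  induction k with
  | zero => simp
  | succ k ih => rw [pow_succ, Derivation.leibniz, ih, h]; simp only [smul_eq_mul]; push_cast; ring

lemma qD_uniq {R : Type*} [CommRing R] [IsDomain R] [CharZero R] (f h : PowerSeries R)
    (h0 : PowerSeries.coeff 0 h = 0) (f0 : PowerSeries.coeff 0 f = 0)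
    (e : qD R f = h * f) : f = 0 := by
  ext1 n
  induction n using Nat.strong_induction_on with
  | _ n ih =>
    rcases Nat.eq_zero_or_pos n with rfl | hn
    · simpa using f0
    have e1 := congrArg (PowerSeries.coeff n) e
    rw [coeff_qD, PowerSeries.coeff_mul] at e1
    have e2 : ∑ p ∈ Finset.HasAntidiagonal.antidiagonal n, PowerSeries.coeff p.1 h * PowerSeries.coeff p.2 f = 0 := by
      apply Finset.sum_eq_zero
      intro p hp
      have hp' : p.1 + p.2 = n := by simpa using hp
      by_cases hz : p.1 = 0
      · rw [hz, h0, zero_mul]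
      · rw [ih p.2 (by omega)]; simp
    rw [e2] at e1
    have hn' : (n : R) ≠ 0 := by exact_mod_cast hn.ne'
    simpa [hn'] using e1

/-- `t` -/
def tT : RR := PowerSeries.C (X : ℚ[X])
/-- `t/2` -/
def tU : RR := PowerSeries.C (Polynomial.C (1/2 : ℚ) * X : ℚ[X])
lemma tT_eq : tT = 2 * tU := by
  unfold tT tU
  rw [show (2 : RR) = PowerSeries.C (2 : ℚ[X]) from (map_ofNat PowerSeries.C 2).symm, ← map_mul]
  congr 1
  rw [← mul_assoc, show (2 : ℚ[X]) = Polynomial.C (2 : ℚ) from (map_ofNat Polynomial.C 2).symm,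
    ← map_mul]
  norm_num

lemma pd_tU : 2 * pd tU = 1 := by
  unfold tU
  rw [pd_C, show (2 : RR) = PowerSeries.C (2 : ℚ[X]) from (map_ofNat PowerSeries.C 2).symm, ← map_mul]
  rw [show (2 : ℚ[X]) = Polynomial.C (2 : ℚ) from (map_ofNat Polynomial.C 2).symm]
  simp only [derivative_mul, derivative_C, derivative_X, zero_mul, zero_add, mul_one]
  rw [← map_mul]
  norm_num

lemma pd_tT : pd tT = 1 := by
  unfold tT; rw [pd_C]; simp

lemma qD_tT : qD _ tT = 0 := qD_C _
lemma qD_tU : qD _ tU = 0 := qD_C _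

/-- P -/
abbrev hP : RR := hat (tB ^ 4)
/-- P inverse -/
abbrev hPi : RR := hat ((tB⁻¹) ^ 4)
/-- Q -/
abbrev hQ : RR := hat (tA ^ 4)
/-- E -/
abbrev hE : RR := hat eE
/-- y -/
abbrev hy : RR := hat yy

lemma P_inv : tB ^ 4 * (tB⁻¹) ^ 4 = 1 := by rw [← mul_pow, tB_inv, one_pow]

lemma qD_P : qD ℚ (tB ^ 4) = tB ^ 4 * yy := by
  have := yy_mul
  rw [Derivation.leibniz_pow]
  simp only [smul_eq_mul, nsmul_eq_mul]
  push_cast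
  linear_combination (-tB^3) * this

lemma qD_Q : qD ℚ (tA ^ 4) = tA ^ 4 * (yy + eE) := by
  have := qD_tA
  rw [Derivation.leibniz_pow]
  simp only [smul_eq_mul, nsmul_eq_mul]
  push_cast
  linear_combination (tA^3) * this

lemma qD_Pi : qD ℚ ((tB⁻¹) ^ 4) = - ((tB⁻¹) ^ 4 * yy) := by
  have h := congrArg (qD ℚ) P_inv
  rw [Derivation.leibniz, qD_P] at h
  simp only [smul_eq_mul, Derivation.map_one_eq_zero] at h
  have h2 := P_inv
  linear_combination ((tB⁻¹) ^ 4) * h - (qD ℚ ((tB⁻¹) ^ 4) + (tB⁻¹) ^ 4 * yy) * h2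

lemma hat_qD_Q : qD _ hQ = hQ * (hy + hE) := by
  rw [qD_map, qD_Q, map_mul, map_add]
lemma hat_qD_Pi : qD _ hPi = - (hPi * hy) := by
  rw [qD_map, qD_Pi, map_neg, map_mul]
lemma hat_qD_y : 2 * qD _ hy = hy ^ 2 - hQ * hE := by
  have h := wW_zero
  unfold wW at h
  have h' : 2 * qD ℚ yy = yy ^ 2 - tA ^ 4 * eE := by linear_combination h
  have := congrArg hat h'
  rw [map_mul, map_sub, map_pow, map_mul, map_ofNat] at this
  rw [qD_map]
  exact this

/-- B -/
def bB : RR := hQ + tU * hy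
/-- J -/
def jJ : RR := PowerSeries.invOfUnit bB 1

lemma yy_zero : PowerSeries.coeff 0 yy = 0 := by
  have h := congrArg (PowerSeries.constantCoeff (R := ℚ)) yy_mul
  rw [map_mul, map_mul, coeff_qD_zero, tB_const] at h
  simpa using h

lemma Q_zero : PowerSeries.constantCoeff (tA ^ 4) = 1 := by
  rw [map_pow, tA_const, one_pow]

lemma bB_zero : PowerSeries.constantCoeff bB = 1 := by
  have h := yy_zero
  have h2 := Q_zero
  rw [PowerSeries.coeff_zero_eq_constantCoeff_apply] at h
  unfold bB hQ hy
  rw [map_add, map_mul, cc_map, cc_map, h2, h]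
  simp

lemma bJ : bB * jJ = 1 := by
  unfold jJ
  apply PowerSeries.mul_invOfUnit
  rw [bB_zero]; simp

lemma jJ_zero : PowerSeries.constantCoeff jJ = 1 := by
  have := congrArg PowerSeries.constantCoeff bJ
  rw [map_mul, bB_zero] at this
  simpa using this

/-- a -/
def aA : RR := hQ + hE * (tU ^ 2 - 2 * tU)

lemma two_qD_B : 2 * qD _ bB = 2 * hQ * (hy + hE) + tU * (hy ^ 2 - hQ * hE) := by
  unfold bB
  have := hat_qD_y
  rw [map_add, qD_mul, hat_qD_Q, qD_tU]
  linear_combination tU * this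

lemma two_pd_B : 2 * pd bB = hy := by
  unfold bB
  have := pd_tU
  rw [pd_add, pd_mul, pd_hat, pd_hat]
  linear_combination hy * this

lemma qD_J : qD _ jJ = - jJ ^ 2 * qD _ bB := by
  have h := congrArg (qD _) bJ
  rw [qD_mul, qD_one] at h
  have h2 := bJ
  linear_combination jJ * h - (qD _ jJ) * h2

lemma pd_J : pd jJ = - jJ ^ 2 * pd bB := by
  have h := congrArg pd bJ
  rw [pd_mul, pd_one] at h
  have h2 := bJ
  linear_combination jJ * h - (pd jJ) * h2

/-- M -/
def mM : RR := tT * (jJ - 1)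

lemma mM_eq : mM + tT = tT * jJ := by unfold mM; ring

lemma mM_zero : PowerSeries.constantCoeff mM = 0 := by
  unfold mM; rw [map_mul, map_sub, jJ_zero]; simp

lemma qD_M : qD _ mM = - (tT * jJ ^ 2 * qD _ bB) := by
  have h := congrArg (qD _) mM_eq
  rw [map_add, qD_mul, qD_tT, qD_J] at h
  linear_combination h

lemma pd_M : pd mM + 1 = jJ ^ 2 * hQ := by
  have h := congrArg pd mM_eq
  rw [pd_add, pd_mul, pd_tT, pd_J] at h
  have h2 := two_pd_B
  have h3 := tT_eq
  have h4 := bJ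
  rw [h3] at h
  have e : hQ = bB - tU * hy := by unfold bB; ring
  rw [e]
  linear_combination h - jJ * h4 - tU * jJ^2 * h2

lemma key1 : 1 + qD _ mM = aA * (pd mM + 1) := by
  rw [pd_M, qD_M, tT_eq]
  have h := two_qD_B
  have h4 := bJ
  have h5 : tU * (2 * hQ * (hy + hE) + tU * (hy ^ 2 - hQ * hE)) + aA * hQ = bB ^ 2 := by
    unfold aA bB; ring
  linear_combination (-jJ^2*tU) * h - jJ^2 * h5 - (bB * jJ + 1) * h4

/-- N -/
def nN : RR := hQ ^ 2 * jJ ^ 2 * hPi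

lemma key2 : qD _ nN = aA * pd nN + hE * tU * nN := by
  have h1 : qD _ nN = nN * (2 * (hy + hE) - 2 * jJ * qD _ bB - hy) := by
    unfold nN
    simp only [qD_mul, qD_sq, hat_qD_Q, hat_qD_Pi, qD_J]
    ring
  have h2 : pd nN = - nN * jJ * hy := by
    unfold nN
    have e : hQ ^ 2 * jJ ^ 2 * hPi = hat ((tA ^ 4) ^ 2 * (tB⁻¹) ^ 4) * (jJ * jJ) := by
      rw [map_mul, map_pow]; ring
    rw [e, pd_mul, pd_mul, pd_hat, pd_J]
    have := two_pd_B
    linear_combination (-hat ((tA ^ 4) ^ 2 * (tB⁻¹) ^ 4) * jJ^3) * this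
  rw [h1, h2]
  have h := two_qD_B
  have h4 := bJ
  have h5 : (hy + 2 * hE) * bB - (2 * hQ * (hy + hE) + tU * (hy ^ 2 - hQ * hE)) + aA * hy
      = hE * tU * bB := by
    unfold aA bB; ring
  linear_combination (-nN * jJ) * h + nN * jJ * h5 - nN * (hy + 2 * hE - hE * tU) * h4

/-- exponential of M -/
def xE : RR := (PowerSeries.exp ℚ[X]).subst mM

lemma hsM : PowerSeries.HasSubst mM := PowerSeries.HasSubst.of_constantCoeff_zero' mM_zero

lemma qD_xE : qD _ xE = xE * qD _ mM := by
  have h := PowerSeries.derivative_subst (f := PowerSeries.exp ℚ[X]) hsM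
  rw [PowerSeries.derivative_exp] at h
  unfold xE qD
  simp only [Derivation.smul_apply, smul_eq_mul]
  rw [h]; ring

lemma xE_zero : PowerSeries.constantCoeff xE = 1 := by
  have h1 : PowerSeries.X ∣ (PowerSeries.exp ℚ[X] - 1) := by
    rw [PowerSeries.X_dvd_iff]; simp
  obtain ⟨g, hg⟩ := h1
  have h2 : PowerSeries.exp ℚ[X] = 1 + PowerSeries.X * g := by rw [← hg]; ring
  unfold xE
  rw [h2, ← PowerSeries.coe_substAlgHom hsM, map_add, map_mul, map_one,
    PowerSeries.coe_substAlgHom, PowerSeries.subst_X hsM]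
  have e : PowerSeries.constantCoeff (1 + mM * PowerSeries.subst mM g : RR) = 1 := by
    rw [map_add, map_mul, mM_zero]; simp
  exact e

lemma qD_zero' (f : RR) : PowerSeries.coeff 0 (qD _ f) = 0 := by
  rw [coeff_qD]; simp

lemma pd_xE : pd xE = xE * pd mM := by
  have h : pd xE - xE * pd mM = 0 := by
    apply qD_uniq _ (qD _ mM) (qD_zero' _)
    · rw [map_sub, c0_mul, coeff_pd, coeff_pd]
      rw [PowerSeries.coeff_zero_eq_constantCoeff_apply, PowerSeries.coeff_zero_eq_constantCoeff_apply,
        mM_zero, xE_zero]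
      simp
    · rw [map_sub, ← pd_qD, qD_xE, pd_mul, qD_mul, qD_xE, pd_qD]
      ring
  exact sub_eq_zero.mp h

/-- H_k -/
def hH (k : ℕ) : RR := nN * xE ^ k
/-- G_k -/
def gG (k : ℕ) : RR := PowerSeries.X ^ k * hH k

lemma qD_Xpow {R : Type*} [CommRing R] (k : ℕ) :
    qD R (PowerSeries.X ^ k) = (k : PowerSeries R) * PowerSeries.X ^ k := by
  have h : qD R (PowerSeries.X : PowerSeries R) = PowerSeries.X * 1 := by
    simp [qD]
  rw [qD_npow _ _ h]; ring

lemma pd_Xpow (k : ℕ) : pd (PowerSeries.X ^ k) = 0 := by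
  have := pd_hat (PowerSeries.X ^ k)
  simpa using this

lemma gG_pde (k : ℕ) : qD _ (gG k) = aA * (pd (gG k) + (k : RR) * gG k) + hE * tU * gG k := by
  unfold gG hH
  simp only [pd_mul, qD_mul]
  rw [qD_Xpow, pd_Xpow, qD_npow _ _ qD_xE, pd_pow _ _ pd_xE, key2]
  have h := key1
  linear_combination (PowerSeries.X ^ k * nN * xE ^ k * (k : RR)) * h

lemma cw_opT (k : ℕ) (f : RR) :
    cw (opT k) f = (tU ^ 2 - 2 * tU) * (pd f + (k : RR) * f) + tU * f := by
  ext1 n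
  have e : tU ^ 2 - 2 * tU = PowerSeries.C (Polynomial.C (1/4 : ℚ) * X ^ 2 - X : ℚ[X]) := by
    rw [← tT_eq, tU, tT, ← map_pow, ← map_sub]
    congr 2
    rw [mul_pow, ← map_pow]; norm_num
  have e2 : (k : RR) = PowerSeries.C (k : ℚ[X]) := (map_natCast PowerSeries.C k).symm
  rw [e, e2, tU, coeff_cw, map_add, PowerSeries.coeff_C_mul, PowerSeries.coeff_C_mul, map_add,
    PowerSeries.coeff_C_mul, coeff_pd]
  generalize PowerSeries.coeff n f = p
  have e3 : (Polynomial.C (1/2 : ℚ)) = 2 * Polynomial.C (1/4 : ℚ) := by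
    rw [show (2 : ℚ[X]) = Polynomial.C (2 : ℚ) from (map_ofNat Polynomial.C 2).symm, ← map_mul]
    norm_num
  rw [e3]
  simp only [opT, dk, derivative_mul, derivative_X]
  ring

lemma gG_eq (k : ℕ) : qD _ (gG k) = hQ * cw (dk k) (gG k) + hE * cw (opT k) (gG k) := by
  have h : cw (dk k) (gG k) = pd (gG k) + (k : RR) * gG k := by
    ext1 n
    have e2 : (k : RR) = PowerSeries.C (k : ℚ[X]) := (map_natCast PowerSeries.C k).symm
    rw [coeff_cw, e2, map_add, PowerSeries.coeff_C_mul, coeff_pd, dk]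
  rw [gG_pde, cw_opT, h]
  unfold aA
  ring

/-- evaluation at `t = 0` -/
abbrev ev : RR →+* PowerSeries ℚ := PowerSeries.map (Polynomial.evalRingHom (0 : ℚ))

lemma ev_hat (f : PowerSeries ℚ) : ev (hat f) = f := by
  ext n; simp

lemma ev_J : tA ^ 4 * ev jJ = 1 := by
  have h := congrArg ev bJ
  rw [map_mul, map_one] at h
  have e : ev bB = tA ^ 4 := by
    unfold bB
    rw [map_add, map_mul, ev_hat]
    have : ev tU = 0 := by
      unfold tU; simp
    rw [this]; ring
  rwa [e] at h

lemma ev_N : ev nN = (tB⁻¹) ^ 4 := by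
  unfold nN
  rw [map_mul, map_mul, map_pow, map_pow, ev_hat, ev_hat, ← mul_pow, ev_J]; ring

lemma ev_xE : ev xE = 1 := by
  have hm : ev mM = 0 := by
    unfold mM tT
    rw [map_mul]; simp
  have h : ev xE - 1 = 0 := by
    apply qD_uniq _ 0
    · simp
    · have := congrArg (Polynomial.evalRingHom (0 : ℚ)) xE_zero
      rw [map_sub, PowerSeries.coeff_map, PowerSeries.coeff_zero_eq_constantCoeff_apply, this]
      simp
    · rw [map_sub, qD_map, qD_xE, map_mul, ← qD_map, hm]; simp
  exact sub_eq_zero.mp h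

lemma ev_G (k : ℕ) : ev (gG k) = PowerSeries.X ^ k * (tB⁻¹) ^ 4 := by
  unfold gG hH
  rw [map_mul, map_mul, map_pow, map_pow, ev_N, ev_xE]
  simp

lemma hH_zero (k : ℕ) : PowerSeries.coeff 0 (hH k) = 1 := by
  rw [PowerSeries.coeff_zero_eq_constantCoeff_apply]
  unfold hH nN
  have h1 : PowerSeries.constantCoeff hQ = 1 := by
    have := Q_zero
    rw [cc_map, this]; simp
  have h2 : PowerSeries.constantCoeff hPi = 1 := by
    rw [cc_map, map_pow]
    simp [tB_const]
  rw [map_mul, map_mul, map_mul, map_pow, map_pow, map_pow, jJ_zero, xE_zero, h1, h2]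
  simp

end OP

namespace OP

/-! ### Comparison of two solutions with coefficients in the field of rational functions -/

/-- power series over the rational functions -/
abbrev LL := PowerSeries KK
/-- constants in the coefficients -/
abbrev kh : PowerSeries ℚ →+* LL := PowerSeries.map cst

lemma cw_mul {R T : Type*} [CommRing R] [CommRing T] (i : ℚ →+* R) (j : ℚ →+* T) (φ : R → T)
    (hadd : ∀ a b, φ (a + b) = φ a + φ b) (hc : ∀ c p, φ (i c * p) = j c * φ p)
    (f : PowerSeries ℚ) (g : PowerSeries R) :
    cw φ (PowerSeries.map i f * g) = PowerSeries.map j f * cw φ g := by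
  ext1 n
  rw [coeff_cw, PowerSeries.coeff_mul, PowerSeries.coeff_mul]
  have h := map_sum (AddMonoidHom.mk' φ hadd)
    (fun p : ℕ × ℕ => PowerSeries.coeff p.1 (PowerSeries.map i f) * PowerSeries.coeff p.2 g)
    (Finset.HasAntidiagonal.antidiagonal n)
  refine Eq.trans h ?_
  apply Finset.sum_congr rfl
  intro p _
  change φ _ = _
  rw [PowerSeries.coeff_map, PowerSeries.coeff_map, hc, coeff_cw]

lemma cw_add {R T : Type*} [CommRing R] [CommRing T] (φ : R → T)
    (hadd : ∀ a b, φ (a + b) = φ a + φ b) (f g : PowerSeries R) :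
    cw φ (f + g) = cw φ f + cw φ g := by
  ext1 n
  simp only [coeff_cw, map_add, hadd]

lemma opA_zero : opA 0 = 0 := by
  have h := opA_cst 0 0
  simpa using h

/-- coefficientwise `opA` -/
def oA (U : LL) : LL := cw opA U

lemma oA_kh (f : PowerSeries ℚ) (U : LL) : oA (kh f * U) = kh f * oA U :=
  cw_mul cst cst opA opA_add opA_cst f U

lemma oA_add (U V : LL) : oA (U + V) = oA U + oA V := cw_add opA opA_add U V

lemma oA_C (s : KK) : oA (PowerSeries.C s) = PowerSeries.C (opA s) := by
  ext1 n
  rw [oA, coeff_cw, PowerSeries.coeff_C, PowerSeries.coeff_C]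
  split_ifs
  · rfl
  · exact opA_zero

lemma khat_qD (f : PowerSeries ℚ) : qD KK (kh f) = kh (qD ℚ f) := qD_map cst f

/-- inverse variable -/
def vi : LL := PowerSeries.C (vv⁻¹)

/-- The operator. -/
def oO (U : LL) : LL := kh (tA ^ 4) * vi * U - qD KK U + kh eE * oA U

lemma oO_add (U V : LL) : oO (U + V) = oO U + oO V := by
  unfold oO; rw [oA_add, map_add]; ring

lemma oO_zero : oO 0 = 0 := by
  have h := oO_add 0 0
  rw [add_zero] at h
  exact left_eq_add.mp h

lemma oO_C (c : ℚ) (U : LL) : oO (kh (PowerSeries.C c) * U) = kh (PowerSeries.C c) * oO U := by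
  unfold oO
  rw [oA_kh, qD_mul, khat_qD, qD_C, map_zero]; ring

lemma oO_sum (f : ℕ → LL) (n : ℕ) :
    oO (∑ k ∈ Finset.range n, f k) = ∑ k ∈ Finset.range n, oO (f k) := by
  induction n with
  | zero => simp [oO_zero]
  | succ n ih => rw [Finset.sum_range_succ, Finset.sum_range_succ, oO_add, ih]

/-- transformed solutions -/
def sS (k : ℕ) : LL := cw (lam k) (gG k)

lemma oO_sS (k : ℕ) : oO (sS k) = kh (tA ^ 4) * vi * kh (PowerSeries.X ^ k * (tB⁻¹) ^ 4) := by
  have hlam : ∀ (f : PowerSeries ℚ) (g : RR), cw (lam k) (hat f * g) = kh f * cw (lam k) g :=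
    fun f g => cw_mul Polynomial.C cst (lam k) (lam_add k) (lam_C k) f g
  have h1 : qD KK (sS k) = cw (lam k) (qD _ (gG k)) := by
    ext1 n
    rw [coeff_qD, coeff_cw, coeff_qD, lam_natCast_mul, sS, coeff_cw]
  have h2 : oA (sS k) = cw (lam k) (cw (opT k) (gG k)) := by
    ext1 n
    rw [oA, coeff_cw, sS, coeff_cw, coeff_cw, coeff_cw, opA_lam]
  have h3 : cw (lam k) (cw (dk k) (gG k)) = vi * (sS k - kh (ev (gG k))) := by
    ext1 n
    rw [vi, PowerSeries.coeff_C_mul, map_sub, sS, coeff_cw, coeff_cw, coeff_cw,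
      PowerSeries.coeff_map, PowerSeries.coeff_map]
    have h := lam1' k (PowerSeries.coeff n (gG k))
    have hv := vv_ne
    rw [Polynomial.coe_evalRingHom, ← h]
    field_simp
  unfold oO
  rw [h1, gG_eq, cw_add _ (lam_add k), hlam, hlam, ← h2, h3, ev_G]
  ring

/-- the modular function -/
def xx : PowerSeries ℚ := eE * (tA⁻¹) ^ 4

lemma tA_inv : tA * tA⁻¹ = 1 := PowerSeries.mul_inv_cancel _ (by simp [tA_const])

lemma Q_inv : tA ^ 4 * (tA⁻¹) ^ 4 = 1 := by rw [← mul_pow, tA_inv, one_pow]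

lemma eE_xx : eE = tA ^ 4 * xx := by
  unfold xx
  linear_combination (-eE) * Q_inv

lemma qD_xx : qD ℚ xx = xx * ((1 - xx) * tA ^ 4) := by
  have h := qD_eE
  have h1 := eE_xx
  have h2 : qD ℚ eE = tA ^ 4 * (yy + eE) * xx + tA ^ 4 * qD ℚ xx := by
    conv_lhs => rw [h1, qD_mul, qD_Q]
  have h3 := Q_inv
  have h4 : tA ^ 4 * qD ℚ xx = tA ^ 4 * (xx * ((1 - xx) * tA ^ 4)) := by
    have e : tA ^ 4 * qD ℚ xx = eE * yy + tA ^ 4 * eE - tA ^ 4 * (yy + eE) * xx := by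
      rw [← h, h2]; ring
    rw [e]
    rw [h1]; ring
  have h5 : tA ^ 4 ≠ 0 := pow_ne_zero _ tA_ne
  exact mul_left_cancel₀ h5 h4

lemma eE_zero : PowerSeries.constantCoeff eE = 0 := by
  unfold eE
  rw [map_sub, map_pow, map_pow, tA_const, tB_const]; norm_num

lemma xx_factor : ∃ g : PowerSeries ℚ, xx = PowerSeries.X * g ∧ PowerSeries.constantCoeff g = 16 := by
  have h : PowerSeries.X ∣ eE := by
    rw [PowerSeries.X_dvd_iff]; exact eE_zero
  obtain ⟨g, hg⟩ := h
  refine ⟨g * (tA⁻¹) ^ 4, ?_, ?_⟩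
  · unfold xx; rw [hg]; ring
  · have h1 : PowerSeries.coeff 1 eE = 16 := by
      unfold eE
      rw [map_sub, cA, cB]; norm_num
    rw [hg, show (1 : ℕ) = 0 + 1 from rfl, PowerSeries.coeff_succ_X_mul] at h1
    rw [map_mul, map_pow, ← PowerSeries.coeff_zero_eq_constantCoeff_apply, h1]
    simp [tA_const]

lemma coeff_xx_pow (n : ℕ) : PowerSeries.coeff n (xx ^ n) = 16 ^ n := by
  obtain ⟨g, hg, h0⟩ := xx_factor
  rw [hg, mul_pow]
  have := PowerSeries.coeff_X_pow_mul (g ^ n) n 0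
  rw [zero_add] at this
  rw [this, PowerSeries.coeff_zero_eq_constantCoeff_apply, map_pow, h0]

lemma oO_x (s : KK) (m : ℕ) : oO (PowerSeries.C s * kh (xx ^ m)) = kh (tA ^ 4) *
    (PowerSeries.C (s / vv - (m : KK) * s) * kh (xx ^ m)
      + PowerSeries.C ((m : KK) * s + opA s) * kh (xx ^ (m + 1))) := by
  unfold oO
  rw [mul_comm (PowerSeries.C s) (kh (xx ^ m)), oA_kh, oA_C, qD_mul, khat_qD, qD_C,
    qD_npow _ _ qD_xx]
  rw [show (kh eE : LL) = kh (tA ^ 4 * xx) from by rw [← eE_xx], vi, div_eq_mul_inv]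
  simp only [map_mul, map_sub, map_add, map_pow, map_one, map_natCast]
  ring

/-- Recursion in clean form. -/
def RecS (S : ℕ → KK) : Prop :=
  S 0 = 1 ∧ ∀ m : ℕ, S (m + 1) / vv - ((m : KK) + 1) * S (m + 1) + ((m : KK) * S m + opA (S m)) = 0

lemma oO_T (S : ℕ → KK) (h : RecS S) (n : ℕ) :
    oO (∑ m ∈ Finset.range (n + 1), PowerSeries.C (S m) * kh (xx ^ m)) =
      kh (tA ^ 4) * (vi + PowerSeries.C ((n : KK) * S n + opA (S n)) * kh (xx ^ (n + 1))) := by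
  induction n with
  | zero =>
    rw [zero_add, Finset.sum_range_one, oO_x, h.1, vi]
    simp
  | succ n ih =>
    rw [Finset.sum_range_succ, oO_add, ih, oO_x]
    have h2 := congrArg (PowerSeries.C : KK → LL) (h.2 n)
    rw [map_add (PowerSeries.C : KK →+* LL), map_zero] at h2
    rw [← mul_add]
    congr 1
    push_cast
    linear_combination kh (xx ^ (n + 1)) * h2

/-- partial sums of the coefficients of `P` -/
def pP (n : ℕ) : PowerSeries ℚ :=
  ∑ k ∈ Finset.range (n + 1), PowerSeries.C (PowerSeries.coeff k (tB ^ 4)) * PowerSeries.X ^ k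

lemma pP_dvd (n : ℕ) : PowerSeries.X ^ (n + 1) ∣ tB ^ 4 - pP n := by
  rw [PowerSeries.X_pow_dvd_iff]
  intro m hm
  rw [map_sub, pP, map_sum]
  simp only [PowerSeries.coeff_C_mul, PowerSeries.coeff_X_pow, mul_ite, mul_one, mul_zero]
  rw [Finset.sum_ite_eq, if_pos (Finset.mem_range.mpr hm), sub_self]

lemma oO_G (n : ℕ) :
    oO (∑ k ∈ Finset.range (n + 1), kh (PowerSeries.C (PowerSeries.coeff k (tB ^ 4))) * sS k) =
      kh (tA ^ 4) * vi * kh (pP n * (tB⁻¹) ^ 4) := by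
  rw [oO_sum, pP, Finset.sum_mul, map_sum, Finset.mul_sum]
  apply Finset.sum_congr rfl
  intro k _
  rw [oO_C, oO_sS]
  simp only [map_mul]
  ring

lemma coeff_mul_low {R : Type*} [CommRing R] (A U : PowerSeries R) (j : ℕ)
    (h : ∀ i < j, PowerSeries.coeff i U = 0) :
    PowerSeries.coeff j (A * U) = PowerSeries.coeff 0 A * PowerSeries.coeff j U := by
  rw [PowerSeries.coeff_mul]
  rw [Finset.sum_eq_single (0, j)]
  · intro p hp hne
    have hp' : p.1 + p.2 = j := by simpa using hp
    have : p.2 < j := by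
      rcases Nat.eq_zero_or_pos p.1 with h0 | h0
      · exfalso; apply hne; ext <;> simp <;> omega
      · omega
    rw [h _ this, mul_zero]
  · intro hp
    exfalso; apply hp; simp

lemma vinv_ne (j : ℕ) : vv⁻¹ - (j : KK) ≠ 0 := by
  intro h
  have hv := vv_ne
  apply den_ne j
  have : vv * (vv⁻¹ - (j : KK)) = 1 - (j : KK) * vv := by
    rw [mul_sub, mul_inv_cancel₀ hv]; ring
  rw [← this, h, mul_zero]

lemma oO_uniq (U : LL) (n : ℕ) (h : PowerSeries.X ^ n ∣ oO U) :
    ∀ j < n, PowerSeries.coeff j U = 0 := by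
  intro j
  induction j using Nat.strong_induction_on with
  | _ j ih =>
    intro hj
    have hlow : ∀ i < j, PowerSeries.coeff i U = 0 := fun i hi => ih i hi (by omega)
    have hlow2 : ∀ i < j, PowerSeries.coeff i (oA U) = 0 := fun i hi => by
      rw [oA, coeff_cw, hlow i hi, opA_zero]
    rw [PowerSeries.X_pow_dvd_iff] at h
    have h1 := h j hj
    unfold oO at h1
    rw [map_add, map_sub, coeff_mul_low _ _ _ hlow, coeff_mul_low _ _ _ hlow2, coeff_qD] at h1
    have e1 : PowerSeries.coeff 0 (kh eE) = 0 := by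
      rw [PowerSeries.coeff_map, PowerSeries.coeff_zero_eq_constantCoeff_apply, eE_zero, map_zero]
    have e2 : PowerSeries.coeff 0 (kh (tA ^ 4) * vi) = vv⁻¹ := by
      rw [vi, PowerSeries.coeff_mul_C, PowerSeries.coeff_map,
        PowerSeries.coeff_zero_eq_constantCoeff_apply, Q_zero, map_one, one_mul]
    rw [e1, e2] at h1
    have h2 : (vv⁻¹ - (j : KK)) * PowerSeries.coeff j U = 0 := by linear_combination h1
    exact (mul_eq_zero.mp h2).resolve_left (vinv_ne j)

lemma compare (S : ℕ → KK) (h : RecS S) (n : ℕ) :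
    ∑ m ∈ Finset.range (n + 1), S m * cst (PowerSeries.coeff n (xx ^ m)) =
      ∑ k ∈ Finset.range (n + 1),
        cst (PowerSeries.coeff k (tB ^ 4)) * lam k (PowerSeries.coeff n (gG k)) := by
  have hT := oO_T S h n
  have hG := oO_G n
  generalize hTd : (∑ m ∈ Finset.range (n + 1), PowerSeries.C (S m) * kh (xx ^ m) : LL) = T at hT
  generalize hGd : (∑ k ∈ Finset.range (n + 1),
    kh (PowerSeries.C (PowerSeries.coeff k (tB ^ 4))) * sS k : LL) = G at hG
  have hsub : oO (T - G) = oO T - oO G := by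
    have := oO_add (T - G) G
    rw [sub_add_cancel] at this
    rw [this]; ring
  have hdvd : PowerSeries.X ^ (n + 1) ∣ oO (T - G) := by
    obtain ⟨g, hg, -⟩ := xx_factor
    obtain ⟨r, hr⟩ := pP_dvd n
    have hkX : kh PowerSeries.X = PowerSeries.X := PowerSeries.map_X _
    have e1 : kh (xx ^ (n + 1)) = PowerSeries.X ^ (n + 1) * kh (g ^ (n + 1)) := by
      rw [hg, mul_pow, map_mul, map_pow, hkX]
    have e2 : kh (pP n * (tB⁻¹) ^ 4) = 1 - PowerSeries.X ^ (n + 1) * kh (r * (tB⁻¹) ^ 4) := by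
      have : pP n * (tB⁻¹) ^ 4 = 1 - PowerSeries.X ^ (n + 1) * (r * (tB⁻¹) ^ 4) := by
        have h2 := P_inv
        linear_combination (-(tB⁻¹) ^ 4) * hr + h2
      rw [this, map_sub, map_one, map_mul, map_pow, hkX]
    rw [hsub, hT, hG, e1, e2]
    refine ⟨kh (tA ^ 4) * (PowerSeries.C ((n : KK) * S n + opA (S n)) * kh (g ^ (n + 1))
      + vi * kh (r * (tB⁻¹) ^ 4)), ?_⟩
    ring
  have h0 := oO_uniq _ _ hdvd n (Nat.lt_succ_self n)
  rw [map_sub, sub_eq_zero, ← hTd, ← hGd, map_sum, map_sum] at h0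
  simp only [PowerSeries.map_C, PowerSeries.coeff_C_mul, PowerSeries.coeff_map, sS, coeff_cw] at h0
  exact h0

lemma S_formula (S : ℕ → KK) (h : RecS S) (n : ℕ) :
    ∃ (d : ℕ → ℚ) (p : ℕ → ℚ[X]), cst (16 ^ n) * S n =
      cst (PowerSeries.coeff n (tB ^ 4)) * (1 - (n : KK) * vv)⁻¹ +
      ∑ k ∈ Finset.range n, (lam k (p k) + cst (d k) * S k) := by
  refine ⟨fun m => - PowerSeries.coeff n (xx ^ m),
    fun k => Polynomial.C (PowerSeries.coeff k (tB ^ 4)) * PowerSeries.coeff n (gG k), ?_⟩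
  have h1 := compare S h n
  rw [Finset.sum_range_succ, Finset.sum_range_succ, coeff_xx_pow] at h1
  have h2 : PowerSeries.coeff n (gG n) = 1 := by
    unfold gG
    have := PowerSeries.coeff_X_pow_mul (hH n) n 0
    rw [zero_add] at this
    rw [this, hH_zero]
  have h3 : lam n 1 = (1 - (n : KK) * vv)⁻¹ := by
    have := lam_monomial n 0 1
    rw [Polynomial.monomial_zero_one, map_one, one_mul] at this
    rw [this]
    exact eq_inv_of_mul_eq_one_right (ell_zero n)
  rw [h2, h3] at h1
  rw [Finset.sum_add_distrib]
  simp only [lam_C, map_neg, neg_mul, Finset.sum_neg_distrib]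
  have e : ∀ m, S m * cst (PowerSeries.coeff n (xx ^ m)) = cst (PowerSeries.coeff n (xx ^ m)) * S m :=
    fun m => mul_comm _ _
  simp only [e] at h1
  linear_combination h1

end OP

namespace OP

/-! ### Residues -/

/-- regular at the point `c` -/
def Reg (c : ℚ) (f : KK) : Prop := ∃ p q : ℚ[X], q.eval c ≠ 0 ∧ f = am p / am q

lemma ne_of_eval {c : ℚ} {q : ℚ[X]} (h : q.eval c ≠ 0) : q ≠ 0 := by
  rintro rfl; simp at h

lemma Reg.add {c : ℚ} {f g : KK} (hf : Reg c f) (hg : Reg c g) : Reg c (f + g) := by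
  obtain ⟨p, q, hq, rfl⟩ := hf
  obtain ⟨r, s, hs, rfl⟩ := hg
  refine ⟨p * s + r * q, q * s, ?_, ?_⟩
  · rw [eval_mul]; exact mul_ne_zero hq hs
  · have h1 := am_ne (ne_of_eval hq)
    have h2 := am_ne (ne_of_eval hs)
    simp only [map_add, map_mul]; field_simp

lemma Reg.mul {c : ℚ} {f g : KK} (hf : Reg c f) (hg : Reg c g) : Reg c (f * g) := by
  obtain ⟨p, q, hq, rfl⟩ := hf
  obtain ⟨r, s, hs, rfl⟩ := hg
  refine ⟨p * r, q * s, ?_, ?_⟩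
  · rw [eval_mul]; exact mul_ne_zero hq hs
  · simp only [map_mul]; rw [div_mul_div_comm]

lemma Reg.am (c : ℚ) (p : ℚ[X]) : Reg c (am p) := ⟨p, 1, by simp, by simp⟩

lemma Reg.cst (c a : ℚ) : Reg c (cst a) := Reg.am c _

lemma Reg.zero (c : ℚ) : Reg c 0 := by
  have := Reg.cst c 0
  rwa [map_zero] at this

lemma Reg.sum (c : ℚ) (f : ℕ → KK) (n : ℕ) (h : ∀ k < n, Reg c (f k)) :
    Reg c (∑ k ∈ Finset.range n, f k) := by
  induction n with
  | zero => simpa using Reg.zero c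
  | succ n ih =>
    rw [Finset.sum_range_succ]
    exact (ih fun k hk => h k (by omega)).add (h n (by omega))

lemma Reg.pow {c : ℚ} {f : KK} (hf : Reg c f) (n : ℕ) : Reg c (f ^ n) := by
  induction n with
  | zero =>
    have := Reg.cst c 1
    rw [map_one] at this
    simpa using this
  | succ n ih => rw [pow_succ]; exact ih.mul hf

lemma reg_den (n k : ℕ) (hn : 1 ≤ n) (hk : k ≠ n) :
    Reg (1 / (n : ℚ)) ((1 - (k : KK) * vv)⁻¹) := by
  refine ⟨1, 1 - (k : ℚ[X]) * X, ?_, ?_⟩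
  · have hn' : (n : ℚ) ≠ 0 := by exact_mod_cast (by omega : n ≠ 0)
    simp only [eval_sub, eval_one, eval_mul, eval_natCast, eval_X]
    intro h
    apply hk
    field_simp at h
    have : (n : ℚ) = k := by linarith
    exact_mod_cast this.symm
  · rw [den_am]; simp

lemma reg_lam (n k : ℕ) (hn : 1 ≤ n) (hk : k ≠ n) (p : ℚ[X]) :
    Reg (1 / (n : ℚ)) (lam k p) := by
  induction p using Polynomial.induction_on' with
  | add p q hp hq => rw [lam_add]; exact hp.add hq
  | monomial j a =>
    rw [lam_monomial]
    apply (Reg.cst _ a).mul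
    have e : ell k j = am ((j.factorial : ℚ[X]) * X ^ j) * ((1 - (k : KK) * vv)⁻¹) ^ (j + 1) := by
      unfold ell
      rw [map_mul, map_natCast, map_pow, ← vv_am, inv_pow, div_eq_mul_inv]
    rw [e]
    exact (Reg.am _ _).mul ((reg_den n k hn hk).pow _)

lemma S_solve (S : ℕ → KK) (h : RecS S) (n : ℕ) :
    ∃ (d : ℕ → ℚ) (p : ℕ → ℚ[X]), S n = cst ((16 ^ n)⁻¹) * (
      cst (PowerSeries.coeff n (tB ^ 4)) * (1 - (n : KK) * vv)⁻¹ +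
      ∑ k ∈ Finset.range n, (lam k (p k) + cst (d k) * S k)) := by
  obtain ⟨d, p, e⟩ := S_formula S h n
  refine ⟨d, p, ?_⟩
  rw [← e, ← mul_assoc, ← map_mul, inv_mul_cancel₀ (by positivity), map_one, one_mul]

lemma reg_S (S : ℕ → KK) (h : RecS S) (n : ℕ) (hn : 1 ≤ n) (m : ℕ) (hm : m < n) :
    Reg (1 / (n : ℚ)) (S m) := by
  induction m using Nat.strong_induction_on with
  | _ m ih =>
    obtain ⟨d, p, e⟩ := S_solve S h m
    rw [e]
    apply (Reg.cst _ _).mul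
    apply Reg.add
    · exact (Reg.cst _ _).mul (reg_den n m hn (by omega))
    · apply Reg.sum
      intro k hk
      exact (reg_lam n k hn (by omega) _).add ((Reg.cst _ _).mul (ih k hk (by omega)))

lemma S_pole (S : ℕ → KK) (h : RecS S) (n : ℕ) (hn : 1 ≤ n) :
    ∃ p q : ℚ[X], q.eval (1 / (n : ℚ)) ≠ 0 ∧ S n = am p / am ((1 - (n : ℚ[X]) * X) * q) ∧
      p.eval (1 / (n : ℚ)) = (16 ^ n)⁻¹ * PowerSeries.coeff n (tB ^ 4) * q.eval (1 / (n : ℚ)) := by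
  obtain ⟨d, r, e⟩ := S_solve S h n
  have hreg : Reg (1 / (n : ℚ)) (∑ k ∈ Finset.range n, (lam k (r k) + cst (d k) * S k)) := by
    apply Reg.sum
    intro k hk
    exact (reg_lam n k hn (by omega) _).add ((Reg.cst _ _).mul (reg_S S h n hn k hk))
  obtain ⟨p, q, hq, e2⟩ := hreg
  have hn' : (n : ℚ) ≠ 0 := by exact_mod_cast (by omega : n ≠ 0)
  refine ⟨Polynomial.C ((16 ^ n)⁻¹) * (Polynomial.C (PowerSeries.coeff n (tB ^ 4)) * q
    + p * (1 - (n : ℚ[X]) * X)), q, hq, ?_, ?_⟩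
  · rw [e, e2, map_mul, map_mul, ← den_am, map_add, map_mul, map_mul, ← den_am, ← cst_apply,
      ← cst_apply]
    have h1 := am_ne (ne_of_eval hq)
    have h2 := den_ne n
    field_simp
  · simp only [eval_mul, eval_add, eval_sub, eval_C, eval_one, eval_natCast, eval_X]
    field_simp
    ring

lemma eval_of_eq (f : KK) (p q : ℚ[X]) (hq : q ≠ 0) (hf : f = am p / am q) (v : ℝ)
    (hv : q.eval₂ (algebraMap ℚ ℝ) v ≠ 0) :
    RatFunc.eval (algebraMap ℚ ℝ) v f =
      p.eval₂ (algebraMap ℚ ℝ) v / q.eval₂ (algebraMap ℚ ℝ) v := by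
  have h1 := num_mul_of_eq f p q hq hf
  have hd : f.denom ∣ q := by
    rw [hf]; exact RatFunc.denom_div_dvd p q
  obtain ⟨r, hr⟩ := hd
  have h2 : f.denom.eval₂ (algebraMap ℚ ℝ) v ≠ 0 := by
    intro h0
    apply hv
    rw [hr, eval₂_mul, h0, zero_mul]
  unfold RatFunc.eval
  rw [div_eq_div_iff h2 hv, ← eval₂_mul, ← eval₂_mul, h1]

lemma S_limit (S : ℕ → KK) (h : RecS S) (n : ℕ) (hn : 1 ≤ n) :
    Tendsto (fun v : ℝ => (v - 1 / n) * RatFunc.eval (algebraMap ℚ ℝ) v (S n))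
      (𝓝[≠] ((1 : ℝ) / n))
      (𝓝 (-(((16 ^ n)⁻¹ * PowerSeries.coeff n (tB ^ 4) : ℚ) : ℝ) / n)) := by
  obtain ⟨p, q, hq, e, hp⟩ := S_pole S h n hn
  have hn' : (n : ℝ) ≠ 0 := by exact_mod_cast (by omega : n ≠ 0)
  have hcast : ∀ r : ℚ[X], r.eval₂ (algebraMap ℚ ℝ) ((1 : ℝ) / n) = ((r.eval (1 / (n : ℚ)) : ℚ) : ℝ) := by
    intro r
    have := Polynomial.eval₂_at_apply (p := r) (algebraMap ℚ ℝ) (1 / (n : ℚ))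
    simpa using this
  have hcont : ∀ r : ℚ[X], Continuous fun v : ℝ => r.eval₂ (algebraMap ℚ ℝ) v :=
    fun r => Polynomial.continuous_eval₂ r _
  have hq0 : q.eval₂ (algebraMap ℚ ℝ) ((1 : ℝ) / n) ≠ 0 := by
    rw [hcast]; exact_mod_cast hq
  have hlim : Tendsto (fun v : ℝ => -(p.eval₂ (algebraMap ℚ ℝ) v / q.eval₂ (algebraMap ℚ ℝ) v) / n)
      (𝓝[≠] ((1 : ℝ) / n))
      (𝓝 (-(p.eval₂ (algebraMap ℚ ℝ) ((1 : ℝ) / n) / q.eval₂ (algebraMap ℚ ℝ) ((1 : ℝ) / n)) / n)) := by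
    apply Tendsto.mono_left _ nhdsWithin_le_nhds
    exact ((((hcont p).tendsto _).div ((hcont q).tendsto _) hq0).neg).div_const _
  have hval : p.eval₂ (algebraMap ℚ ℝ) ((1 : ℝ) / n) / q.eval₂ (algebraMap ℚ ℝ) ((1 : ℝ) / n)
      = (((16 ^ n)⁻¹ * PowerSeries.coeff n (tB ^ 4) : ℚ) : ℝ) := by
    rw [div_eq_iff hq0, hcast, hcast, hp]
    push_cast; ring
  rw [hval] at hlim
  refine hlim.congr' ?_
  have hev : ∀ᶠ v in 𝓝[≠] ((1 : ℝ) / n), q.eval₂ (algebraMap ℚ ℝ) v ≠ 0 :=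
    nhdsWithin_le_nhds ((hcont q).continuousAt.eventually_ne hq0)
  filter_upwards [hev, self_mem_nhdsWithin] with v hv hne
  have hne' : v ≠ 1 / n := hne
  have hd : (1 - (n : ℝ) * v) ≠ 0 := by
    intro h0
    apply hne'
    rw [eq_div_iff hn']; linarith
  have hden : ((1 - (n : ℚ[X]) * X) * q).eval₂ (algebraMap ℚ ℝ) v
      = (1 - n * v) * q.eval₂ (algebraMap ℚ ℝ) v := by
    rw [eval₂_mul, eval₂_sub, eval₂_mul, eval₂_one, eval₂_natCast, eval₂_X]
  rw [eval_of_eq (S n) p _ (mul_ne_zero (den_poly_ne n) (ne_of_eval hq)) e v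
    (by rw [hden]; exact mul_ne_zero hd hv), hden]
  field_simp
  ring

lemma rd_zero : ratDeriv 0 = 0 := by
  have := rd_cst 0 0
  simpa using this

lemma opA_smul (s : KK) : opA s = (1/4 : ℚ) • (RatFunc.X * ratDeriv (RatFunc.X * s))
    - RatFunc.X * ratDeriv s
    + (1/4 : ℚ) • (RatFunc.X * ratDeriv (RatFunc.X * ratDeriv (RatFunc.X * s))) := by
  rw [smul_cst, smul_cst]; rfl

end OP

/-- An odd integer `n ≥ 1` is perfect if and only if
`Res_{v=1/n} S n = 1/16^{n-1}` (the residue being the limit of `(v - 1/n) Sₙ(v)` as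
`v → 1/n`; each `Sₙ` has at most a simple pole at `v = 1/n`). -/
theorem odd_perfect_iff_residue_of_S
    (S : ℕ → RatFunc ℚ)
    (hSrec : ∀ m : ℕ,
      S m / RatFunc.X - (m : ℚ) • S m
        + ((m : ℚ) - 1) • (if m = 0 then 0 else S (m - 1))
        + (1/4 : ℚ) • (RatFunc.X * ratDeriv (RatFunc.X * (if m = 0 then 0 else S (m - 1))))
        - RatFunc.X * ratDeriv (if m = 0 then 0 else S (m - 1))
        + (1/4 : ℚ) • (RatFunc.X * ratDeriv (RatFunc.X *
            ratDeriv (RatFunc.X * (if m = 0 then 0 else S (m - 1)))))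
      = (if m = 0 then 1 else 0) / RatFunc.X)
    (n : ℕ) (hn : 1 ≤ n) (hodd : Odd n) :
    Nat.Perfect n ↔
      Tendsto (fun v : ℝ => (v - 1 / n) * RatFunc.eval (algebraMap ℚ ℝ) v (S n))
        (𝓝[≠] ((1 : ℝ) / n)) (𝓝 (1 / 16 ^ (n - 1))) := by
  have hrec : OP.RecS S := by
    constructor
    · have h0 := hSrec 0
      simp only [OP.smul_cst, if_true, mul_zero, OP.rd_zero, Nat.cast_zero, map_zero, zero_mul,
        sub_zero, add_zero] at h0
      have hv : (RatFunc.X : RatFunc ℚ) ≠ 0 := OP.vv_ne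
      field_simp at h0
      exact h0
    · intro m
      have h1 := hSrec (m + 1)
      rw [if_neg (Nat.succ_ne_zero m), if_neg (Nat.succ_ne_zero m), Nat.add_sub_cancel,
        zero_div] at h1
      rw [OP.opA]
      simp only [OP.smul_cst] at h1
      have e1 : OP.cst ((m + 1 : ℕ) : ℚ) = (m : RatFunc ℚ) + 1 := by
        rw [OP.cst_natCast]; push_cast; rfl
      have e2 : OP.cst (((m + 1 : ℕ) : ℚ) - 1) = (m : RatFunc ℚ) := by
        rw [← OP.cst_natCast]; congr 1; push_cast; ring
      rw [e1, e2] at h1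
      linear_combination h1
  have hlim := OP.S_limit S hrec n hn
  have hn' : (n : ℝ) ≠ 0 := by exact_mod_cast (by omega : n ≠ 0)
  have hval : (-(((16 ^ n)⁻¹ * PowerSeries.coeff n (OP.tB ^ 4) : ℚ) : ℝ) / n)
      = ((∑ d ∈ n.divisors, d : ℕ) : ℝ) / (2 * n * 16 ^ (n - 1)) := by
    rw [OP.coeff_P hodd]
    obtain ⟨k, rfl⟩ : ∃ k, n = k + 1 := ⟨n - 1, by omega⟩
    rw [Nat.add_sub_cancel, pow_succ]
    push_cast
    field_simp
    ring
  rw [hval] at hlim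
  have hiff : ((∑ d ∈ n.divisors, d : ℕ) : ℝ) / (2 * n * 16 ^ (n - 1)) = 1 / 16 ^ (n - 1) ↔
      (∑ d ∈ n.divisors, d) = 2 * n := by
    have h16 : (16 : ℝ) ^ (n - 1) ≠ 0 := by positivity
    rw [div_eq_div_iff (by positivity) h16, one_mul]
    constructor
    · intro hh
      have := mul_right_cancel₀ h16 hh
      exact_mod_cast this
    · intro hh
      rw [hh]; push_cast; ring
  rw [Nat.perfect_iff_sum_divisors_eq_two_mul (by omega), ← hiff]
  constructor
  · intro hh
    rw [← hh]; exact hlim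
  · intro hh
    exact tendsto_nhds_unique hlim hh
end
end
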